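/- arXiv:1912.03900 — 2 statements merged into one kernel-verified Lean document; each statement's English description precedes it below -/
import Mathlib

section
/- Every 2-neighborly 6-polytope with at least 13 vertices has at least 17 facets. -/
open Set

/-- A polytope is the convex hull of a finite set of points. -/
def IsPolytope {N : ℕ} (P : Set (Fin N → ℝ)) : Prop :=
  ∃ S : Finset (Fin N → ℝ), P = convexHull ℝ (S : Set (Fin N → ℝ))

/-- The dimension of a set: the dimension of its affine span. -/
noncomputable def pdim {N : ℕ} (P : Set (Fin N → ℝ)) : ℕ :=
  Module.finrank ℝ (affineSpan ℝ P).direction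

/-- A vertex is a 0-dimensional (exposed) face, i.e. an exposed singleton. -/
def IsVertex {N : ℕ} (P : Set (Fin N → ℝ)) (v : Fin N → ℝ) : Prop :=
  IsExposed ℝ P {v}

/-- The set of vertices of `P`. -/
def vertexSet {N : ℕ} (P : Set (Fin N → ℝ)) : Set (Fin N → ℝ) :=
  {v | IsVertex P v}

/-- A facet is a nonempty exposed face of dimension one less than the polytope. -/
def IsFacetOf {N : ℕ} (P F : Set (Fin N → ℝ)) : Prop :=
  IsExposed ℝ P F ∧ F.Nonempty ∧ pdim F + 1 = pdim P

/-- The set of facets of `P`. -/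
def facetSet {N : ℕ} (P : Set (Fin N → ℝ)) : Set (Set (Fin N → ℝ)) :=
  {F | IsFacetOf P F}

/-- A polytope is 2-neighborly if every pair of distinct vertices is the vertex set of
an edge (1-dimensional face), i.e. the segment between them is an exposed face. -/
def TwoNeighborly {N : ℕ} (P : Set (Fin N → ℝ)) : Prop :=
  ∀ u v : Fin N → ℝ, IsVertex P u → IsVertex P v → u ≠ v →
    IsExposed ℝ P (convexHull ℝ {u, v}) ∧ pdim (convexHull ℝ ({u, v} : Set (Fin N → ℝ))) = 1

/-- A polytope is 2-simplicial if every 2-dimensional face has exactly 3 vertices. -/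
def TwoSimplicial {N : ℕ} (P : Set (Fin N → ℝ)) : Prop :=
  ∀ F : Set (Fin N → ℝ), IsExposed ℝ P F → F.Nonempty → pdim F = 2 →
    (vertexSet F).ncard = 3

/-- A polytope is a pyramid if some vertex (the apex) is not in the affine span
of the remaining vertices. -/
def IsPyramid {N : ℕ} (P : Set (Fin N → ℝ)) : Prop :=
  ∃ v : Fin N → ℝ, IsVertex P v ∧ v ∉ affineSpan ℝ (vertexSet P \ {v})

/-- `P` is a pyramid over `Q`: `Q` is a facet of `P` and `P` is the convex hull of `Q`
together with one additional point (the apex) not in the affine span of `Q`. -/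
def IsPyramidOver {N : ℕ} (P Q : Set (Fin N → ℝ)) : Prop :=
  IsFacetOf P Q ∧ ∃ a : Fin N → ℝ, a ∉ affineSpan ℝ Q ∧ P = convexHull ℝ (Q ∪ {a})

/-- `P` is a `k`-fold pyramid over `Q`. -/
def IsKFoldPyramidOver {N : ℕ} : ℕ → Set (Fin N → ℝ) → Set (Fin N → ℝ) → Prop
  | 0, P, Q => P = Q
  | k + 1, P, Q => ∃ R : Set (Fin N → ℝ), IsKFoldPyramidOver k R Q ∧ IsPyramidOver P R

/-- A ranked family of subsets of `X` with the order-theoretic properties of the face lattice of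
a polytope with vertex set `X` in which every two vertices form an edge. -/
structure NeighborlySystem (X : Type*) [Fintype X] [DecidableEq X] where
  faces : Finset (Finset X)
  rk : Finset X → ℕ
  inter_mem : ∀ F ∈ faces, ∀ G ∈ faces, F ∩ G ∈ faces
  rk_lt_rk : ∀ F ∈ faces, ∀ G ∈ faces, F ⊂ G → rk F < rk G
  exists_between : ∀ A ∈ faces, ∀ B ∈ faces, A ⊂ B → rk A + 2 ≤ rk B →
    ∃ F ∈ faces, A ⊂ F ∧ F ⊂ B
  euler : ∀ A ∈ faces, ∀ B ∈ faces, A ⊂ B →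
    ∑ F ∈ faces with A ⊆ F ∧ F ⊆ B, (-1 : ℤ) ^ rk F = 0
  empty_mem : ∅ ∈ faces
  rk_empty : rk ∅ = 0
  pair_mem : ∀ x y, {x, y} ∈ faces

namespace NeighborlySystem

variable {X : Type*} [Fintype X] [DecidableEq X] (S : NeighborlySystem X)

/-- The faces of rank `k` in the interval `[A, B]`. -/
def between (A B : Finset X) (k : ℕ) : Finset (Finset X) :=
  {F ∈ S.faces | A ⊆ F ∧ F ⊆ B ∧ S.rk F = k}

/-- The number of faces of rank `k` in the interval `[A, B]`. -/
def num (A B : Finset X) (k : ℕ) : ℤ := (S.between A B k).card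

variable {S} {A B F G : Finset X} {j k : ℕ}

lemma mem_between : F ∈ S.between A B k ↔ F ∈ S.faces ∧ A ⊆ F ∧ F ⊆ B ∧ S.rk F = k := by
  simp [between]

lemma rk_le_rk (hF : F ∈ S.faces) (hG : G ∈ S.faces) (h : F ⊆ G) : S.rk F ≤ S.rk G := by
  rcases h.eq_or_ssubset with rfl | h
  · exact le_rfl
  · exact (S.rk_lt_rk F hF G hG h).le

lemma eq_of_rk_le (hF : F ∈ S.faces) (hG : G ∈ S.faces) (h : F ⊆ G) (hr : S.rk G ≤ S.rk F) :
    F = G := by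
  rcases h.eq_or_ssubset with rfl | h
  · rfl
  · exact absurd (S.rk_lt_rk F hF G hG h) (by omega)

lemma ssubset_of_rk_lt (h : F ⊆ G) (hr : S.rk F < S.rk G) : F ⊂ G := by
  rcases h.eq_or_ssubset with rfl | h
  · omega
  · exact h

lemma num_left (hA : A ∈ S.faces) (h : A ⊆ B) (hk : S.rk A = k) : S.num A B k = 1 := by
  have : S.between A B k = {A} := by
    ext F
    simp only [mem_between, Finset.mem_singleton]
    constructor
    · rintro ⟨hF, hAF, -, hr⟩
      exact (eq_of_rk_le hA hF hAF (by omega)).symm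
    · rintro rfl
      exact ⟨hA, subset_rfl, h, hk⟩
  simp [num, this]

lemma num_right (hB : B ∈ S.faces) (h : A ⊆ B) (hk : S.rk B = k) : S.num A B k = 1 := by
  have : S.between A B k = {B} := by
    ext F
    simp only [mem_between, Finset.mem_singleton]
    constructor
    · rintro ⟨hF, -, hFB, hr⟩
      exact eq_of_rk_le hF hB hFB (by omega)
    · rintro rfl
      exact ⟨hB, h, subset_rfl, hk⟩
  simp [num, this]

lemma num_eq_zero (hA : A ∈ S.faces) (hk : k < S.rk A) : S.num A B k = 0 := by
  simp only [num, Nat.cast_eq_zero, Finset.card_eq_zero, Finset.eq_empty_iff_forall_notMem,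
    mem_between, not_and]
  intro F hF hAF _ hr
  have := rk_le_rk hA hF hAF
  omega

lemma alternating_sum_num (hA : A ∈ S.faces) (hB : B ∈ S.faces) (h : A ⊆ B)
    (hr : S.rk A < S.rk B) :
    ∑ k ∈ Finset.range (S.rk B + 1), (-1 : ℤ) ^ k * S.num A B k = 0 := by
  rw [← S.euler A hA B hB (ssubset_of_rk_lt h hr),
    ← Finset.sum_fiberwise_of_maps_to (t := Finset.range (S.rk B + 1)) (g := S.rk)]
  · refine Finset.sum_congr rfl fun k _ => ?_
    rw [Finset.sum_congr rfl (g := fun _ => (-1 : ℤ) ^ k)]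
    · rw [Finset.sum_const, num, nsmul_eq_mul, mul_comm, Finset.filter_filter, between]
      simp only [and_assoc]
    · simp +contextual
  · intro F hF
    simp only [Finset.mem_filter] at hF
    have := rk_le_rk hF.1 hB hF.2.2
    simp; omega

lemma sum_num_comm (A B : Finset X) (j k : ℕ) :
    ∑ G ∈ S.between A B j, S.num G B k = ∑ F ∈ S.between A B k, S.num A F j := by
  have := Finset.sum_card_bipartiteAbove_eq_sum_card_bipartiteBelow
    (s := S.between A B j) (t := S.between A B k) (fun G F => G ⊆ F)
  have h1 : ∀ G ∈ S.between A B j,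
      (S.between A B k).bipartiteAbove (fun G F => G ⊆ F) G = S.between G B k := by
    intro G hG
    rw [mem_between] at hG
    ext F
    simp only [Finset.mem_bipartiteAbove, mem_between]
    exact ⟨fun h => ⟨h.1.1, h.2, h.1.2.2⟩, fun h => ⟨⟨h.1, hG.2.1.trans h.2.1, h.2.2⟩, h.2.1⟩⟩
  have h2 : ∀ F ∈ S.between A B k,
      (S.between A B j).bipartiteBelow (fun G F => G ⊆ F) F = S.between A F j := by
    intro F hF
    rw [mem_between] at hF
    ext G
    simp only [Finset.mem_bipartiteBelow, mem_between]
    exact ⟨fun h => ⟨h.1.1, h.1.2.1, h.2, h.1.2.2.2⟩,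
      fun h => ⟨⟨h.1, h.2.1, h.2.2.1.trans hF.2.2.1, h.2.2.2⟩, h.2.2.1⟩⟩
  rw [Finset.sum_congr rfl fun G hG => by rw [h1 G hG],
    Finset.sum_congr (s₁ := S.between A B k) rfl fun F hF => by rw [h2 F hF]] at this
  simp only [num]
  exact_mod_cast this

/-! ### Short intervals -/

lemma num_of_rk_add_two (hA : A ∈ S.faces) (hB : B ∈ S.faces) (h : A ⊆ B)
    (hr : S.rk B = S.rk A + 2) : S.num A B (S.rk A + 1) = 2 := by
  have := alternating_sum_num hA hB h (by omega)
  rw [hr, Finset.sum_range_succ, Finset.sum_range_succ, Finset.sum_range_succ,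
    Finset.sum_eq_zero, num_left hA h rfl, num_right hB h hr] at this
  · rcases Nat.even_or_odd (S.rk A) with he | he
    · simp [pow_add, he.neg_one_pow] at this; omega
    · simp [pow_add, he.neg_one_pow] at this; omega
  · intro k hk
    rw [num_eq_zero hA (by simpa using hk), mul_zero]

lemma num_eq_num_of_rk_add_three (hA : A ∈ S.faces) (hB : B ∈ S.faces) (h : A ⊆ B)
    (hr : S.rk B = S.rk A + 3) : S.num A B (S.rk A + 1) = S.num A B (S.rk A + 2) := by
  have := alternating_sum_num hA hB h (by omega)
  rw [hr, Finset.sum_range_succ, Finset.sum_range_succ, Finset.sum_range_succ,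
    Finset.sum_range_succ, Finset.sum_eq_zero, num_left hA h rfl, num_right hB h hr] at this
  · rcases Nat.even_or_odd (S.rk A) with he | he
    · simp [pow_add, he.neg_one_pow] at this; omega
    · simp [pow_add, he.neg_one_pow] at this; omega
  · intro k hk
    rw [num_eq_zero hA (by simpa using hk), mul_zero]

lemma three_le_num (hA : A ∈ S.faces) (hB : B ∈ S.faces) (h : A ⊆ B)
    (hr : S.rk B = S.rk A + 3) : 3 ≤ S.num A B (S.rk A + 2) := by
  have heq := num_eq_num_of_rk_add_three hA hB h hr
  obtain ⟨F, hF, hAF, hFB⟩ := S.exists_between A hA B hB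
    (ssubset_of_rk_lt (S := S) h (by omega)) (by omega)
  have h1 := S.rk_lt_rk A hA F hF hAF
  have h2 := S.rk_lt_rk F hF B hB hFB
  have hpos : ∃ G, G ∈ S.between A B (S.rk A + 2) := by
    by_contra hc
    push Not at hc
    have h0 : S.num A B (S.rk A + 2) = 0 := by
      simp [num, Finset.eq_empty_iff_forall_notMem, hc]
    have hF' : F ∈ S.between A B (S.rk A + 1) := by
      rw [mem_between]
      refine ⟨hF, hAF.1, hFB.1, ?_⟩
      by_contra hne
      exact hc F (mem_between.2 ⟨hF, hAF.1, hFB.1, by omega⟩)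
    rw [h0] at heq
    simp only [num, Nat.cast_eq_zero, Finset.card_eq_zero] at heq
    simp [heq] at hF'
  have hsub : ∀ G ∈ S.between A B (S.rk A + 2),
      S.between A G (S.rk A + 1) ⊆ S.between A B (S.rk A + 1) ∧
      (S.between A G (S.rk A + 1)).card = 2 := by
    intro G hG
    rw [mem_between] at hG
    refine ⟨fun E hE => ?_, ?_⟩
    · rw [mem_between] at hE ⊢
      exact ⟨hE.1, hE.2.1, hE.2.2.1.trans hG.2.2.1, hE.2.2.2⟩
    · have := num_of_rk_add_two hA hG.1 hG.2.1 hG.2.2.2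
      simp only [num] at this
      exact_mod_cast this
  obtain ⟨G, hG⟩ := hpos
  have hcard : 2 ≤ (S.between A B (S.rk A + 1)).card := by
    rw [← (hsub G hG).2]
    exact Finset.card_le_card (hsub G hG).1
  by_contra hlt
  have hc1 : (S.between A B (S.rk A + 1)).card = 2 := by
    simp only [num] at heq hlt
    omega
  have hc2 : (S.between A B (S.rk A + 2)).card = 2 := by
    simp only [num] at heq hlt
    omega
  have hall : ∀ G ∈ S.between A B (S.rk A + 2),
      S.between A G (S.rk A + 1) = S.between A B (S.rk A + 1) := fun G hG =>
    Finset.eq_of_subset_of_card_le (hsub G hG).1 (by rw [hc1, (hsub G hG).2])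
  obtain ⟨G₁, G₂, hG12, hG⟩ := Finset.card_eq_two.1 hc2
  obtain ⟨E₁, E₂, hE12, hE⟩ := Finset.card_eq_two.1 hc1
  have hG₁ : G₁ ∈ S.between A B (S.rk A + 2) := by simp [hG]
  have hG₂ : G₂ ∈ S.between A B (S.rk A + 2) := by simp [hG]
  have key : ∀ E ∈ S.between A B (S.rk A + 1), E = G₁ ∩ G₂ := by
    intro E hE
    have e1 := hall G₁ hG₁ ▸ hE
    have e2 := hall G₂ hG₂ ▸ hE
    rw [mem_between] at e1 e2 hG₁ hG₂
    have hm := S.inter_mem G₁ hG₁.1 G₂ hG₂.1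
    refine eq_of_rk_le e1.1 hm (Finset.subset_inter e1.2.2.1 e2.2.2.1) ?_
    by_contra hlt
    have hle := rk_le_rk hm hG₁.1 Finset.inter_subset_left
    have q1 := eq_of_rk_le hm hG₁.1 Finset.inter_subset_left (by omega)
    have q2 := eq_of_rk_le hm hG₂.1 Finset.inter_subset_right (by omega)
    exact hG12 (q1.symm.trans q2)
  exact hE12 ((key E₁ (by simp [hE])).trans (key E₂ (by simp [hE])).symm)

/-! ### Faces of small rank are simplices -/

lemma singleton_mem (x : X) : {x} ∈ S.faces := by simpa using S.pair_mem x x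

lemma rk_singleton (x : X) : S.rk {x} = 1 := by
  have h := S.rk_lt_rk ∅ S.empty_mem {x} (singleton_mem x) (by simp)
  by_contra hne
  obtain ⟨F, -, h1, h2⟩ := S.exists_between ∅ S.empty_mem {x} (singleton_mem x) (by simp)
    (by rw [S.rk_empty] at *; omega)
  rw [Finset.ssubset_singleton_iff] at h2
  simp [h2] at h1

lemma rk_pair {x y : X} (hxy : x ≠ y) : S.rk {x, y} = 2 := by
  have hss : ({x} : Finset X) ⊂ {x, y} := by
    rw [Finset.ssubset_iff_of_subset (by simp)]
    exact ⟨y, by simp, by simpa using hxy.symm⟩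
  have h := S.rk_lt_rk {x} (singleton_mem x) {x, y} (S.pair_mem x y) hss
  rw [rk_singleton] at h
  by_contra hne
  obtain ⟨F, -, h1, h2⟩ := S.exists_between {x} (singleton_mem x) {x, y} (S.pair_mem x y) hss
    (by rw [rk_singleton]; omega)
  have c1 := Finset.card_lt_card h1
  have c2 := Finset.card_lt_card h2
  rw [Finset.card_pair hxy] at c2
  simp at c1
  omega

lemma rk_le_card (hF : F ∈ S.faces) : S.rk F ≤ F.card := by
  induction hn : F.card using Nat.strong_induction_on generalizing F with
  | _ n ih =>
    by_cases h0 : F = ∅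
    · simp [h0, S.rk_empty]
    have hne : ({G ∈ S.faces | G ⊂ F} : Finset (Finset X)).Nonempty :=
      ⟨∅, by simp [S.empty_mem, Finset.empty_ssubset, Finset.nonempty_iff_ne_empty, h0]⟩
    obtain ⟨G, hG, hmax⟩ := Finset.exists_max_image _ S.rk hne
    simp only [Finset.mem_filter, and_imp] at hG hmax
    have h1 := ih G.card (hn ▸ Finset.card_lt_card hG.2) hG.1 rfl
    have h2 := Finset.card_lt_card hG.2
    by_contra hlt
    obtain ⟨E, hE, hGE, hEF⟩ := S.exists_between G hG.1 F hF hG.2 (by omega)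
    have := hmax E hE hEF
    have := S.rk_lt_rk G hG.1 E hE hGE
    omega

lemma mem_between_one : F ∈ S.between ∅ B 1 ↔ ∃ x ∈ B, F = {x} := by
  rw [mem_between]
  constructor
  · rintro ⟨hF, -, hFB, hr⟩
    have hne : F.Nonempty := by
      rw [Finset.nonempty_iff_ne_empty]
      rintro rfl
      rw [S.rk_empty] at hr
      omega
    obtain ⟨x, hx⟩ := hne
    exact ⟨x, hFB hx, (eq_of_rk_le (singleton_mem x) hF (by simpa using hx)
      (by rw [hr, rk_singleton])).symm⟩
  · rintro ⟨x, hx, rfl⟩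
    exact ⟨singleton_mem x, by simp, by simpa using hx, rk_singleton x⟩

lemma mem_between_two : F ∈ S.between ∅ B 2 ↔ F ⊆ B ∧ F.card = 2 := by
  rw [mem_between]
  constructor
  · rintro ⟨hF, -, hFB, hr⟩
    have := rk_le_card hF
    obtain ⟨x, y, hxy, hx, hy⟩ : ∃ x y, x ≠ y ∧ x ∈ F ∧ y ∈ F := by
      obtain ⟨x, hx, y, hy, hxy⟩ := Finset.one_lt_card.1 (show 1 < F.card by omega)
      exact ⟨x, y, hxy, hx, hy⟩
    have := eq_of_rk_le (S.pair_mem x y) hF (by simp [Finset.insert_subset_iff, hx, hy])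
      (by rw [hr, rk_pair hxy])
    exact ⟨hFB, by rw [← this, Finset.card_pair hxy]⟩
  · rintro ⟨hFB, hc⟩
    obtain ⟨x, y, hxy, rfl⟩ := Finset.card_eq_two.1 hc
    exact ⟨S.pair_mem x y, by simp, hFB, rk_pair hxy⟩

lemma sum_between_one (f : Finset X → ℤ) :
    ∑ G ∈ S.between ∅ B 1, f G = ∑ x ∈ B, f {x} := by
  have : S.between ∅ B 1 = B.image (fun x => {x}) := by
    ext F
    simp [mem_between_one, eq_comm]
  rw [this, Finset.sum_image (by simp)]

lemma num_one (B : Finset X) : S.num ∅ B 1 = B.card := by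
  have := sum_between_one (S := S) (B := B) (fun _ => 1)
  simp at this
  rw [num]
  exact_mod_cast this

lemma num_two (B : Finset X) : 2 * S.num ∅ B 2 = B.card * (B.card - 1) := by
  have : S.between ∅ B 2 = B.powersetCard 2 := by
    ext F
    simp [mem_between_two, Finset.mem_powersetCard]
  rw [num, this, Finset.card_powersetCard]
  have h2 := Nat.choose_two_right B.card
  have h3 := Nat.triangle_succ (B.card - 1)
  rcases Nat.eq_zero_or_pos B.card with h | h
  · simp [h]
  · have h4 : B.card.choose 2 * 2 = B.card * (B.card - 1) := by
      rw [h2]; exact Nat.div_two_mul_two_of_even (Nat.even_mul_pred_self _)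
    zify [h] at h4
    linarith

lemma num_singleton_two {v : X} (hv : v ∈ B) : S.num {v} B 2 = B.card - 1 := by
  have : S.between {v} B 2 = (B.erase v).image (fun x => {v, x}) := by
    ext F
    simp only [Finset.mem_image, Finset.mem_erase]
    constructor
    · intro h
      have h' := mem_between.1 h
      have h2 := (mem_between_two (S := S)).1 (mem_between.2 ⟨h'.1, by simp, h'.2.2⟩)
      obtain ⟨x, y, hxy, rfl⟩ := Finset.card_eq_two.1 h2.2
      have hm : v = x ∨ v = y := by simpa using h'.2.1
      rcases hm with rfl | rfl
      · exact ⟨y, ⟨hxy.symm, h2.1 (by simp)⟩, rfl⟩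
      · exact ⟨x, ⟨hxy, h2.1 (by simp)⟩, Finset.pair_comm _ _⟩
    · rintro ⟨x, ⟨hx, hxB⟩, rfl⟩
      rw [mem_between]
      exact ⟨S.pair_mem v x, by simp, by simp [Finset.insert_subset_iff, hv, hxB],
        rk_pair hx.symm⟩
  rw [num, this, Finset.card_image_of_injOn, Finset.card_erase_of_mem hv]
  · have := Finset.card_pos.2 ⟨v, hv⟩
    omega
  · intro x hx y hy hxy
    simp only [Finset.coe_erase, Set.mem_sdiff, Set.mem_singleton_iff] at hx hy
    have : x ∈ ({v, y} : Finset X) := by rw [← show ({v, x} : Finset X) = {v, y} from hxy]; simp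
    simp only [Finset.mem_insert, Finset.mem_singleton] at this
    tauto

variable {Q R T W : Finset X} {v : X}

lemma sum_between_of_forall_eq {f : Finset X → ℤ} {c : ℤ}
    (h : ∀ G ∈ S.between A B k, f G = c) : ∑ G ∈ S.between A B k, f G = c * S.num A B k := by
  rw [Finset.sum_congr rfl h, Finset.sum_const, num, nsmul_eq_mul, mul_comm]

lemma mul_num_le_sum_between {f : Finset X → ℤ} {c : ℤ}
    (h : ∀ G ∈ S.between A B k, c ≤ f G) : c * S.num A B k ≤ ∑ G ∈ S.between A B k, f G := by
  rw [← sum_between_of_forall_eq (f := fun _ => c) fun _ _ => rfl]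
  exact Finset.sum_le_sum h

lemma num_zero (B : Finset X) : S.num ∅ B 0 = 1 :=
  num_left S.empty_mem (by simp) S.rk_empty

lemma card_of_rk_three (hF : F ∈ S.faces) (hr : S.rk F = 3) : F.card = 3 := by
  have h := alternating_sum_num S.empty_mem hF (by simp) (by rw [S.rk_empty]; omega)
  have h2 := num_two (S := S) F
  have hc := rk_le_card hF
  simp only [hr, Finset.sum_range_succ, Finset.sum_range_zero, num_zero, num_one,
    num_right hF (Finset.empty_subset F) hr] at h
  rw [hr] at hc
  zify at hc ⊢
  nlinarith

lemma num_two_of_rk_three (hF : F ∈ S.faces) (hr : S.rk F = 3) : S.num ∅ F 2 = 3 := by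
  have h2 := num_two (S := S) F
  rw [card_of_rk_three hF hr] at h2
  norm_num at h2
  omega

lemma num_coatoms_of_rk_four (hF : F ∈ S.faces) (hr : S.rk F = 4) :
    3 * S.num ∅ F 3 = 2 * S.num ∅ F 2 := by
  have h := sum_num_comm (S := S) ∅ F 2 3
  rw [sum_between_of_forall_eq (c := 2), sum_between_of_forall_eq (c := 3)] at h
  · exact h.symm
  · intro G hG
    rw [mem_between] at hG
    exact num_two_of_rk_three hG.1 hG.2.2.2
  · intro G hG
    rw [mem_between] at hG
    have := num_of_rk_add_two hG.1 hF hG.2.2.1 (by omega)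
    rwa [hG.2.2.2] at this

lemma card_of_rk_four (hF : F ∈ S.faces) (hr : S.rk F = 4) : F.card = 4 := by
  have h := alternating_sum_num S.empty_mem hF (by simp) (by rw [S.rk_empty]; omega)
  have h2 := num_two (S := S) F
  have h3 := num_coatoms_of_rk_four hF hr
  have hc := rk_le_card hF
  simp only [hr, Finset.sum_range_succ, Finset.sum_range_zero, num_zero, num_one,
    num_right hF (Finset.empty_subset F) hr] at h
  rw [hr] at hc
  zify at hc ⊢
  have : ((F.card : ℤ) - 4) * (F.card - 3) = 0 := by linarith
  rcases mul_eq_zero.1 this with h | h <;> linarith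

lemma num_two_of_rk_four (hF : F ∈ S.faces) (hr : S.rk F = 4) : S.num ∅ F 2 = 6 := by
  have h2 := num_two (S := S) F
  rw [card_of_rk_four hF hr] at h2
  norm_num at h2
  omega

lemma num_three_of_rk_four (hF : F ∈ S.faces) (hr : S.rk F = 4) : S.num ∅ F 3 = 4 := by
  have h2 := num_coatoms_of_rk_four hF hr
  rw [num_two_of_rk_four hF hr] at h2
  omega

lemma num_singleton_three_of_rk_four (hF : F ∈ S.faces) (hr : S.rk F = 4) (hv : v ∈ F) :
    S.num {v} F 3 = 3 := by
  have h := num_eq_num_of_rk_add_three (singleton_mem v) hF (by simpa using hv)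
    (by rw [rk_singleton, hr])
  rw [rk_singleton, num_singleton_two hv, card_of_rk_four hF hr] at h
  norm_num at h
  exact h.symm

lemma mem_of_card_le_two (h : F.card ≤ 2) : F ∈ S.faces ∧ S.rk F = F.card := by
  have : F.card = 0 ∨ F.card = 1 ∨ F.card = 2 := by omega
  rcases this with h | h | h
  · rw [h]
    rw [Finset.card_eq_zero] at h
    subst h
    exact ⟨S.empty_mem, S.rk_empty⟩
  · rw [h]
    obtain ⟨x, rfl⟩ := Finset.card_eq_one.1 h
    exact ⟨singleton_mem x, rk_singleton x⟩
  · rw [h]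
    obtain ⟨x, y, hxy, rfl⟩ := Finset.card_eq_two.1 h
    exact ⟨S.pair_mem x y, rk_pair hxy⟩

lemma card_eq_rk (hF : F ∈ S.faces) (hr : S.rk F ≤ 4) : F.card = S.rk F := by
  by_cases h4 : S.rk F = 4
  · rw [card_of_rk_four hF h4, h4]
  by_cases h3 : S.rk F = 3
  · rw [card_of_rk_three hF h3, h3]
  by_contra hne
  have hlt : S.rk F < F.card := lt_of_le_of_ne (rk_le_card hF) (Ne.symm hne)
  obtain ⟨G, hGF, hG⟩ := Finset.exists_subset_card_eq (show S.rk F ≤ F.card by omega)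
  have hG' := mem_of_card_le_two (S := S) (F := G) (by omega)
  have := eq_of_rk_le hG'.1 hF hGF (by omega)
  subst this
  omega

lemma mem_of_subset_of_rk_le_four (hF : F ∈ S.faces) (hr : S.rk F ≤ 4) (hGF : G ⊆ F) :
    G ∈ S.faces ∧ S.rk G = G.card := by
  by_cases h2 : G.card ≤ 2
  · exact mem_of_card_le_two h2
  rcases hGF.eq_or_ssubset with rfl | hss
  · exact ⟨hF, (card_eq_rk hF hr).symm⟩
  have hc := Finset.card_lt_card hss
  have hF4 := card_eq_rk hF hr
  have h4 : S.rk F = 4 := by omega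
  have h3 : G.card = 3 := by omega
  have hsub : S.between ∅ F 3 ⊆ F.powersetCard 3 := by
    intro E hE
    rw [mem_between] at hE
    exact Finset.mem_powersetCard.2 ⟨hE.2.2.1, card_of_rk_three hE.1 hE.2.2.2⟩
  have heq := Finset.eq_of_subset_of_card_le hsub (by
    have := num_three_of_rk_four hF h4
    simp only [num] at this
    rw [Finset.card_powersetCard, hF4, h4]
    have h43 : Nat.choose 4 3 = 4 := rfl
    omega)
  have : G ∈ S.between ∅ F 3 := by
    rw [heq]
    exact Finset.mem_powersetCard.2 ⟨hGF, h3⟩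
  rw [mem_between] at this
  exact ⟨this.1, by omega⟩

lemma singleton_subset_of_mem_between (hF : F ∈ S.between {v} B k) : v ∈ F := by
  rw [mem_between] at hF
  simpa using hF.2.1

/-! ### Faces of rank five -/

lemma num_singleton_of_rk_five (hR : R ∈ S.faces) (hr : S.rk R = 5) (hv : v ∈ R) :
    S.num {v} R 3 = 3 * (R.card - 3) ∧ S.num {v} R 4 = 2 * (R.card - 3) := by
  have hvR : {v} ⊆ R := by simpa using hv
  have h := alternating_sum_num (singleton_mem v) hR hvR (by rw [rk_singleton]; omega)
  have hc := sum_num_comm (S := S) {v} R 3 4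
  rw [sum_between_of_forall_eq (c := 2), sum_between_of_forall_eq (c := 3)] at hc
  · simp only [hr, Finset.sum_range_succ, Finset.sum_range_zero, num_right hR hvR hr,
      num_left (singleton_mem v) hvR (rk_singleton v), num_singleton_two hv,
      num_eq_zero (S := S) (B := R) (k := 0) (singleton_mem v) (by rw [rk_singleton]; omega)] at h
    constructor <;> linarith
  · intro G hG
    have hG' := mem_between.1 hG
    exact num_singleton_three_of_rk_four hG'.1 hG'.2.2.2 (singleton_subset_of_mem_between hG)
  · intro G hG
    rw [mem_between] at hG
    have := num_of_rk_add_two hG.1 hR hG.2.2.1 (by omega)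
    rwa [hG.2.2.2] at this

lemma num_four_of_rk_five (hR : R ∈ S.faces) (hr : S.rk R = 5) :
    2 * S.num ∅ R 4 = R.card * (R.card - 3) := by
  have hc := sum_num_comm (S := S) ∅ R 1 4
  rw [sum_between_one, Finset.sum_congr rfl fun v hv => (num_singleton_of_rk_five hR hr hv).2,
    sum_between_of_forall_eq (c := 4)] at hc
  · simp only [Finset.sum_const, nsmul_eq_mul] at hc
    linarith
  · intro G hG
    have hG' := mem_between.1 hG
    rw [num_one, card_of_rk_four hG'.1 hG'.2.2.2]
    rfl

/-! ### Faces of rank six -/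

lemma num_singleton_of_rk_six (hQ : Q ∈ S.faces) (hr : S.rk Q = 6) (hv : v ∈ Q) :
    S.num {v} Q 3 = Q.card - 1 + S.num {v} Q 4 - S.num {v} Q 5 := by
  have hvQ : {v} ⊆ Q := by simpa using hv
  have h := alternating_sum_num (singleton_mem v) hQ hvQ (by rw [rk_singleton]; omega)
  simp only [hr, Finset.sum_range_succ, Finset.sum_range_zero, num_right hQ hvQ hr,
      num_left (singleton_mem v) hvQ (rk_singleton v), num_singleton_two hv,
      num_eq_zero (S := S) (B := Q) (k := 0) (singleton_mem v) (by rw [rk_singleton]; omega)] at h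
  linarith

lemma sum_num_three_five (hQ : Q ∈ S.faces) (hr : S.rk Q = 6) (v : X) :
    ∑ T ∈ S.between {v} Q 3, S.num T Q 5 = 3 * S.num {v} Q 4 := by
  have h1 := sum_num_comm (S := S) {v} Q 4 5
  have h2 := sum_num_comm (S := S) {v} Q 3 5
  rw [sum_between_of_forall_eq (c := 2)] at h1
  · rw [h2]
    have : ∀ G ∈ S.between {v} Q 5, 2 * S.num {v} G 3 = 3 * S.num {v} G 4 := by
      intro G hG
      have hG' := mem_between.1 hG
      have := num_singleton_of_rk_five hG'.1 hG'.2.2.2 (singleton_subset_of_mem_between hG)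
      linarith
    have := Finset.sum_congr rfl this
    rw [← Finset.mul_sum, ← Finset.mul_sum, ← h1] at this
    linarith
  · intro G hG
    rw [mem_between] at hG
    have := num_of_rk_add_two hG.1 hQ hG.2.2.1 (by omega)
    rwa [hG.2.2.2] at this

lemma three_le_num_three_five (hQ : Q ∈ S.faces) (hr : S.rk Q = 6) {A : Finset X}
    (hT : T ∈ S.between A Q 3) : 3 ≤ S.num T Q 5 ∧ S.num T Q 4 = S.num T Q 5 := by
  rw [mem_between] at hT
  have h1 := three_le_num hT.1 hQ hT.2.2.1 (by omega)
  have h2 := num_eq_num_of_rk_add_three hT.1 hQ hT.2.2.1 (by omega)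
  rw [hT.2.2.2] at h1 h2
  exact ⟨h1, h2⟩

lemma num_singleton_three_le_four (hQ : Q ∈ S.faces) (hr : S.rk Q = 6) (v : X) :
    S.num {v} Q 3 ≤ S.num {v} Q 4 := by
  have h := mul_num_le_sum_between fun T hT => (three_le_num_three_five hQ hr (A := {v}) hT).1
  rw [sum_num_three_five hQ hr] at h
  linarith

lemma card_sub_one_le_num_five (hQ : Q ∈ S.faces) (hr : S.rk Q = 6) (hv : v ∈ Q) :
    (Q.card : ℤ) - 1 ≤ S.num {v} Q 5 := by
  have h1 := num_singleton_of_rk_six hQ hr hv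
  have h2 := num_singleton_three_le_four hQ hr v
  linarith

lemma num_five_eq_three (hQ : Q ∈ S.faces) (hr : S.rk Q = 6) (hv : v ∈ Q)
    (he : S.num {v} Q 5 = Q.card - 1) (hT : T ∈ S.between {v} Q 3) : S.num T Q 5 = 3 := by
  have h1 := num_singleton_of_rk_six hQ hr hv
  have h3 : ∑ T ∈ S.between {v} Q 3, (3 : ℤ) = ∑ T ∈ S.between {v} Q 3, S.num T Q 5 := by
    rw [sum_num_three_five hQ hr, sum_between_of_forall_eq (c := 3) (fun _ _ => rfl)]
    linarith
  exact ((Finset.sum_eq_sum_iff_of_le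
    fun T hT => (three_le_num_three_five hQ hr hT).1).1 h3 T hT).symm

lemma sum_card_between_five (Q : Finset X) :
    ∑ R ∈ S.between ∅ Q k, (R.card : ℤ) = ∑ v ∈ Q, S.num {v} Q k := by
  rw [← sum_between_one (f := fun G => S.num G Q k), sum_num_comm]
  simp only [num_one]

lemma card_mul_le_sum_card (hQ : Q ∈ S.faces) (hr : S.rk Q = 6) :
    (Q.card : ℤ) * (Q.card - 1) ≤ ∑ R ∈ S.between ∅ Q 5, (R.card : ℤ) := by
  rw [sum_card_between_five, ← nsmul_eq_mul, ← Finset.sum_const]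
  exact Finset.sum_le_sum fun v hv => card_sub_one_le_num_five hQ hr hv

lemma sum_card_mul_card (hQ : Q ∈ S.faces) (hr : S.rk Q = 6) :
    ∑ R ∈ S.between ∅ Q 5, ((R.card : ℤ) - 3) * (R.card - 4) =
      2 * (Q.card - 3) * (Q.card - 4) := by
  have h := alternating_sum_num S.empty_mem hQ (by simp) (by rw [S.rk_empty]; omega)
  simp only [hr, Finset.sum_range_succ, Finset.sum_range_zero, num_zero, num_one,
    num_right hQ (Finset.empty_subset Q) hr] at h
  have h2 := num_two (S := S) Q
  have h3 := Finset.sum_congr rfl fun v hv => num_singleton_of_rk_six hQ hr (v := v) hv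
  simp only [Finset.sum_sub_distrib, Finset.sum_add_distrib, ← sum_card_between_five,
    Finset.sum_const, nsmul_eq_mul] at h3
  rw [sum_between_of_forall_eq (c := 3) (fun G hG => by
      rw [mem_between] at hG; rw [card_of_rk_three hG.1 hG.2.2.2]; rfl),
    sum_between_of_forall_eq (c := 4) (fun G hG => by
      rw [mem_between] at hG; rw [card_of_rk_four hG.1 hG.2.2.2]; rfl)] at h3
  have h4 := sum_num_comm (S := S) ∅ Q 4 5
  rw [sum_between_of_forall_eq (c := 2) (fun G hG => by
    rw [mem_between] at hG
    have := num_of_rk_add_two hG.1 hQ hG.2.2.1 (by omega)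
    rwa [hG.2.2.2] at this)] at h4
  have h5 : 2 * ∑ R ∈ S.between ∅ Q 5, S.num ∅ R 4 =
      ∑ R ∈ S.between ∅ Q 5, (R.card : ℤ) * (R.card - 3) := by
    rw [Finset.mul_sum]
    refine Finset.sum_congr rfl fun G hG => ?_
    rw [mem_between] at hG
    exact num_four_of_rk_five hG.1 hG.2.2.2
  have h6 : ∑ R ∈ S.between ∅ Q 5, ((R.card : ℤ) - 3) * (R.card - 4) =
      ∑ R ∈ S.between ∅ Q 5, (R.card : ℤ) * (R.card - 3) -
      4 * ∑ R ∈ S.between ∅ Q 5, (R.card : ℤ) + 12 * S.num ∅ Q 5 := by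
    rw [← sum_between_of_forall_eq (S := S) (f := fun _ => 12) (fun _ _ => rfl), Finset.mul_sum,
      ← Finset.sum_sub_distrib, ← Finset.sum_add_distrib]
    exact Finset.sum_congr rfl fun _ _ => by ring
  rw [h6, ← h5, ← h4]
  linarith

/-! ### Faces of rank seven -/

lemma two_mul_num_four_of_rk_seven (hW : W ∈ S.faces) (hr : S.rk W = 7) :
    4 * S.num ∅ W 4 = 2 * (W.card * (W.card - 3)) +
      ∑ R ∈ S.between ∅ W 5, (R.card : ℤ) * (R.card - 3) -
      ∑ Q ∈ S.between ∅ W 6, (Q.card : ℤ) * (Q.card - 3) := by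
  have hv : ∀ v ∈ W, (W.card - 3 : ℤ) - S.num {v} W 3 + S.num {v} W 4 - S.num {v} W 5 +
      S.num {v} W 6 = 0 := by
    intro v hv
    have hvW : {v} ⊆ W := by simpa using hv
    have h := alternating_sum_num (singleton_mem v) hW hvW (by rw [rk_singleton]; omega)
    simp only [hr, Finset.sum_range_succ, Finset.sum_range_zero, num_right hW hvW hr,
      num_left (singleton_mem v) hvW (rk_singleton v), num_singleton_two hv,
      num_eq_zero (S := S) (B := W) (k := 0) (singleton_mem v) (by rw [rk_singleton]; omega)] at h
    linarith
  have he : ∀ e ∈ S.between ∅ W 2, - S.num e W 3 + S.num e W 4 - S.num e W 5 +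
      S.num e W 6 = 0 := by
    intro e he
    rw [mem_between] at he
    have h := alternating_sum_num he.1 hW he.2.2.1 (by omega)
    simp only [hr, Finset.sum_range_succ, Finset.sum_range_zero, num_right hW he.2.2.1 hr,
      num_left he.1 he.2.2.1 he.2.2.2,
      num_eq_zero (S := S) (B := W) (k := 0) he.1 (by omega),
      num_eq_zero (S := S) (B := W) (k := 1) he.1 (by omega)] at h
    linarith
  have hv' := Finset.sum_eq_zero hv
  have he' := Finset.sum_eq_zero he
  have c3 : ∀ G ∈ S.between ∅ W 3, (G.card : ℤ) = 3 := fun G hG => by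
      rw [mem_between] at hG; rw [card_of_rk_three hG.1 hG.2.2.2]; rfl
  have c4 : ∀ G ∈ S.between ∅ W 4, (G.card : ℤ) = 4 := fun G hG => by
      rw [mem_between] at hG; rw [card_of_rk_four hG.1 hG.2.2.2]; rfl
  have d3 : ∀ G ∈ S.between ∅ W 3, S.num ∅ G 2 = 3 := fun G hG => by
      rw [mem_between] at hG; exact num_two_of_rk_three hG.1 hG.2.2.2
  have d4 : ∀ G ∈ S.between ∅ W 4, S.num ∅ G 2 = 6 := fun G hG => by
      rw [mem_between] at hG; exact num_two_of_rk_four hG.1 hG.2.2.2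
  simp only [Finset.sum_sub_distrib, Finset.sum_add_distrib, ← sum_card_between_five,
    Finset.sum_const, nsmul_eq_mul, sum_between_of_forall_eq c3, sum_between_of_forall_eq c4]
    at hv'
  simp only [Finset.sum_sub_distrib, Finset.sum_add_distrib, Finset.sum_neg_distrib,
    sum_num_comm, sum_between_of_forall_eq d3, sum_between_of_forall_eq d4] at he'
  have h2 : ∀ i, ∑ G ∈ S.between ∅ W i, (G.card : ℤ) * (G.card - 3) =
      2 * ∑ G ∈ S.between ∅ W i, S.num ∅ G 2 - 2 * ∑ G ∈ S.between ∅ W i, (G.card : ℤ) := by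
    intro i
    rw [Finset.mul_sum, Finset.mul_sum, ← Finset.sum_sub_distrib]
    refine Finset.sum_congr rfl fun G _ => ?_
    rw [num_two]
    ring
  rw [h2, h2]
  linarith

lemma sum_weight_le (hW : W ∈ S.faces) (hr : S.rk W = 7) :
    12 * ((W.card : ℤ) * (W.card - 3)) ≤ ∑ Q ∈ S.between ∅ W 6, (6 * ((Q.card : ℤ) * (Q.card - 3)) -
      ∑ R ∈ S.between ∅ Q 5, (R.card : ℤ) * (R.card - 3)) := by
  have h1 := two_mul_num_four_of_rk_seven hW hr
  have h2 : 6 * S.num ∅ W 4 ≤ ∑ R ∈ S.between ∅ W 5, (R.card : ℤ) * (R.card - 3) := by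
    have h := mul_num_le_sum_between (S := S) (A := ∅) (B := W) (k := 4) (c := 3)
      (f := fun T => S.num T W 5) (fun T hT => by
        rw [mem_between] at hT
        have h1 := three_le_num hT.1 hW hT.2.2.1 (by omega)
        have h2 := num_eq_num_of_rk_add_three hT.1 hW hT.2.2.1 (by omega)
        rw [hT.2.2.2] at h1 h2
        exact h1.trans_eq h2.symm)
    rw [sum_num_comm] at h
    have h5 : 2 * ∑ R ∈ S.between ∅ W 5, S.num ∅ R 4 =
        ∑ R ∈ S.between ∅ W 5, (R.card : ℤ) * (R.card - 3) := by
      rw [Finset.mul_sum]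
      refine Finset.sum_congr rfl fun G hG => ?_
      rw [mem_between] at hG
      exact num_four_of_rk_five hG.1 hG.2.2.2
    linarith
  have h3 : ∑ Q ∈ S.between ∅ W 6, ∑ R ∈ S.between ∅ Q 5, (R.card : ℤ) * (R.card - 3) =
      2 * ∑ R ∈ S.between ∅ W 5, (R.card : ℤ) * (R.card - 3) := by
    rw [Finset.sum_comm' (t' := S.between ∅ W 5) (s' := fun R => S.between R W 6), Finset.mul_sum]
    · refine Finset.sum_congr rfl fun R hR => ?_
      rw [mem_between] at hR
      have := num_of_rk_add_two hR.1 hW hR.2.2.1 (by omega)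
      rw [hR.2.2.2, num] at this
      rw [Finset.sum_const, nsmul_eq_mul, this]
    · intro Q R
      simp only [mem_between, Finset.empty_subset, true_and]
      constructor
      · rintro ⟨⟨a, b, c⟩, d, e, f⟩
        exact ⟨⟨a, e, b, c⟩, d, e.trans b, f⟩
      · rintro ⟨⟨a, b, c, d⟩, e, f, g⟩
        exact ⟨⟨a, c, d⟩, e, b, g⟩
  rw [Finset.sum_sub_distrib, h3, ← Finset.mul_sum]
  linarith

variable {e : Finset X}

/-! ### Coatoms of an interval -/

lemma rk_inter_lt (hF : F ∈ S.between A B k) (hG : G ∈ S.between A B k) (h : G ≠ F) :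
    F ∩ G ∈ S.faces ∧ S.rk (F ∩ G) < k := by
  rw [mem_between] at hF hG
  have hm := S.inter_mem F hF.1 G hG.1
  refine ⟨hm, ?_⟩
  by_contra hlt
  have q1 := eq_of_rk_le hm hF.1 Finset.inter_subset_left (by omega)
  have q2 := eq_of_rk_le hm hG.1 Finset.inter_subset_right (by omega)
  exact h (q2.symm.trans q1)

lemma between_subset_image_inter (hB : B ∈ S.faces) (hr : S.rk B = k + 2)
    (hF : F ∈ S.between A B (k + 1)) :
    S.between A F k ⊆ ((S.between A B (k + 1)).erase F).image (fun G => F ∩ G) := by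
  intro R hR
  have hF' := mem_between.1 hF
  have hR' := mem_between.1 hR
  have h2 := num_of_rk_add_two hR'.1 hB (hR'.2.2.1.trans hF'.2.2.1) (by omega)
  simp only [num, hR'.2.2.2] at h2
  obtain ⟨G, hG, hGF⟩ := Finset.exists_mem_ne
    (show 1 < (S.between R B (k + 1)).card by omega) F
  rw [mem_between] at hG
  have hG2 : G ∈ S.between A B (k + 1) :=
    mem_between.2 ⟨hG.1, hR'.2.1.trans hG.2.1, hG.2.2⟩
  refine Finset.mem_image.2 ⟨G, Finset.mem_erase.2 ⟨hGF, hG2⟩, ?_⟩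
  have h3 := rk_inter_lt hF hG2 hGF
  exact (eq_of_rk_le hR'.1 h3.1 (Finset.subset_inter hR'.2.2.1 hG.2.1) (by omega)).symm

lemma num_add_one_le (hB : B ∈ S.faces) (hr : S.rk B = k + 2)
    (hF : F ∈ S.between A B (k + 1)) : S.num A F k + 1 ≤ S.num A B (k + 1) := by
  have h := (Finset.card_le_card (between_subset_image_inter hB hr hF)).trans
    Finset.card_image_le
  rw [Finset.card_erase_of_mem hF] at h
  have := Finset.card_pos.2 ⟨F, hF⟩
  simp only [num]
  omega

lemma inter_mem_between_of_num_eq (hB : B ∈ S.faces) (hr : S.rk B = k + 2)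
    (hF : F ∈ S.between A B (k + 1)) (he : S.num A B (k + 1) ≤ S.num A F k + 1)
    (hG : G ∈ S.between A B (k + 1)) (h : G ≠ F) : F ∩ G ∈ S.between A F k := by
  have hsub := between_subset_image_inter hB hr hF
  have hle : (((S.between A B (k + 1)).erase F).image (fun G => F ∩ G)).card ≤
      (S.between A F k).card := by
    refine Finset.card_image_le.trans ?_
    rw [Finset.card_erase_of_mem hF]
    simp only [num] at he
    omega
  rw [Finset.eq_of_subset_of_card_le hsub hle]
  exact Finset.mem_image.2 ⟨G, Finset.mem_erase.2 ⟨h, hG⟩, rfl⟩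

lemma num_eq_sum_ite (A B : Finset X) (k : ℕ) :
    S.num A B k = ∑ T ∈ S.between ∅ B k, if A ⊆ T then 1 else 0 := by
  rw [Finset.sum_ite, Finset.sum_const_zero, add_zero, Finset.sum_const, num, nsmul_eq_mul, mul_one]
  congr 2
  ext T
  simp only [mem_between, Finset.mem_filter, Finset.empty_subset, true_and]
  tauto

/-! ### Edges of a face of rank six -/

lemma euler_edge (hQ : Q ∈ S.faces) (hr : S.rk Q = 6) (he : e ∈ S.between ∅ Q 2) :
    S.num e Q 5 = 2 + S.num e Q 4 - S.num e Q 3 := by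
  rw [mem_between] at he
  have h := alternating_sum_num he.1 hQ he.2.2.1 (by omega)
  simp only [hr, Finset.sum_range_succ, Finset.sum_range_zero, num_right hQ he.2.2.1 hr,
    num_left he.1 he.2.2.1 he.2.2.2,
    num_eq_zero (S := S) (B := Q) (k := 0) he.1 (by omega),
    num_eq_zero (S := S) (B := Q) (k := 1) he.1 (by omega)] at h
  linarith

lemma sum_num_edge (hQ : Q ∈ S.faces) (hr : S.rk Q = 6) (e : Finset X) :
    ∑ R ∈ S.between e Q 5, S.num e R 4 = 2 * S.num e Q 4 := by
  rw [← sum_num_comm]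
  refine sum_between_of_forall_eq fun T hT => ?_
  rw [mem_between] at hT
  have := num_of_rk_add_two hT.1 hQ hT.2.2.1 (by omega)
  rwa [hT.2.2.2] at this

lemma sum_num_edge_three (he : e ∈ S.between ∅ Q 2) :
    ∑ T ∈ S.between e Q 3, S.num T Q 4 = 2 * S.num e Q 4 := by
  rw [sum_num_comm]
  refine sum_between_of_forall_eq fun T hT => ?_
  rw [mem_between] at hT he
  have := num_of_rk_add_two he.1 hT.1 hT.2.1 (by omega)
  rwa [he.2.2.2] at this

lemma three_mul_num_edge_le (hQ : Q ∈ S.faces) (hr : S.rk Q = 6) (he : e ∈ S.between ∅ Q 2) :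
    3 * S.num e Q 3 ≤ 2 * S.num e Q 4 := by
  rw [← sum_num_edge_three he]
  refine mul_num_le_sum_between fun T hT => ?_
  have := three_le_num_three_five hQ hr hT
  omega

/-! ### The number of elements of a face of rank six -/

lemma card_bounds_of_mem_between_five (hr : S.rk Q = 6)
    (hR : R ∈ S.between A Q 5) : 5 ≤ R.card ∧ R.card + 1 ≤ Q.card := by
  rw [mem_between] at hR
  have h1 := rk_le_card hR.1
  have h2 := Finset.card_lt_card (ssubset_of_rk_lt (S := S) hR.2.2.1 (by omega))
  omega

lemma num_five_lower_bound (hQ : Q ∈ S.faces) (hr : S.rk Q = 6) (hR : R ∈ S.between ∅ Q 5) :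
    (R.card : ℤ) * (R.card - 3) + 2 ≤ 2 * S.num ∅ Q 5 := by
  have h1 := num_add_one_le hQ hr hR
  rw [mem_between] at hR
  have h2 := num_four_of_rk_five hR.1 hR.2.2.2
  linarith

lemma card_le_nine (hQ : Q ∈ S.faces) (hr : S.rk Q = 6) (hf : S.num ∅ Q 5 ≤ 15) :
    Q.card ≤ 9 := by
  have h1 := sum_card_mul_card hQ hr
  have h2 := card_mul_le_sum_card hQ hr
  have h3 : 0 ≤ ∑ R ∈ S.between ∅ Q 5, ((R.card : ℤ) - 5) * (R.card - 6) := by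
    refine Finset.sum_nonneg fun R _ => ?_
    rcases le_or_gt R.card 5 with h | h
    · exact mul_nonneg_of_nonpos_of_nonpos (by omega) (by omega)
    · exact mul_nonneg (by omega) (by omega)
  have h4 : ∑ R ∈ S.between ∅ Q 5, ((R.card : ℤ) - 5) * (R.card - 6) =
      ∑ R ∈ S.between ∅ Q 5, ((R.card : ℤ) - 3) * (R.card - 4) -
      4 * ∑ R ∈ S.between ∅ Q 5, (R.card : ℤ) + 18 * S.num ∅ Q 5 := by
    rw [← sum_between_of_forall_eq (S := S) (f := fun _ => 18) (fun _ _ => rfl), Finset.mul_sum,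
      ← Finset.sum_sub_distrib, ← Finset.sum_add_distrib]
    exact Finset.sum_congr rfl fun _ _ => by ring
  have hc := rk_le_card hQ
  by_contra hlt
  have : (10 : ℤ) ≤ Q.card := by omega
  nlinarith

lemma sum_of_card_le_six (hQ : Q ∈ S.faces) (hr : S.rk Q = 6)
    (h6 : ∀ R ∈ S.between ∅ Q 5, R.card ≤ 6) :
    4 * ∑ R ∈ S.between ∅ Q 5, (R.card : ℤ) - 18 * S.num ∅ Q 5 =
      2 * (Q.card - 3) * (Q.card - 4) ∧
    ∑ R ∈ S.between ∅ Q 5, (R.card : ℤ) * (R.card - 3) =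
      8 * ∑ R ∈ S.between ∅ Q 5, (R.card : ℤ) - 30 * S.num ∅ Q 5 := by
  have h56 : ∀ R ∈ S.between ∅ Q 5, R.card = 5 ∨ R.card = 6 := fun R hR => by
    have h1 := card_bounds_of_mem_between_five hr hR
    have h2 := h6 R hR
    omega
  rw [← sum_card_mul_card hQ hr,
    ← sum_between_of_forall_eq (S := S) (f := fun _ => 18) (fun _ _ => rfl),
    ← sum_between_of_forall_eq (S := S) (f := fun _ => 30) (fun _ _ => rfl), Finset.mul_sum,
    Finset.mul_sum, ← Finset.sum_sub_distrib, ← Finset.sum_sub_distrib]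
  constructor
  · refine Finset.sum_congr rfl fun R hR => ?_
    rcases h56 R hR with h | h <;> rw [h] <;> norm_num
  · refine Finset.sum_congr rfl fun R hR => ?_
    rcases h56 R hR with h | h <;> rw [h] <;> norm_num

lemma weight_le (hQ : Q ∈ S.faces) (hr : S.rk Q = 6) (hm : Q.card ≤ 8) :
    6 * ((Q.card : ℤ) * (Q.card - 3)) - ∑ R ∈ S.between ∅ Q 5, (R.card : ℤ) * (R.card - 3) ≤ 96 := by
  have hc := rk_le_card hQ
  have h2 := card_mul_le_sum_card hQ hr
  by_cases h6 : ∀ R ∈ S.between ∅ Q 5, R.card ≤ 6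
  · obtain ⟨h3, h4⟩ := sum_of_card_le_six hQ hr h6
    rw [h4]
    have : Q.card = 6 ∨ Q.card = 7 ∨ Q.card = 8 := by omega
    rcases this with h | h | h
    · have h5 : ∑ R ∈ S.between ∅ Q 5, (R.card : ℤ) = 5 * S.num ∅ Q 5 :=
        sum_between_of_forall_eq fun R hR => by
          have := card_bounds_of_mem_between_five hr hR
          omega
      rw [h] at h2 h3 ⊢
      norm_num at h2 h3 ⊢
      omega
    all_goals
      rw [h] at h2 h3 ⊢
      norm_num at h2 h3 ⊢
      omega
  · push Not at h6
    obtain ⟨R, hR, hR6⟩ := h6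
    have h3 := num_five_lower_bound hQ hr hR
    have h4 := card_bounds_of_mem_between_five hr hR
    have hR7 : R.card = 7 := by omega
    have hQ8 : Q.card = 8 := by omega
    rw [← Finset.add_sum_erase _ _ hR, hR7, hQ8]
    rw [hR7] at h3
    have h5 : ((S.between ∅ Q 5).erase R).card • (10 : ℤ) ≤
        ∑ R ∈ (S.between ∅ Q 5).erase R, (R.card : ℤ) * (R.card - 3) := by
      refine Finset.card_nsmul_le_sum _ _ _ fun G hG => ?_
      have := card_bounds_of_mem_between_five hr (Finset.mem_of_mem_erase hG)
      have : (5 : ℤ) ≤ G.card := by omega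
      nlinarith
    rw [Finset.card_erase_of_mem hR] at h5
    have h6 := Finset.card_pos.2 ⟨R, hR⟩
    simp only [num] at h3
    rw [nsmul_eq_mul] at h5
    push_cast at h3 h5 ⊢
    omega

/-! ### Excluding nine elements, with a large face of rank five -/

lemma card_le_six_of_card_eq_nine (hQ : Q ∈ S.faces) (hr : S.rk Q = 6) (hf : S.num ∅ Q 5 ≤ 15)
    (hm : Q.card = 9) (hR : R ∈ S.between ∅ Q 5) : R.card ≤ 6 := by
  by_contra hR6
  have h3 := num_five_lower_bound hQ hr hR
  have h4 := card_bounds_of_mem_between_five hr hR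
  have hR7 : R.card = 7 := by
    by_contra h7
    have : R.card = 8 := by omega
    rw [this] at h3
    norm_num at h3
    omega
  have hR' := mem_between.1 hR
  have hR4 := num_four_of_rk_five hR'.1 hR'.2.2.2
  rw [hR7] at h3 hR4
  norm_num at h3 hR4
  have hf15 : S.num ∅ Q 5 = 15 := by omega
  have hinter : ∀ G ∈ S.between ∅ Q 5, G ≠ R → R ∩ G ∈ S.between ∅ R 4 := fun G hG hGR =>
    inter_mem_between_of_num_eq hQ hr hR
      (show S.num ∅ Q 5 ≤ S.num ∅ R 4 + 1 by omega) hG hGR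
  obtain ⟨x, y, hxy, hxyQ⟩ : ∃ x y, x ≠ y ∧ Q \ R = {x, y} := by
    rw [← Finset.card_eq_two, Finset.card_sdiff_of_subset hR'.2.2.1]
    omega
  have hxQ : x ∈ Q ∧ x ∉ R := by
    rw [← Finset.mem_sdiff, hxyQ]; simp
  have hyQ : y ∈ Q ∧ y ∉ R := by
    rw [← Finset.mem_sdiff, hxyQ]; simp
  have hcard : ∀ G ∈ S.between ∅ Q 5, G ≠ R → G.card = 4 + (G ∩ {x, y}).card := by
    intro G hG hGR
    have h1 := hinter G hG hGR
    rw [mem_between] at h1 hG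
    have h2 := card_of_rk_four h1.1 h1.2.2.2
    have h3 : G = (R ∩ G) ∪ (G ∩ {x, y}) := by
      rw [← hxyQ]
      ext z
      have := @hG.2.2.1 z
      simp only [Finset.mem_union, Finset.mem_inter, Finset.mem_sdiff]
      tauto
    have h4 : Disjoint (R ∩ G) (G ∩ {x, y}) := by
      rw [← hxyQ, Finset.disjoint_left]
      intro z
      simp only [Finset.mem_inter, Finset.mem_sdiff]
      tauto
    have h5 := Finset.card_union_of_disjoint h4
    rw [← h3] at h5
    omega
  have hle : ∀ G : Finset X, (G ∩ {x, y}).card ≤ 2 := fun G =>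
    (Finset.card_le_card Finset.inter_subset_right).trans (Finset.card_pair hxy).le
  have he : ({x, y} : Finset X) ∈ S.between ∅ Q 2 :=
    mem_between_two.2 ⟨by simp [Finset.insert_subset_iff, hxQ.1, hyQ.1], Finset.card_pair hxy⟩
  have hite : ∀ G ∈ (S.between ∅ Q 5).erase R, (G.card : ℤ) - 5 =
      if ({x, y} : Finset X) ⊆ G then 1 else 0 := by
    intro G hG
    rw [Finset.mem_erase] at hG
    have h1 := hcard G hG.2 hG.1
    have h2 := card_bounds_of_mem_between_five hr hG.2
    split_ifs with h
    · rw [Finset.inter_eq_right.2 h, Finset.card_pair hxy] at h1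
      omega
    · have : (G ∩ {x, y}).card < 2 := by
        rw [← Finset.card_pair hxy]
        exact Finset.card_lt_card ⟨Finset.inter_subset_right,
          fun h' => h (Finset.Subset.trans h' Finset.inter_subset_left)⟩
      omega
  have hRe : S.num {x, y} Q 5 = 5 := by
    have h1 := sum_card_mul_card hQ hr
    rw [← Finset.add_sum_erase _ _ hR, hm, hR7] at h1
    have h2 : ∑ G ∈ (S.between ∅ Q 5).erase R, ((G.card : ℤ) - 3) * (G.card - 4) =
        ∑ G ∈ (S.between ∅ Q 5).erase R, (4 * ((G.card : ℤ) - 5) + 2) := by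
      refine Finset.sum_congr rfl fun G hG => ?_
      have h1 := hite G hG
      have : (G.card : ℤ) = 5 ∨ (G.card : ℤ) = 6 := by
        split_ifs at h1 <;> omega
      rcases this with h | h <;> rw [h] <;> norm_num
    rw [h2, Finset.sum_add_distrib, ← Finset.mul_sum, Finset.sum_const,
      Finset.card_erase_of_mem hR, Finset.sum_congr rfl hite] at h1
    rw [num_eq_sum_ite, ← Finset.add_sum_erase _ _ hR]
    have : ¬ ({x, y} : Finset X) ⊆ R := fun h => hxQ.2 (h (by simp))
    rw [if_neg this]
    have hf' : (S.between ∅ Q 5).card = 15 := by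
      simp only [num] at hf15
      omega
    rw [hf'] at h1
    norm_num at h1 ⊢
    omega
  have hk : ∀ G ∈ S.between {x, y} Q 5, S.num {x, y} G 4 = 4 := by
    intro G hG
    have hG' := mem_between.1 hG
    have hxG : x ∈ G := hG'.2.1 (by simp)
    have hyG : y ∈ G := hG'.2.1 (by simp)
    have hG0 : G ∈ S.between ∅ Q 5 := mem_between.2 ⟨hG'.1, by simp, hG'.2.2⟩
    have hGR : G ≠ R := fun h => hxQ.2 (h ▸ hxG)
    have hG6 : G.card = 6 := by
      rw [hcard G hG0 hGR, Finset.inter_eq_right.2 hG'.2.1, Finset.card_pair hxy]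
    have hi := hinter G hG0 hGR
    rw [mem_between] at hi
    have n0 := num_four_of_rk_five hG'.1 hG'.2.2.2
    have n1 := (num_singleton_of_rk_five hG'.1 hG'.2.2.2 hxG).2
    have n2 := (num_singleton_of_rk_five hG'.1 hG'.2.2.2 hyG).2
    rw [hG6] at n0 n1 n2
    have hs : ∑ T ∈ S.between ∅ G 4, (if T = R ∩ G then 1 else 0 : ℤ) = 1 := by
      rw [Finset.sum_ite_eq' (S.between ∅ G 4) (R ∩ G) (fun _ => (1 : ℤ)), if_pos]
      exact mem_between.2 ⟨hi.1, by simp, Finset.inter_subset_right, hi.2.2.2⟩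
    have hs2 : ∀ T ∈ S.between ∅ G 4, (if T = R ∩ G then 1 else 0 : ℤ) =
        1 - (if {x} ⊆ T then 1 else 0) - (if {y} ⊆ T then 1 else 0) +
          (if {x, y} ⊆ T then 1 else 0) := by
      intro T hT
      rw [mem_between] at hT
      have hTe : T = R ∩ G ↔ x ∉ T ∧ y ∉ T := by
        constructor
        · rintro rfl
          simp [hxQ.2, hyQ.2]
        · rintro ⟨h1, h2⟩
          refine eq_of_rk_le hT.1 hi.1 (fun z hz => Finset.mem_inter.2 ⟨?_, hT.2.2.1 hz⟩) (by omega)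
          by_contra hzR
          have : z ∈ Q \ R := Finset.mem_sdiff.2 ⟨hG'.2.2.1 (hT.2.2.1 hz), hzR⟩
          rw [hxyQ] at this
          simp only [Finset.mem_insert, Finset.mem_singleton] at this
          rcases this with rfl | rfl <;> tauto
      simp only [hTe, Finset.singleton_subset_iff, Finset.insert_subset_iff]
      by_cases h1 : x ∈ T <;> by_cases h2 : y ∈ T <;> simp [h1, h2]
    rw [Finset.sum_congr rfl hs2, Finset.sum_add_distrib, Finset.sum_sub_distrib,
      Finset.sum_sub_distrib, ← num_eq_sum_ite, ← num_eq_sum_ite, ← num_eq_sum_ite, n1, n2,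
      sum_between_of_forall_eq (c := 1) (fun _ _ => rfl)] at hs
    norm_num at hs n0
    omega
  have e1 := euler_edge hQ hr he
  have e2 := sum_num_edge hQ hr {x, y}
  have e3 := three_mul_num_edge_le hQ hr he
  rw [sum_between_of_forall_eq hk, hRe] at e2
  rw [hRe] at e1
  omega

end NeighborlySystem

/-- There is no graph on eight vertices, with degrees four and six, at least one of them four,
and with a family of triangles that contains every edge exactly three times.  Here `N a` is the set
of neighbours of `a`, and `D a b` is the set of `c` such that `abc` is one of the triangles. -/
lemma no_triangulated_graph_on_eight {X : Type*} [DecidableEq X] (Y : Finset X) (hY : Y.card = 8)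
    (N : X → Finset X) (D : X → X → Finset X)
    (hNY : ∀ a ∈ Y, N a ⊆ Y) (hirr : ∀ a ∈ Y, a ∉ N a)
    (hsymm : ∀ a ∈ Y, ∀ b ∈ Y, b ∈ N a → a ∈ N b)
    (hD3 : ∀ a ∈ Y, ∀ b ∈ N a, (D a b).card = 3)
    (hDN : ∀ a ∈ Y, ∀ b ∈ N a, ∀ c ∈ D a b, c ∈ N a ∧ c ∈ N b)
    (hDcomm : ∀ a ∈ Y, ∀ b ∈ N a, D a b = D b a)
    (hDswap : ∀ a ∈ Y, ∀ b ∈ N a, ∀ c ∈ D a b, b ∈ D a c)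
    (hdeg : ∀ a ∈ Y, (N a).card = 4 ∨ (N a).card = 6)
    (s : X) (hs : s ∈ Y) (hs4 : (N s).card = 4) : False := by
  -- the triangles at a vertex of degree four
  have hD : ∀ s ∈ Y, (N s).card = 4 → ∀ x ∈ N s, D s x = (N s).erase x := by
    intro s hs hs4 x hx
    refine Finset.eq_of_subset_of_card_le (fun c hc => ?_) ?_
    · have h := hDN s hs x hx c hc
      refine Finset.mem_erase.2 ⟨?_, h.1⟩
      rintro rfl
      exact hirr c (hNY s hs hx) h.2
    · rw [Finset.card_erase_of_mem hx, hD3 s hs x hx, hs4]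
  have hclique : ∀ s ∈ Y, (N s).card = 4 → ∀ x ∈ N s, (insert s (N s)).erase x ⊆ N x := by
    intro s hs hs4 x hx c hc
    rw [Finset.mem_erase, Finset.mem_insert] at hc
    rcases hc with ⟨hcx, rfl | hc⟩
    · exact hsymm c hs x (hNY c hs hx) hx
    · refine (hDN s hs x hx c ?_).2
      rw [hD s hs hs4 x hx]
      exact Finset.mem_erase.2 ⟨hcx, hc⟩
  have hinsert : ∀ s ∈ Y, (N s).card = 4 → (insert s (N s)).card = 5 := by
    intro s hs hs4
    rw [Finset.card_insert_of_notMem (hirr s hs), hs4]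
  -- two vertices of degree four are not adjacent
  have hadj : ∀ s ∈ Y, (N s).card = 4 → ∀ t ∈ N s, (N t).card = 6 := by
    intro s hs hs4 t ht
    refine (hdeg t (hNY s hs ht)).resolve_left fun ht4 => ?_
    have htY := hNY s hs ht
    have hNt : N t = (insert s (N s)).erase t := by
      refine (Finset.eq_of_subset_of_card_le (hclique s hs hs4 t ht) ?_).symm
      rw [Finset.card_erase_of_mem (Finset.mem_insert_of_mem ht), hinsert s hs hs4, ht4]
    have hst : s ≠ t := by
      rintro rfl
      exact hirr s hs ht
    have hall : ∀ b ∈ insert s (N s), (N b).card = 4 := by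
      intro b hb
      by_cases hbs : b = s
      · rw [hbs, hs4]
      by_cases hbt : b = t
      · rw [hbt, ht4]
      have hbN : b ∈ N s := by simpa [hbs] using hb
      have hbY := hNY s hs hbN
      have hbt' : b ∈ N t := by
        rw [hNt]
        exact Finset.mem_erase.2 ⟨hbt, hb⟩
      have hsb : s ∈ N b := hsymm s hs b hbY hbN
      have htb : t ∈ N b := hsymm t htY b hbY hbt'
      refine (hdeg b hbY).resolve_right fun hb6 => ?_
      -- the remaining vertices of the link of `b`
      have hPcard : (N b \ insert s (N s)).card = 2 := by
        have h1 := Finset.card_sdiff_add_card_inter (N b) (insert s (N s))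
        have h2 : N b ∩ insert s (N s) = (insert s (N s)).erase b := by
          ext z
          rw [Finset.mem_inter, Finset.mem_erase]
          constructor
          · rintro ⟨h1, h2⟩
            refine ⟨?_, h2⟩
            rintro rfl
            exact hirr z hbY h1
          · rintro ⟨h1, h2⟩
            exact ⟨hclique s hs hs4 b hbN (Finset.mem_erase.2 ⟨h1, h2⟩), h2⟩
        rw [h2, Finset.card_erase_of_mem hb, hinsert s hs hs4] at h1
        omega
      have hCcard : ((((insert s (N s)).erase b).erase s).erase t).card = 2 := by
        rw [Finset.card_erase_of_mem, Finset.card_erase_of_mem, Finset.card_erase_of_mem hb,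
          hinsert s hs hs4]
        · simp [Ne.symm hbs]
        · simp [Ne.symm hbt, hst.symm, ht]
      set P := N b \ insert s (N s) with hP
      set C := (((insert s (N s)).erase b).erase s).erase t with hC
      have hDp : ∀ p ∈ P, C ⊆ D b p := by
        intro p hp
        have hp' := Finset.mem_sdiff.1 hp
        have hsub : D b p ⊆ C ∪ P.erase p := by
          intro z hz
          have hzN := hDN b hbY p hp'.1 z hz
          have hzb : z ≠ b := by rintro rfl; exact hirr z hbY hzN.1
          have hzp : z ≠ p := by rintro rfl; exact hirr z (hNY b hbY hp'.1) hzN.2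
          have hzs : z ≠ s := by
            rintro rfl
            have := hsymm p (hNY b hbY hp'.1) z hs hzN.2
            exact hp'.2 (Finset.mem_insert_of_mem this)
          have hzt : z ≠ t := by
            rintro rfl
            have := hsymm p (hNY b hbY hp'.1) z htY hzN.2
            rw [hNt] at this
            exact hp'.2 (Finset.mem_of_mem_erase this)
          simp only [hC, hP, Finset.mem_union, Finset.mem_erase, Finset.mem_sdiff]
          by_cases hzz : z ∈ insert s (N s) <;> tauto
        have hcard := Finset.card_union_le C (P.erase p)
        rw [Finset.card_erase_of_mem hp, hPcard, hCcard] at hcard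
        have := Finset.eq_of_subset_of_card_le hsub (by rw [hD3 b hbY p hp'.1]; omega)
        rw [this]
        exact Finset.subset_union_left
      obtain ⟨c, hc⟩ : C.Nonempty := Finset.card_pos.1 (by omega)
      have hc' : c ≠ t ∧ c ≠ s ∧ c ≠ b ∧ c ∈ insert s (N s) := by
        simpa only [hC, Finset.mem_erase] using hc
      have hcb : c ∈ N b := hclique s hs hs4 b hbN (Finset.mem_erase.2 hc'.2.2)
      have hcs : c ∈ N s := by simpa [hc'.2.1] using hc'.2.2.2
      have hct : c ∈ N t := by
        rw [hNt]
        exact Finset.mem_erase.2 ⟨hc'.1, hc'.2.2.2⟩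
      have h1 : s ∈ D b c := by
        refine hDswap b hbY s hsb c ?_
        rw [hDcomm b hbY s hsb, hD s hs hs4 b hbN]
        exact Finset.mem_erase.2 ⟨hc'.2.2.1, hcs⟩
      have h2 : t ∈ D b c := by
        refine hDswap b hbY t htb c ?_
        rw [hDcomm b hbY t htb, hD t htY ht4 b hbt']
        exact Finset.mem_erase.2 ⟨hc'.2.2.1, hct⟩
      have h3 : P ⊆ D b c := fun p hp =>
        hDswap b hbY p (Finset.mem_sdiff.1 hp).1 c (hDp p hp hc)
      have h4 : insert s (insert t P) ⊆ D b c := by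
        simp only [Finset.insert_subset_iff]
        exact ⟨h1, h2, h3⟩
      have h5 := Finset.card_le_card h4
      rw [hD3 b hbY c hcb, Finset.card_insert_of_notMem, Finset.card_insert_of_notMem] at h5
      · omega
      · simp [hP, ht]
      · simp [hP, hst]
    have hNb : ∀ b ∈ insert s (N s), N b ⊆ insert s (N s) := by
      intro b hb
      by_cases hbs : b = s
      · rw [hbs]
        exact Finset.subset_insert _ _
      have hbN : b ∈ N s := by simpa [hbs] using hb
      have := Finset.eq_of_subset_of_card_le (hclique s hs hs4 b hbN) (by
        rw [Finset.card_erase_of_mem hb, hinsert s hs hs4, hall b hb])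
      rw [← this]
      exact Finset.erase_subset _ _
    have hsubY : insert s (N s) ⊆ Y := Finset.insert_subset hs (hNY s hs)
    have hcomp : (Y \ insert s (N s)).card = 3 := by
      rw [Finset.card_sdiff_of_subset hsubY, hinsert s hs hs4, hY]
    obtain ⟨m, hm⟩ : (Y \ insert s (N s)).Nonempty := Finset.card_pos.1 (by omega)
    have hm' := Finset.mem_sdiff.1 hm
    have hNm : N m ⊆ (Y \ insert s (N s)).erase m := by
      intro z hz
      have hzY := hNY m hm'.1 hz
      refine Finset.mem_erase.2 ⟨?_, Finset.mem_sdiff.2 ⟨hzY, fun hzS => ?_⟩⟩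
      · rintro rfl
        exact hirr z hm'.1 hz
      · exact hm'.2 (hNb z hzS (hsymm m hm'.1 z hzY hz))
    have := Finset.card_le_card hNm
    rw [Finset.card_erase_of_mem hm, hcomp] at this
    rcases hdeg m hm'.1 with h | h <;> omega
  -- count the edges between the neighbours and the other vertices
  have hsubY : insert s (N s) ⊆ Y := Finset.insert_subset hs (hNY s hs)
  have hcomp : (Y \ insert s (N s)).card = 3 := by
    rw [Finset.card_sdiff_of_subset hsubY, hinsert s hs hs4, hY]
  set M := Y \ insert s (N s) with hM
  have hcount : ∑ n ∈ N s, (M ∩ N n).card = ∑ μ ∈ M, (N s ∩ N μ).card := by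
    have := Finset.sum_card_bipartiteAbove_eq_sum_card_bipartiteBelow
      (s := N s) (t := M) (fun n μ => μ ∈ N n)
    rw [Finset.sum_congr (s₁ := N s) rfl (g := fun n => (M ∩ N n).card) fun n _ => ?_,
      Finset.sum_congr (s₁ := M) rfl (g := fun μ => (N s ∩ N μ).card) fun μ hμ => ?_] at this
    · exact this
    · congr 1
      ext z
      have hμY := (Finset.mem_sdiff.1 hμ).1
      simp only [Finset.mem_bipartiteBelow, Finset.mem_inter]
      exact and_congr_right fun hz => ⟨fun h => hsymm z (hNY s hs hz) μ hμY h,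
        fun h => hsymm μ hμY z (hNY s hs hz) h⟩
    · congr 1
  have hleft : ∑ n ∈ N s, (M ∩ N n).card = 8 := by
    rw [Finset.sum_congr rfl (g := fun _ => 2)]
    · simp [hs4]
    intro n hn
    have h6 := hadj s hs hs4 n hn
    have h1 : N n = (insert s (N s)).erase n ∪ (M ∩ N n) := by
      ext z
      constructor
      · intro hz
        by_cases hzS : z ∈ insert s (N s)
        · refine Finset.mem_union_left _ (Finset.mem_erase.2 ⟨?_, hzS⟩)
          rintro rfl
          exact hirr z (hNY s hs hn) hz
        · exact Finset.mem_union_right _ (Finset.mem_inter.2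
            ⟨Finset.mem_sdiff.2 ⟨hNY n (hNY s hs hn) hz, hzS⟩, hz⟩)
      · intro hz
        rcases Finset.mem_union.1 hz with hz | hz
        · exact hclique s hs hs4 n hn hz
        · exact (Finset.mem_inter.1 hz).2
    have h2 : Disjoint ((insert s (N s)).erase n) (M ∩ N n) := by
      rw [Finset.disjoint_left]
      intro z hz hz'
      exact (Finset.mem_sdiff.1 (Finset.mem_inter.1 hz').1).2 (Finset.mem_of_mem_erase hz)
    have h3 := Finset.card_union_of_disjoint h2
    rw [← h1, Finset.card_erase_of_mem (Finset.mem_insert_of_mem hn), hinsert s hs hs4] at h3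
    omega
  have hsplit : ∀ μ ∈ M, N μ ⊆ (N s ∩ N μ) ∪ (M ∩ N μ) ∧ μ ∉ N μ := by
    intro μ hμ
    have hμ' := Finset.mem_sdiff.1 hμ
    refine ⟨fun z hz => ?_, hirr μ hμ'.1⟩
    have hzY := hNY μ hμ'.1 hz
    have hzs : z ≠ s := by
      rintro rfl
      exact hμ'.2 (Finset.mem_insert_of_mem (hsymm μ hμ'.1 z hs hz))
    simp only [hM, Finset.mem_union, Finset.mem_inter, Finset.mem_sdiff, Finset.mem_insert]
    tauto
  set H := M.filter (fun μ => (N μ).card = 6) with hH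
  have hbig : ∀ μ ∈ H, 4 ≤ (N s ∩ N μ).card := by
    intro μ hμ
    rw [hH, Finset.mem_filter] at hμ
    have h1 := Finset.card_le_card (hsplit μ hμ.1).1
    have h2 := Finset.card_union_le (N s ∩ N μ) (M ∩ N μ)
    have h3 : M ∩ N μ ⊆ M.erase μ := fun z hz => Finset.mem_erase.2
      ⟨by rintro rfl; exact (hsplit z hμ.1).2 (Finset.mem_inter.1 hz).2, (Finset.mem_inter.1 hz).1⟩
    have h4 := Finset.card_le_card h3
    rw [Finset.card_erase_of_mem hμ.1, hcomp] at h4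
    omega
  have hsmall : ∀ μ ∈ M.filter (fun μ => ¬ (N μ).card = 6), 4 - H.card ≤ (N s ∩ N μ).card := by
    intro μ hμ
    rw [Finset.mem_filter] at hμ
    have hμY := (Finset.mem_sdiff.1 hμ.1).1
    have hμ4 := (hdeg μ hμY).resolve_right hμ.2
    have h1 := Finset.card_le_card (hsplit μ hμ.1).1
    have h2 := Finset.card_union_le (N s ∩ N μ) (M ∩ N μ)
    have h3 : M ∩ N μ ⊆ H := fun z hz => Finset.mem_filter.2
      ⟨(Finset.mem_inter.1 hz).1, hadj μ hμY hμ4 z (Finset.mem_inter.1 hz).2⟩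
    have h4 := Finset.card_le_card h3
    omega
  have h1 := Finset.card_nsmul_le_sum _ _ _ hbig
  have h2 := Finset.card_nsmul_le_sum _ _ _ hsmall
  have h3 := Finset.sum_filter_add_sum_filter_not M (fun μ => (N μ).card = 6)
    (fun μ => (N s ∩ N μ).card)
  have h4 := Finset.card_filter_add_card_filter_not (s := M) (fun μ => (N μ).card = 6)
  rw [← hH] at h3 h4
  rw [← hcount, hleft] at h3
  rw [hcomp] at h4
  have h5 : H.card ≤ 3 := by omega
  have h6 : (M.filter (fun μ => ¬ (N μ).card = 6)).card = 3 - H.card := by omega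
  rw [h6] at h2
  generalize H.card = h at *
  simp only [smul_eq_mul] at h1 h2
  interval_cases h <;> omega

lemma Finset.card_powersetCard_three_filter {X : Type*} [DecidableEq X] {B : Finset X} {v : X}
    (hv : v ∈ B) :
    ((B.powersetCard 3).filter (fun T => v ∈ T)).card = (B.card - 1).choose 2 := by
  have : (B.powersetCard 3).filter (fun T => v ∈ T) =
      ((B.erase v).powersetCard 2).image (insert v) := by
    ext T
    simp only [Finset.mem_filter, Finset.mem_powersetCard, Finset.mem_image]
    constructor
    · rintro ⟨⟨h1, h2⟩, h3⟩
      exact ⟨T.erase v, ⟨Finset.erase_subset_erase _ h1, by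
        rw [Finset.card_erase_of_mem h3, h2]⟩, Finset.insert_erase h3⟩
    · rintro ⟨U, ⟨h1, h2⟩, rfl⟩
      have hvU : v ∉ U := fun h => by simpa using h1 h
      exact ⟨⟨Finset.insert_subset hv (h1.trans (Finset.erase_subset _ _)), by
        rw [Finset.card_insert_of_notMem hvU, h2]⟩, by simp⟩
  rw [this, Finset.card_image_of_injOn, Finset.card_powersetCard, Finset.card_erase_of_mem hv]
  intro U hU V hV hUV
  simp only [Finset.mem_coe, Finset.mem_powersetCard] at hU hV
  have hvU : v ∉ U := fun h => by simpa using hU.1 h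
  have hvV : v ∉ V := fun h => by simpa using hV.1 h
  rw [← Finset.erase_insert hvU, ← Finset.erase_insert hvV, show insert v U = insert v V from hUV]

namespace NeighborlySystem

variable {X : Type*} [Fintype X] [DecidableEq X] {S : NeighborlySystem X}
variable {A B F G Q R T W e : Finset X} {j k : ℕ} {v : X}

/-! ### Links of small faces -/

/-- The elements of `B` that can be added to the face `A`. -/
def extensions (S : NeighborlySystem X) (A B : Finset X) : Finset X :=
  {x ∈ B \ A | insert x A ∈ S.faces}

lemma mem_extensions {x : X} : x ∈ S.extensions A B ↔ x ∈ B ∧ x ∉ A ∧ insert x A ∈ S.faces := by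
  simp [extensions, and_assoc]

lemma card_extensions (hA : A ∈ S.faces) (hAB : A ⊆ B) (hr : S.rk A ≤ 3) :
    S.num A B (S.rk A + 1) = (S.extensions A B).card := by
  have hAc := card_eq_rk hA (by omega)
  have : S.between A B (S.rk A + 1) = (S.extensions A B).image (fun x => insert x A) := by
    ext F
    simp only [Finset.mem_image, mem_extensions, mem_between]
    constructor
    · rintro ⟨hF, hAF, hFB, hrF⟩
      have hc := card_eq_rk hF (by omega)
      obtain ⟨x, hx, rfl⟩ := (Finset.exists_eq_insert_iff (s := A) (t := F)).2 ⟨hAF, by omega⟩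
      exact ⟨x, ⟨hFB (by simp), hx, hF⟩, rfl⟩
    · rintro ⟨x, ⟨hxB, hxA, hF⟩, rfl⟩
      refine ⟨hF, Finset.subset_insert _ _, Finset.insert_subset hxB hAB, ?_⟩
      have h1 := rk_le_card hF
      rw [Finset.card_insert_of_notMem hxA] at h1
      have h2 := S.rk_lt_rk A hA _ hF (Finset.ssubset_insert hxA)
      omega
  rw [num, this, Finset.card_image_of_injOn]
  intro x hx y hy hxy
  simp only [Finset.mem_coe, mem_extensions] at hx hy
  have : x ∈ insert y A := by rw [← show insert x A = insert y A from hxy]; simp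
  simpa [hx.2.1] using this

/-- The three-element subsets of `B` through `v` that are not faces. -/
def nonfaces (S : NeighborlySystem X) (v : X) (B : Finset X) : Finset (Finset X) :=
  (B.powersetCard 3).filter (fun T => v ∈ T) \ S.between {v} B 3

lemma mem_nonfaces : T ∈ S.nonfaces v B ↔ T ⊆ B ∧ T.card = 3 ∧ v ∈ T ∧ T ∉ S.faces := by
  simp only [nonfaces, Finset.mem_sdiff, Finset.mem_filter, Finset.mem_powersetCard, mem_between,
    Finset.singleton_subset_iff]
  constructor
  · rintro ⟨⟨⟨h1, h2⟩, h3⟩, h4⟩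
    refine ⟨h1, h2, h3, fun h => h4 ⟨h, h3, h1, ?_⟩⟩
    have h5 := rk_le_card h
    rw [← h2, card_eq_rk h (by omega)]
  · rintro ⟨h1, h2, h3, h4⟩
    exact ⟨⟨⟨h1, h2⟩, h3⟩, fun h => h4 h.1⟩

lemma card_nonfaces (hv : v ∈ B) :
    ((S.nonfaces v B).card : ℤ) = (B.card - 1).choose 2 - S.num {v} B 3 := by
  have hsub : S.between {v} B 3 ⊆ (B.powersetCard 3).filter (fun T => v ∈ T) := by
    intro T hT
    rw [mem_between] at hT
    exact Finset.mem_filter.2 ⟨Finset.mem_powersetCard.2 ⟨hT.2.2.1, card_of_rk_three hT.1 hT.2.2.2⟩,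
      by simpa using hT.2.1⟩
  have h := Finset.card_sdiff_add_card_eq_card hsub
  rw [Finset.card_powersetCard_three_filter hv] at h
  rw [nonfaces, num]
  omega

/-! ### Excluding nine elements -/

lemma card_ne_nine (hQ : Q ∈ S.faces) (hr : S.rk Q = 6) (hf : S.num ∅ Q 5 ≤ 15) :
    Q.card ≠ 9 := by
  intro hm
  have h6 : ∀ R ∈ S.between ∅ Q 5, R.card ≤ 6 := fun R hR =>
    card_le_six_of_card_eq_nine hQ hr hf hm hR
  have hs := (sum_of_card_le_six hQ hr h6).1
  have hs2 := card_mul_le_sum_card hQ hr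
  rw [hm] at hs hs2
  norm_num at hs hs2
  have hs78 : ∑ R ∈ S.between ∅ Q 5, (R.card : ℤ) = 78 := by omega
  obtain ⟨v, hv, hφ⟩ : ∃ v ∈ Q, S.num {v} Q 5 = 8 := by
    by_contra hc
    push Not at hc
    have : Q.card • (9 : ℤ) ≤ ∑ v ∈ Q, S.num {v} Q 5 := by
      refine Finset.card_nsmul_le_sum _ _ _ fun v hv => ?_
      have h1 := card_sub_one_le_num_five hQ hr hv
      have h2 := hc v hv
      rw [hm] at h1
      norm_num at h1
      omega
    rw [← sum_card_between_five, hs78, hm] at this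
    norm_num at this
  have hφ' : S.num {v} Q 5 = Q.card - 1 := by rw [hφ, hm]; norm_num
  have hT3 : ∀ T ∈ S.between {v} Q 3, S.num T Q 4 = 3 := fun T hT => by
    rw [(three_le_num_three_five hQ hr hT).2, num_five_eq_three hQ hr hv hφ' hT]
  have hpair : ∀ w ∈ Q.erase v, ({v, w} : Finset X) ∈ S.between ∅ Q 2 := fun w hw => by
    rw [Finset.mem_erase] at hw
    exact mem_between_two.2 ⟨by simp [Finset.insert_subset_iff, hv, hw.2],
      Finset.card_pair (Ne.symm hw.1)⟩
  have hext : ∀ w ∈ Q.erase v, S.num {v, w} Q 3 = (S.extensions {v, w} Q).card := fun w hw => by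
    have h1 := mem_between.1 (hpair w hw)
    have h2 := card_extensions h1.1 h1.2.2.1 (by omega)
    rwa [h1.2.2.2] at h2
  -- the degrees in the link of `v`
  have htet : ∀ w ∈ Q.erase v, 3 * S.num {v, w} Q 3 = 2 * S.num {v, w} Q 4 := fun w hw => by
    rw [← sum_num_edge_three (hpair w hw), sum_between_of_forall_eq]
    intro T hT
    rw [mem_between] at hT
    exact hT3 T (mem_between.2 ⟨hT.1, (by simp : ({v} : Finset X) ⊆ {v, w}).trans hT.2.1, hT.2.2⟩)
  have hdeg : ∀ w ∈ Q.erase v, S.num {v, w} Q 3 = 4 ∨ S.num {v, w} Q 3 = 6 := fun w hw => by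
    have h1 := htet w hw
    have h2 := euler_edge hQ hr (hpair w hw)
    have h3 := hext w hw
    have h4 : S.extensions {v, w} Q ⊆ (Q.erase v).erase w := fun x hx => by
      rw [mem_extensions] at hx
      simp only [Finset.mem_insert, Finset.mem_singleton, not_or] at hx
      exact Finset.mem_erase.2 ⟨hx.2.1.2, Finset.mem_erase.2 ⟨hx.2.1.1, hx.1⟩⟩
    have h5 := Finset.card_le_card h4
    rw [Finset.card_erase_of_mem hw, Finset.card_erase_of_mem hv, hm] at h5
    have h6 : 3 ≤ S.num {v, w} Q 3 := by
      have hpos : 0 < S.num {v, w} Q 5 := by omega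
      obtain ⟨R, hR⟩ := Finset.card_pos.1 (show 0 < (S.between {v, w} Q 5).card by
        simpa [num] using hpos)
      rw [mem_between] at hR
      have h0 := mem_between.1 (hpair w hw)
      have h7 := three_le_num h0.1 hR.1 hR.2.1 (by omega)
      have h8 := num_eq_num_of_rk_add_three h0.1 hR.1 hR.2.1 (by omega)
      rw [h0.2.2.2] at h7 h8
      have h9 : S.between {v, w} R 3 ⊆ S.between {v, w} Q 3 := fun T hT => by
        rw [mem_between] at hT ⊢
        exact ⟨hT.1, hT.2.1, hT.2.2.1.trans hR.2.2.1, hT.2.2.2⟩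
      have h10 := Finset.card_le_card h9
      simp only [num, Nat.reduceAdd] at h7 h8 ⊢
      omega
    omega
  -- some degree is four
  obtain ⟨s, hs, hs4⟩ : ∃ s ∈ Q.erase v, S.num {v, s} Q 3 = 4 := by
    by_contra hc
    push Not at hc
    have h5 : ∀ e ∈ S.between {v} Q 2, S.num e Q 5 = 5 := by
      intro e he
      have he0 := mem_between.1 he
      obtain ⟨a, b, hab, rfl⟩ := Finset.card_eq_two.1 (mem_between_two.1
        (mem_between.2 ⟨he0.1, Finset.empty_subset _, he0.2.2⟩)).2
      have hvm : v = a ∨ v = b := by simpa using he0.2.1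
      obtain ⟨w, hw, he'⟩ : ∃ w ∈ Q.erase v, ({a, b} : Finset X) = {v, w} := by
        rcases hvm with rfl | rfl
        · exact ⟨b, Finset.mem_erase.2 ⟨hab.symm, he0.2.2.1 (by simp)⟩, rfl⟩
        · exact ⟨a, Finset.mem_erase.2 ⟨hab, he0.2.2.1 (by simp)⟩, Finset.pair_comm _ _⟩
      rw [he']
      have h1 := htet w hw
      have h2 := euler_edge hQ hr (hpair w hw)
      have h3 := (hdeg w hw).resolve_left (hc w hw)
      omega
    have h40 : ∑ R ∈ S.between {v} Q 5, ((R.card : ℤ) - 1) = 40 := by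
      have h1 := sum_num_comm (S := S) {v} Q 2 5
      rw [sum_between_of_forall_eq h5, num_singleton_two hv, hm] at h1
      rw [Finset.sum_congr rfl fun R hR =>
        (num_singleton_two (S := S) (singleton_subset_of_mem_between hR)).symm, ← h1]
      norm_num
    have hle : ∀ R ∈ S.between {v} Q 5, (R.card : ℤ) - 1 ≤ 5 := by
      intro R hR
      rw [mem_between] at hR
      have := h6 R (mem_between.2 ⟨hR.1, by simp, hR.2.2⟩)
      omega
    have hall : ∀ R ∈ S.between {v} Q 5, R.card = 6 := by
      intro R hR
      have h1 : ∑ R ∈ S.between {v} Q 5, ((R.card : ℤ) - 1) = ∑ R ∈ S.between {v} Q 5, (5 : ℤ) := by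
        rw [h40, sum_between_of_forall_eq (c := 5) (fun _ _ => rfl), hφ]
        norm_num
      have := (Finset.sum_eq_sum_iff_of_le hle).1 h1 R hR
      omega
    have hone : ∀ R ∈ S.between {v} Q 5, (S.nonfaces v R).card = 1 := by
      intro R hR
      have hR' := mem_between.1 hR
      have hvR := singleton_subset_of_mem_between hR
      have h1 := card_nonfaces (S := S) hvR
      rw [(num_singleton_of_rk_five hR'.1 hR'.2.2.2 hvR).1, hall R hR] at h1
      have h52 : Nat.choose 5 2 = 10 := rfl
      norm_num [h52] at h1
      exact h1
    have hdisj : ∀ R ∈ S.between {v} Q 5, ∀ R' ∈ S.between {v} Q 5, R ≠ R' →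
        Disjoint (S.nonfaces v R) (S.nonfaces v R') := by
      intro R hR R' hR' hne
      rw [Finset.disjoint_left]
      intro T hT hT'
      rw [mem_nonfaces] at hT hT'
      have h1 := rk_inter_lt hR hR' hne.symm
      exact hT.2.2.2 (mem_of_subset_of_rk_le_four h1.1 (by omega)
        (Finset.subset_inter hT.1 hT'.1)).1
    have hcard := Finset.card_biUnion hdisj
    rw [Finset.sum_congr rfl hone, Finset.sum_const, smul_eq_mul, mul_one] at hcard
    have hsub : (S.between {v} Q 5).biUnion (S.nonfaces v) ⊆ S.nonfaces v Q := by
      intro T hT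
      obtain ⟨R, hR, hTR⟩ := Finset.mem_biUnion.1 hT
      rw [mem_between] at hR
      rw [mem_nonfaces] at hTR ⊢
      exact ⟨hTR.1.trans hR.2.2.1, hTR.2⟩
    have hfin := Finset.card_le_card hsub
    have h24 : S.num {v} Q 4 = 24 := by
      have h1 := sum_num_comm (S := S) {v} Q 4 5
      rw [sum_between_of_forall_eq (c := 2), sum_between_of_forall_eq (c := 6), hφ] at h1
      · omega
      · intro R hR
        have hR' := mem_between.1 hR
        rw [(num_singleton_of_rk_five hR'.1 hR'.2.2.2 (singleton_subset_of_mem_between hR)).2,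
          hall R hR]
        norm_num
      · intro T hT
        rw [mem_between] at hT
        have := num_of_rk_add_two hT.1 hQ hT.2.2.1 (by omega)
        rwa [hT.2.2.2] at this
    have h1 := num_singleton_of_rk_six hQ hr hv
    have h2 := card_nonfaces (S := S) hv
    have h82 : Nat.choose 8 2 = 28 := rfl
    rw [h1, h24, hφ, hm] at h2
    norm_num [h82] at h2
    simp only [num] at hφ
    omega
  -- the link of `v` is impossible
  have hins : ∀ a ∈ Q.erase v, ∀ b ∈ S.extensions {v, a} Q,
      b ∈ Q ∧ b ≠ v ∧ b ≠ a ∧ ({b, v, a} : Finset X) ∈ S.faces := by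
    intro a _ b hb
    rw [mem_extensions] at hb
    simp only [Finset.mem_insert, Finset.mem_singleton, not_or] at hb
    exact ⟨hb.1, hb.2.1.1, hb.2.1.2, hb.2.2⟩
  have hD : ∀ a ∈ Q.erase v, ∀ b ∈ S.extensions {v, a} Q, ∀ c ∈ S.extensions {b, v, a} Q,
      c ∈ Q ∧ c ≠ v ∧ c ≠ a ∧ c ≠ b ∧ ({c, b, v, a} : Finset X) ∈ S.faces ∧
      ∀ G ⊆ ({c, b, v, a} : Finset X), G ∈ S.faces := by
    intro a ha b hb c hc
    rw [mem_extensions] at hc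
    simp only [Finset.mem_insert, Finset.mem_singleton, not_or] at hc
    refine ⟨hc.1, hc.2.1.2.1, hc.2.1.2.2, hc.2.1.1, hc.2.2, fun G hG => ?_⟩
    exact (mem_of_subset_of_rk_le_four hc.2.2 ((rk_le_card hc.2.2).trans Finset.card_le_four) hG).1
  refine no_triangulated_graph_on_eight (Q.erase v)
    (by rw [Finset.card_erase_of_mem hv, hm])
    (fun a => S.extensions {v, a} Q) (fun a b => S.extensions {b, v, a} Q)
    ?_ ?_ ?_ ?_ ?_ ?_ ?_ ?_ s hs ?_
  · intro a ha b hb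
    have := hins a ha b hb
    exact Finset.mem_erase.2 ⟨this.2.1, this.1⟩
  · intro a ha hb
    exact (hins a ha a hb).2.2.1 rfl
  · intro a ha b hb hab
    have h1 := hins a ha b hab
    rw [Finset.mem_erase] at ha
    rw [mem_extensions]
    refine ⟨ha.2, by simp [ha.1, Ne.symm h1.2.2.1], ?_⟩
    have h2 : ({a, v, b} : Finset X) = {b, v, a} := by
      ext z; simp only [Finset.mem_insert, Finset.mem_singleton]; tauto
    rw [h2]
    exact h1.2.2.2
  · intro a ha b hb
    have h1 := hins a ha b hb
    rw [Finset.mem_erase] at ha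
    have hc : ({b, v, a} : Finset X).card = 3 := by
      rw [Finset.card_eq_three]
      exact ⟨b, v, a, h1.2.1, h1.2.2.1, ha.1.symm, rfl⟩
    have hrk : S.rk {b, v, a} = 3 := by
      rw [← hc, card_eq_rk h1.2.2.2 ((rk_le_card h1.2.2.2).trans (by omega))]
    have hsub : ({b, v, a} : Finset X) ⊆ Q := by
      simp [Finset.insert_subset_iff, h1.1, hv, ha.2]
    have h2 := card_extensions h1.2.2.2 hsub (by omega)
    have h3 := hT3 {b, v, a} (mem_between.2 ⟨h1.2.2.2, by simp, hsub, hrk⟩)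
    rw [hrk, h3] at h2
    exact_mod_cast h2.symm
  · intro a ha b hb c hc
    have h1 := hD a ha b hb c hc
    simp only [mem_extensions, Finset.mem_insert, Finset.mem_singleton, not_or]
    refine ⟨⟨h1.1, ⟨h1.2.1, h1.2.2.1⟩, h1.2.2.2.2.2 _ ?_⟩,
      ⟨h1.1, ⟨h1.2.1, h1.2.2.2.1⟩, h1.2.2.2.2.2 _ ?_⟩⟩
    · simp [Finset.insert_subset_iff]
    · simp [Finset.insert_subset_iff]
  · intro a ha b hb
    have : ({b, v, a} : Finset X) = {a, v, b} := by
      ext z; simp only [Finset.mem_insert, Finset.mem_singleton]; tauto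
    simp only [this]
  · intro a ha b hb c hc
    have h1 := hD a ha b hb c hc
    have h2 := hins a ha b hb
    simp only [mem_extensions, Finset.mem_insert, Finset.mem_singleton, not_or]
    refine ⟨h2.1, ⟨Ne.symm h1.2.2.2.1, h2.2.1, h2.2.2.1⟩, h1.2.2.2.2.2 _ ?_⟩
    simp [Finset.insert_subset_iff]
  · intro a ha
    have h1 := hdeg a ha
    rw [hext a ha] at h1
    exact_mod_cast h1
  · rw [hext s hs] at hs4
    exact_mod_cast hs4

/-- A face of rank seven with at least thirteen elements contains at least seventeen faces of
rank six. -/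
theorem seventeen_le_num (hW : W ∈ S.faces) (hr : S.rk W = 7) (hn : 13 ≤ W.card) :
    17 ≤ S.num ∅ W 6 := by
  by_contra hlt
  have h1 := sum_weight_le hW hr
  have h2 : ∑ Q ∈ S.between ∅ W 6, (6 * ((Q.card : ℤ) * (Q.card - 3)) -
      ∑ R ∈ S.between ∅ Q 5, (R.card : ℤ) * (R.card - 3)) ≤ (S.between ∅ W 6).card • (96 : ℤ) := by
    refine Finset.sum_le_card_nsmul _ _ _ fun Q hQ => ?_
    have hf := num_add_one_le hW hr hQ
    rw [mem_between] at hQ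
    have hf' : S.num ∅ Q 5 ≤ 15 := by
      have : S.num ∅ Q 5 + 1 ≤ S.num ∅ W 6 := hf
      omega
    have h9 := card_le_nine hQ.1 hQ.2.2.2 hf'
    have h9' := card_ne_nine hQ.1 hQ.2.2.2 hf'
    exact weight_le hQ.1 hQ.2.2.2 (by omega)
  rw [nsmul_eq_mul] at h2
  simp only [num] at hlt
  have : (13 : ℤ) ≤ W.card := by exact_mod_cast hn
  nlinarith

end NeighborlySystem

section EulerRelation

variable {M : Type*} [NormedAddCommGroup M] [NormedSpace ℝ M]

open Classical in
/-- The contribution `(-1) ^ dim U` of the relatively open convex set `U ∩ K` to an Euler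
characteristic, or zero if this set is empty. -/
noncomputable def eulerTerm (U : Submodule ℝ M) (K : Set M) : ℤ :=
  if ∃ u ∈ U, u ∈ K then (-1) ^ Module.finrank ℝ U else 0

lemma eulerTerm_congr {U : Submodule ℝ M} {K K' : Set M} (h : ∀ u ∈ U, u ∈ K ↔ u ∈ K') :
    eulerTerm U K = eulerTerm U K' := by
  unfold eulerTerm
  congr 1
  exact propext (exists_congr fun u => and_congr_right fun hu => h u hu)

lemma finrank_eq_finrank_inf_ker_add_one [FiniteDimensional ℝ M] {U : Submodule ℝ M}
    (d : M →L[ℝ] ℝ) {w : M} (hwU : w ∈ U) (hw : d w ≠ 0) :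
    Module.finrank ℝ U = Module.finrank ℝ ↥(U ⊓ LinearMap.ker d.toLinearMap) + 1 := by
  have h1 := LinearMap.finrank_range_add_finrank_ker (d.toLinearMap.domRestrict U)
  have h2 : LinearMap.range (d.toLinearMap.domRestrict U) = ⊤ := by
    rw [LinearMap.range_eq_top]
    refine LinearMap.surjective (fun h => hw ?_)
    exact congrArg (fun f => f ⟨w, hwU⟩) h
  have h3 : Module.finrank ℝ (LinearMap.ker (d.toLinearMap.domRestrict U)) =
      Module.finrank ℝ ↥(U ⊓ LinearMap.ker d.toLinearMap) := by
    rw [LinearMap.ker_domRestrict, ← Submodule.map_comap_subtype,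
      Submodule.finrank_map_subtype_eq]
  rw [h2, finrank_top, Module.finrank_self, h3] at h1
  omega

lemma eulerTerm_split [FiniteDimensional ℝ M] (U : Submodule ℝ M) {K : Set M} (hK : Convex ℝ K) (hKo : IsOpen K)
    (d : M →L[ℝ] ℝ) :
    eulerTerm U K = eulerTerm U (K ∩ {u | 0 < d u}) + eulerTerm (U ⊓ LinearMap.ker d.toLinearMap) K +
      eulerTerm U (K ∩ {u | d u < 0}) := by
  by_cases hne : ∃ u ∈ U, u ∈ K
  swap
  · have h1 : ¬ ∃ u ∈ U, u ∈ K ∩ {u | 0 < d u} := fun ⟨u, hu, hk⟩ => hne ⟨u, hu, hk.1⟩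
    have h2 : ¬ ∃ u ∈ U ⊓ LinearMap.ker d.toLinearMap, u ∈ K := fun ⟨u, hu, hk⟩ => hne ⟨u, hu.1, hk⟩
    have h3 : ¬ ∃ u ∈ U, u ∈ K ∩ {u | d u < 0} := fun ⟨u, hu, hk⟩ => hne ⟨u, hu, hk.1⟩
    simp only [eulerTerm, if_neg hne, if_neg h1, if_neg h2, if_neg h3, add_zero]
  by_cases hd : ∀ u ∈ U, d u = 0
  · have hU : U ⊓ LinearMap.ker d.toLinearMap = U := inf_eq_left.2 fun u hu => hd u hu
    have h1 : ¬ ∃ u ∈ U, u ∈ K ∩ {u | 0 < d u} := fun ⟨u, hu, hk⟩ => (hk.2 : 0 < d u).ne' (hd u hu)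
    have h3 : ¬ ∃ u ∈ U, u ∈ K ∩ {u | d u < 0} := fun ⟨u, hu, hk⟩ => (hk.2 : d u < 0).ne (hd u hu)
    rw [hU]
    simp only [eulerTerm, if_neg h1, if_neg h3, zero_add, add_zero]
  push Not at hd
  obtain ⟨w, hwU, hw⟩ : ∃ w ∈ U, 0 < d w := by
    obtain ⟨w, hwU, hw⟩ := hd
    rcases lt_or_gt_of_ne hw with h | h
    · exact ⟨-w, U.neg_mem hwU, by rw [map_neg]; linarith⟩
    · exact ⟨w, hwU, h⟩
  have hrank := finrank_eq_finrank_inf_ker_add_one d hwU hw.ne'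
  have hzero : ∀ u ∈ U, u ∈ K → d u = 0 →
      (∃ u ∈ U, u ∈ K ∩ {u | 0 < d u}) ∧ ∃ u ∈ U, u ∈ K ∩ {u | d u < 0} := by
    intro u hu hk h0
    have hcont : Continuous fun t : ℝ => u + t • w := by fun_prop
    have hmem : ∀ᶠ t in nhds (0 : ℝ), u + t • w ∈ K := by
      refine hcont.continuousAt.eventually_mem (hKo.mem_nhds ?_)
      simpa using hk
    obtain ⟨ε, hε, hball⟩ := Metric.eventually_nhds_iff.1 hmem
    refine ⟨⟨u + (ε / 2) • w, U.add_mem hu (U.smul_mem _ hwU), hball ?_, ?_⟩,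
      ⟨u + (-(ε / 2)) • w, U.add_mem hu (U.smul_mem _ hwU), hball ?_, ?_⟩⟩
    · rw [Real.dist_eq, sub_zero, abs_of_pos (by positivity)]
      linarith
    · simp only [Set.mem_ofPred_eq, map_add, map_smul, h0, smul_eq_mul, zero_add]
      positivity
    · rw [Real.dist_eq, sub_zero, abs_neg, abs_of_pos (by positivity)]
      linarith
    · simp only [Set.mem_ofPred_eq, map_add, map_smul, h0, smul_eq_mul, zero_add]
      have : 0 < ε / 2 * d w := by positivity
      linarith
  have hboth : (∃ u ∈ U, u ∈ K ∩ {u | 0 < d u}) → (∃ u ∈ U, u ∈ K ∩ {u | d u < 0}) →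
      ∃ u ∈ U ⊓ LinearMap.ker d.toLinearMap, u ∈ K := by
    rintro ⟨p, hp, hpK, hp0⟩ ⟨n, hn, hnK, hn0⟩
    simp only [Set.mem_ofPred_eq] at hp0 hn0
    have hpos : 0 < d p - d n := by linarith
    refine ⟨(-d n / (d p - d n)) • p + (d p / (d p - d n)) • n,
      ⟨U.add_mem (U.smul_mem _ hp) (U.smul_mem _ hn), ?_⟩, hK hpK hnK ?_ ?_ ?_⟩
    · rw [SetLike.mem_coe, LinearMap.mem_ker]
      change d _ = 0
      simp only [map_add, map_smul, smul_eq_mul]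
      field_simp
      ring
    · exact div_nonneg (by linarith) hpos.le
    · exact div_nonneg hp0.le hpos.le
    · field_simp
      ring
  obtain ⟨u, hu, huK⟩ := hne
  by_cases h0 : ∃ u ∈ U ⊓ LinearMap.ker d.toLinearMap, u ∈ K
  · obtain ⟨h1, h2⟩ := hzero _ h0.choose_spec.1.1 h0.choose_spec.2 h0.choose_spec.1.2
    simp only [eulerTerm, if_pos h0, if_pos h1, if_pos h2, if_pos (⟨u, hu, huK⟩ : ∃ u ∈ U, u ∈ K),
      hrank, pow_succ]
    ring
  · by_cases h1 : ∃ u ∈ U, u ∈ K ∩ {u | 0 < d u}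
    · have h2 : ¬ ∃ u ∈ U, u ∈ K ∩ {u | d u < 0} := fun h2 => h0 (hboth h1 h2)
      simp only [eulerTerm, if_neg h0, if_pos h1, if_neg h2,
        if_pos (⟨u, hu, huK⟩ : ∃ u ∈ U, u ∈ K), add_zero]
    · have h2 : ∃ u ∈ U, u ∈ K ∩ {u | d u < 0} := by
        refine ⟨u, hu, huK, ?_⟩
        by_contra hlt
        have hlt' : ¬ d u < 0 := hlt
        rcases (not_lt.1 hlt').lt_or_eq with h | h
        · exact h1 ⟨u, hu, huK, h⟩
        · exact h0 ⟨u, ⟨hu, h.symm⟩, huK⟩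
      simp only [eulerTerm, if_neg h0, if_neg h1, if_pos h2,
        if_pos (⟨u, hu, huK⟩ : ∃ u ∈ U, u ∈ K), add_zero, zero_add]

variable {X : Type*}

/-- The subspace of `U` on which the functionals `q a`, `a ∈ F`, coincide. -/
def equalizer (q : X → M →L[ℝ] ℝ) (U : Submodule ℝ M) (F : Finset X) : Submodule ℝ M where
  carrier := {u | u ∈ U ∧ ∀ a ∈ F, ∀ b ∈ F, q a u = q b u}
  add_mem' := fun hu hw => ⟨U.add_mem hu.1 hw.1, fun a ha b hb => by
    rw [map_add, map_add, hu.2 a ha b hb, hw.2 a ha b hb]⟩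
  zero_mem' := ⟨U.zero_mem, fun a _ b _ => by rw [map_zero, map_zero]⟩
  smul_mem' := fun c u hu => ⟨U.smul_mem c hu.1, fun a ha b hb => by
    rw [map_smul, map_smul, hu.2 a ha b hb]⟩

lemma mem_equalizer {q : X → M →L[ℝ] ℝ} {U : Submodule ℝ M} {F : Finset X} {u : M} :
    u ∈ equalizer q U F ↔ u ∈ U ∧ ∀ a ∈ F, ∀ b ∈ F, q a u = q b u := Iff.rfl

/-- The points of `K` at which all functionals `q a`, `a ∈ F`, are smaller than all functionals
`q z`, `z ∈ G`. -/
def below (q : X → M →L[ℝ] ℝ) (K : Set M) (F G : Finset X) : Set M :=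
  {u | u ∈ K ∧ ∀ a ∈ F, ∀ z ∈ G, q a u < q z u}

lemma mem_below {q : X → M →L[ℝ] ℝ} {K : Set M} {F G : Finset X} {u : M} :
    u ∈ below q K F G ↔ u ∈ K ∧ ∀ a ∈ F, ∀ z ∈ G, q a u < q z u := Iff.rfl

lemma isOpen_below {q : X → M →L[ℝ] ℝ} {K : Set M} (hK : IsOpen K) (F G : Finset X) :
    IsOpen (below q K F G) := by
  have : below q K F G = K ∩ ⋂ a ∈ F, ⋂ z ∈ G, {u | q a u < q z u} := by
    ext u
    simp [below]
  rw [this]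
  exact hK.inter (isOpen_biInter_finset fun a _ => isOpen_biInter_finset fun z _ =>
    isOpen_lt (q a).continuous (q z).continuous)

lemma convex_below {q : X → M →L[ℝ] ℝ} {K : Set M} (hK : Convex ℝ K) (F G : Finset X) :
    Convex ℝ (below q K F G) := by
  intro u hu w hw s t hs ht hst
  refine ⟨hK hu.1 hw.1 hs ht hst, fun a ha z hz => ?_⟩
  have h1 := hu.2 a ha z hz
  have h2 := hw.2 a ha z hz
  simp only [map_add, map_smul, smul_eq_mul]
  rcases hs.lt_or_eq with h | h
  · nlinarith
  · subst h
    rw [zero_add] at hst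
    subst hst
    simpa using h2

/-- The Euler relation for the decomposition of an open convex set according to which of finitely
many functionals attain the minimum. -/
lemma sum_eulerTerm [FiniteDimensional ℝ M] [DecidableEq X] (q : X → M →L[ℝ] ℝ) (U : Submodule ℝ M) {C : Finset X} (hC : C.Nonempty)
    {K : Set M} (hK : Convex ℝ K) (hKo : IsOpen K) :
    ∑ F ∈ C.powerset with F.Nonempty, eulerTerm (equalizer q U F) (below q K F (C \ F)) =
      eulerTerm U K := by
  induction hC using Finset.Nonempty.cons_induction generalizing K with
  | singleton y =>
    have h1 : (({y} : Finset X).powerset.filter Finset.Nonempty) = {{y}} := by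
      ext F
      simp only [Finset.mem_filter, Finset.mem_powerset, Finset.subset_singleton_iff,
        Finset.mem_singleton]
      constructor
      · rintro ⟨rfl | rfl, h⟩
        · simp at h
        · rfl
      · rintro rfl
        simp
    have h2 : equalizer q U {y} = U := by
      ext u
      simp [mem_equalizer]
    rw [h1, Finset.sum_singleton, h2]
    exact eulerTerm_congr fun u _ => by simp [below]
  | cons z C hz hC ih =>
    have hparts : ((Finset.cons z C hz).powerset.filter Finset.Nonempty) =
        (C.powerset.filter Finset.Nonempty) ∪
          (insert {z} ((C.powerset.filter Finset.Nonempty).image (insert z))) := by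
      ext F
      simp only [Finset.mem_filter, Finset.mem_powerset, Finset.mem_union, Finset.mem_insert,
        Finset.mem_image, Finset.cons_eq_insert]
      constructor
      · rintro ⟨h1, h2⟩
        by_cases hzF : z ∈ F
        · right
          by_cases he : (F.erase z).Nonempty
          · right
            exact ⟨F.erase z, ⟨by rwa [← Finset.subset_insert_iff], he⟩, Finset.insert_erase hzF⟩
          · left
            rw [Finset.not_nonempty_iff_eq_empty] at he
            rw [← Finset.insert_erase hzF, he]
            rfl
        · left
          exact ⟨(Finset.subset_insert_iff_of_notMem hzF).1 h1, h2⟩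
      · rintro (⟨h1, h2⟩ | rfl | ⟨F, ⟨h1, h2⟩, rfl⟩)
        · exact ⟨h1.trans (Finset.subset_insert _ _), h2⟩
        · simp
        · exact ⟨Finset.insert_subset_insert _ h1, by simp⟩
    have hzF : ∀ F ∈ C.powerset.filter Finset.Nonempty, z ∉ F := fun F hF h =>
      hz (Finset.mem_powerset.1 (Finset.mem_filter.1 hF).1 h)
    rw [hparts, Finset.sum_union, Finset.sum_insert, Finset.sum_image, ← ih hK hKo]
    · have hz' : eulerTerm (equalizer q U {z}) (below q K {z} (Finset.cons z C hz \ {z})) =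
          eulerTerm U (below q K {z} C) := by
        have h2 : equalizer q U {z} = U := by
          ext u
          simp [mem_equalizer]
        rw [h2, Finset.cons_eq_insert, Finset.insert_sdiff_of_mem _ (by simp),
          Finset.sdiff_singleton_eq_erase, Finset.erase_eq_of_notMem hz]
      rw [hz', ← ih (convex_below hK {z} C) (isOpen_below hKo {z} C), ← add_assoc,
        add_right_comm, ← Finset.sum_add_distrib, ← Finset.sum_add_distrib]
      refine Finset.sum_congr rfl fun F hF => ?_
      have hzF' := hzF F hF
      obtain ⟨hFC, a, ha⟩ := Finset.mem_filter.1 hF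
      rw [Finset.mem_powerset] at hFC
      have haz : a ≠ z := fun h => hzF' (h ▸ ha)
      rw [eulerTerm_split (equalizer q U F) (convex_below hK F (C \ F)) (isOpen_below hKo F (C \ F))
        (q z - q a)]
      have hker : equalizer q U F ⊓ LinearMap.ker (q z - q a).toLinearMap =
          equalizer q U (insert z F) := by
        ext u
        rw [Submodule.mem_inf, LinearMap.mem_ker, mem_equalizer, mem_equalizer]
        change _ ∧ q z u - q a u = 0 ↔ _
        rw [sub_eq_zero]
        constructor
        · rintro ⟨⟨h1, h2⟩, h3⟩
          refine ⟨h1, fun b hb c hc => ?_⟩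
          rw [Finset.mem_insert] at hb hc
          rcases hb with rfl | hb <;> rcases hc with rfl | hc
          · rfl
          · rw [h3, h2 a ha c hc]
          · rw [h3, h2 b hb a ha]
          · exact h2 b hb c hc
        · rintro ⟨h1, h2⟩
          exact ⟨⟨h1, fun b hb c hc => h2 b (Finset.mem_insert_of_mem hb) c
            (Finset.mem_insert_of_mem hc)⟩, h2 z (Finset.mem_insert_self _ _) a
            (Finset.mem_insert_of_mem ha)⟩
      rw [hker]
      have h1 : eulerTerm (equalizer q U F) (below q K F (C \ F) ∩ {u | 0 < (q z - q a) u}) =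
          eulerTerm (equalizer q U F) (below q K F (Finset.cons z C hz \ F)) := by
        refine eulerTerm_congr fun u hu => ?_
        rw [mem_equalizer] at hu
        rw [Set.mem_inter_iff, mem_below, mem_below, Set.mem_ofPred_eq, sub_apply, sub_pos]
        simp only [Finset.cons_eq_insert, Finset.mem_sdiff, Finset.mem_insert]
        constructor
        · rintro ⟨⟨h1, h2⟩, h3⟩
          refine ⟨h1, fun b hb y hy => ?_⟩
          rcases hy with ⟨rfl | hy, hyF⟩
          · rw [hu.2 b hb a ha]
            exact h3
          · exact h2 b hb y ⟨hy, hyF⟩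
        · rintro ⟨h1, h2⟩
          exact ⟨⟨h1, fun b hb y hy => h2 b hb y ⟨Or.inr hy.1, hy.2⟩⟩,
            h2 a ha z ⟨Or.inl rfl, hzF'⟩⟩
      have h2 : eulerTerm (equalizer q U (insert z F)) (below q K F (C \ F)) =
          eulerTerm (equalizer q U (insert z F))
            (below q K (insert z F) (Finset.cons z C hz \ insert z F)) := by
        refine eulerTerm_congr fun u hu => ?_
        rw [mem_equalizer] at hu
        have hua := fun b hb => hu.2 b hb a (Finset.mem_insert_of_mem ha)
        rw [mem_below, mem_below]
        simp only [Finset.cons_eq_insert, Finset.mem_sdiff, Finset.mem_insert, not_or]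
        refine and_congr_right fun _ => ⟨fun h b hb y hy => ?_, fun h b hb y hy => ?_⟩
        · rw [hua b (Finset.mem_insert.2 hb)]
          rcases hy with ⟨rfl | hy, hy1, hy2⟩
          · exact absurd rfl hy1
          · exact h a ha y ⟨hy, hy2⟩
        · exact h b (Or.inr hb) y ⟨Or.inr hy.1, fun h => hz (h ▸ hy.1), hy.2⟩
      have h3 : eulerTerm (equalizer q U F) (below q K F (C \ F) ∩ {u | (q z - q a) u < 0}) =
          eulerTerm (equalizer q U F) (below q (below q K {z} C) F (C \ F)) := by
        refine eulerTerm_congr fun u hu => ?_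
        rw [mem_equalizer] at hu
        rw [Set.mem_inter_iff, mem_below, mem_below, mem_below, Set.mem_ofPred_eq, sub_apply,
          sub_neg]
        simp only [Finset.mem_singleton, Finset.mem_sdiff, forall_eq]
        constructor
        · rintro ⟨⟨h1, h2⟩, h3⟩
          refine ⟨⟨h1, fun y hy => ?_⟩, h2⟩
          by_cases hyF : y ∈ F
          · rw [hu.2 y hyF a ha]
            exact h3
          · exact h3.trans (h2 a ha y ⟨hy, hyF⟩)
        · rintro ⟨⟨h1, h2⟩, h3⟩
          exact ⟨⟨h1, h3⟩, h2 a (hFC ha)⟩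
      rw [h1, h2, h3]
    · intro F hF G hG hFG
      rw [← Finset.erase_insert (hzF F hF), ← Finset.erase_insert (hzF G hG),
        show insert z F = insert z G from hFG]
    · intro h
      obtain ⟨F, hF, hFz⟩ := Finset.mem_image.1 h
      obtain ⟨a, ha⟩ := (Finset.mem_filter.1 hF).2
      have : a ∈ ({z} : Finset X) := hFz ▸ Finset.mem_insert_of_mem ha
      rw [Finset.mem_singleton] at this
      exact hzF F hF (this ▸ ha)
    · rw [Finset.disjoint_left]
      intro F hF hF'
      have : z ∈ F := by
        rcases Finset.mem_insert.1 hF' with rfl | h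
        · simp
        · obtain ⟨G, -, rfl⟩ := Finset.mem_image.1 h
          simp
      exact hzF F hF this

end EulerRelation

section PointConfiguration

variable {M : Type*} [NormedAddCommGroup M] [NormedSpace ℝ M] {X : Type*}

/-- A set of indices is a face of the configuration `ev` if it is the zero set of a vector at which
all the functionals `ev x` are nonnegative. -/
def IsConfigFace (ev : X → M →L[ℝ] ℝ) (F : Finset X) : Prop :=
  ∃ l : M, (∀ x, 0 ≤ ev x l) ∧ ∀ x, x ∈ F ↔ ev x l = 0

/-- The vectors at which all functionals `ev x`, `x ∈ F`, vanish. -/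
def commonKer (ev : X → M →L[ℝ] ℝ) (F : Finset X) : Submodule ℝ M where
  carrier := {u | ∀ x ∈ F, ev x u = 0}
  add_mem' := fun hu hw x hx => by rw [map_add, hu x hx, hw x hx, add_zero]
  zero_mem' := fun x _ => map_zero _
  smul_mem' := fun c u hu x hx => by rw [map_smul, hu x hx, smul_zero]

variable {ev : X → M →L[ℝ] ℝ} {A B F G : Finset X}

lemma mem_commonKer {u : M} : u ∈ commonKer ev F ↔ ∀ x ∈ F, ev x u = 0 := Iff.rfl

lemma IsConfigFace.inter [DecidableEq X] (hF : IsConfigFace ev F) (hG : IsConfigFace ev G) :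
    IsConfigFace ev (F ∩ G) := by
  obtain ⟨l, hl, hlF⟩ := hF
  obtain ⟨m, hm, hmG⟩ := hG
  refine ⟨l + m, fun x => ?_, fun x => ?_⟩
  · rw [map_add]
    exact add_nonneg (hl x) (hm x)
  · rw [Finset.mem_inter, hlF, hmG, map_add]
    have := hl x
    have := hm x
    constructor
    · rintro ⟨h1, h2⟩
      rw [h1, h2, add_zero]
    · intro h
      constructor <;> linarith

lemma IsConfigFace.of_subset [Finite X] (hB : IsConfigFace ev B) {l : M}
    (hl : ∀ y ∈ B, 0 ≤ ev y l) (hF : ∀ x, x ∈ F ↔ x ∈ B ∧ ev x l = 0) : IsConfigFace ev F := by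
  obtain ⟨m, hm, hmB⟩ := hB
  have hpos : ∀ x, x ∉ B → 0 < ev x m := fun x hx =>
    (hm x).lt_of_ne fun h => hx ((hmB x).2 h.symm)
  have hev : ∀ᶠ t : ℝ in Filter.atTop, ∀ x, x ∉ B → 0 < ev x l + t * ev x m := by
    refine Filter.eventually_all.2 fun x => ?_
    by_cases hx : x ∈ B
    · exact Filter.Eventually.of_forall fun t h => absurd hx h
    · have := Filter.tendsto_atTop_add_const_left Filter.atTop (ev x l)
        (Filter.tendsto_id.atTop_mul_const (hpos x hx))
      filter_upwards [this.eventually_gt_atTop 0] with t ht _ using ht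
  obtain ⟨t, ht⟩ := hev.exists
  have hval : ∀ x, ev x (l + t • m) = ev x l + t * ev x m := fun x => by
    rw [map_add, map_smul, smul_eq_mul]
  refine ⟨l + t • m, fun x => ?_, fun x => ?_⟩
  · rw [hval]
    by_cases hx : x ∈ B
    · rw [(hmB x).1 hx, mul_zero, add_zero]
      exact hl x hx
    · exact (ht x hx).le
  · rw [hval, hF]
    by_cases hx : x ∈ B
    · rw [(hmB x).1 hx, mul_zero, add_zero]
      exact and_iff_right hx
    · exact ⟨fun h => absurd h.1 hx, fun h => absurd h (ht x hx).ne'⟩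

lemma commonKer_lt (hF : IsConfigFace ev F) (h : F ⊂ G) : commonKer ev G < commonKer ev F := by
  refine lt_of_le_of_ne (fun u hu x hx => hu x (h.1 hx)) fun heq => ?_
  obtain ⟨l, -, hlF⟩ := hF
  have hl : l ∈ commonKer ev G := heq ▸ fun x hx => (hlF x).1 hx
  exact h.2 fun x hx => (hlF x).2 (hl x hx)

variable [FiniteDimensional ℝ M]

variable (ev) in
/-- The dimension of the span of the functionals `ev x`, `x ∈ F`. -/
noncomputable def configRank (F : Finset X) : ℕ :=
  Module.finrank ℝ M - Module.finrank ℝ (commonKer ev F)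

lemma configRank_add_finrank (F : Finset X) :
    configRank ev F + Module.finrank ℝ (commonKer ev F) = Module.finrank ℝ M :=
  Nat.sub_add_cancel (Submodule.finrank_le _)

lemma configRank_lt (hF : IsConfigFace ev F) (h : F ⊂ G) : configRank ev F < configRank ev G := by
  have h1 := Submodule.finrank_lt_finrank_of_lt (commonKer_lt hF h)
  have h2 := configRank_add_finrank (ev := ev) F
  have h3 := configRank_add_finrank (ev := ev) G
  omega

lemma exists_isConfigFace_between [Finite X] [DecidableEq X] (hA : IsConfigFace ev A)
    (hB : IsConfigFace ev B) (hAB : A ⊂ B) (hr : configRank ev A + 2 ≤ configRank ev B) :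
    ∃ F, IsConfigFace ev F ∧ A ⊂ F ∧ F ⊂ B := by
  obtain ⟨m, hm, hmA⟩ := hA
  obtain ⟨l, hlA, hl⟩ : ∃ l ∈ commonKer ev A, l ∉ Submodule.span ℝ {m} ⊔ commonKer ev B := by
    by_contra! hcon
    have h1 := Submodule.finrank_mono (show commonKer ev A ≤ _ from hcon)
    have h2 := Submodule.finrank_add_le_finrank_add_finrank (Submodule.span ℝ {m})
      (commonKer ev B)
    have h3 := finrank_span_le_card (R := ℝ) ({m} : Set M)
    have h4 := configRank_add_finrank (ev := ev) A
    have h5 := configRank_add_finrank (ev := ev) B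
    simp only [Set.toFinset_singleton, Finset.card_singleton] at h3
    omega
  obtain ⟨y, hy, hmin⟩ := Finset.exists_min_image (B \ A) (fun y => ev y l / ev y m)
    (Finset.sdiff_nonempty.2 hAB.2)
  rw [Finset.mem_sdiff] at hy
  have hpos : ∀ x, x ∉ A → 0 < ev x m := fun x hx =>
    (hm x).lt_of_ne fun h => hx ((hmA x).2 h.symm)
  set c := ev y l / ev y m with hc
  have hval : ∀ x, ev x (l - c • m) = ev x l - c * ev x m := fun x => by
    rw [map_sub, map_smul, smul_eq_mul]
  have hzero : ∀ x ∈ A, ev x (l - c • m) = 0 := fun x hx => by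
    rw [hval, hlA x hx, (hmA x).1 hx, mul_zero, sub_zero]
  have hyz : ev y (l - c • m) = 0 := by
    rw [hval, hc, div_mul_cancel₀ _ (hpos y hy.2).ne', sub_self]
  have hmem : ∀ x, x ∈ B.filter (fun x => ev x (l - c • m) = 0) ↔
      x ∈ B ∧ ev x (l - c • m) = 0 := fun x => Finset.mem_filter
  refine ⟨B.filter fun x => ev x (l - c • m) = 0, hB.of_subset (fun x hx => ?_) hmem, ?_, ?_⟩
  · by_cases hxA : x ∈ A
    · exact (hzero x hxA).ge
    · have := hmin x (Finset.mem_sdiff.2 ⟨hx, hxA⟩)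
      rw [le_div_iff₀ (hpos x hxA)] at this
      rw [hval]
      linarith
  · rw [Finset.ssubset_iff_of_subset fun x hx => (hmem x).2 ⟨hAB.1 hx, hzero x hx⟩]
    exact ⟨y, (hmem y).2 ⟨hy.1, hyz⟩, hy.2⟩
  · refine (Finset.filter_subset _ _).ssubset_of_ne fun heq => hl ?_
    have h1 : l - c • m ∈ commonKer ev B := fun x hx => by
      rw [← heq] at hx
      exact ((hmem x).1 hx).2
    have h2 := Submodule.add_mem_sup (Submodule.smul_mem _ c (Submodule.mem_span_singleton_self m))
      h1
    rwa [add_sub_cancel] at h2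

lemma eulerTerm_equalizer [Finite X] [DecidableEq X] (hB : IsConfigFace ev B) (hAB : A ⊆ B)
    {m : M} (hm : ∀ x, 0 ≤ ev x m) (hmA : ∀ x, x ∈ A ↔ ev x m = 0) (hF : F.Nonempty)
    (hFC : F ⊆ B \ A) [Decidable (IsConfigFace ev (A ∪ F))] :
    eulerTerm (equalizer (fun y => (ev y m)⁻¹ • ev y) (commonKer ev A) F)
      (below (fun y => (ev y m)⁻¹ • ev y) univ F ((B \ A) \ F)) =
      if IsConfigFace ev (A ∪ F) then -(-1) ^ Module.finrank ℝ (commonKer ev (A ∪ F)) else 0 := by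
  have hpos : ∀ x, x ∉ A → 0 < ev x m := fun x hx =>
    (hm x).lt_of_ne fun h => hx ((hmA x).2 h.symm)
  have hFA : ∀ x ∈ F, x ∉ A := fun x hx => (Finset.mem_sdiff.1 (hFC hx)).2
  obtain ⟨a, ha⟩ := hF
  have hq : ∀ x ∉ A, ∀ u, ev x u = ev x m * ((ev x m)⁻¹ • ev x) u := fun x hx u => by
    rw [smul_apply, smul_eq_mul, mul_inv_cancel_left₀ (hpos x hx).ne']
  set q : X → M →L[ℝ] ℝ := fun y => (ev y m)⁻¹ • ev y with hqdef
  have hqm : ∀ x ∉ A, q x m = 1 := fun x hx => by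
    rw [hqdef]
    exact inv_mul_cancel₀ (hpos x hx).ne'
  have hrank : Module.finrank ℝ (equalizer q (commonKer ev A) F) =
      Module.finrank ℝ (commonKer ev (A ∪ F)) + 1 := by
    have hmem : m ∈ equalizer q (commonKer ev A) F :=
      ⟨fun x hx => (hmA x).1 hx, fun x hx y hy => by rw [hqm x (hFA x hx), hqm y (hFA y hy)]⟩
    suffices h : equalizer q (commonKer ev A) F ⊓ LinearMap.ker (q a).toLinearMap =
        commonKer ev (A ∪ F) by
      rw [← h]
      exact finrank_eq_finrank_inf_ker_add_one (q a) hmem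
        (by rw [hqm a (hFA a ha)]; exact one_ne_zero)
    ext u
    rw [Submodule.mem_inf, LinearMap.mem_ker, mem_equalizer, mem_commonKer, mem_commonKer]
    change _ ∧ q a u = 0 ↔ _
    constructor
    · rintro ⟨⟨h1, h2⟩, h3⟩ x hx
      rcases Finset.mem_union.1 hx with hx | hx
      · exact h1 x hx
      · rw [hq x (hFA x hx), h2 x hx a ha, h3, mul_zero]
    · intro h
      have hz : ∀ x ∈ F, q x u = 0 := fun x hx => by
        change (ev x m)⁻¹ * ev x u = 0
        rw [h x (Finset.mem_union_right _ hx), mul_zero]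
      exact ⟨⟨fun x hx => h x (Finset.mem_union_left _ hx), fun x hx y hy => by
        rw [hz x hx, hz y hy]⟩, hz a ha⟩
  have hiff : (∃ u ∈ equalizer q (commonKer ev A) F, u ∈ below q univ F ((B \ A) \ F)) ↔
      IsConfigFace ev (A ∪ F) := by
    constructor
    · rintro ⟨u, ⟨hu1, hu2⟩, -, hu3⟩
      have hval : ∀ x ∉ A, ev x (u - q a u • m) = ev x m * (q x u - q a u) := fun x hx => by
        rw [map_sub, map_smul, smul_eq_mul, hq x hx u]
        ring
      have hzero : ∀ x ∈ A, ev x (u - q a u • m) = 0 := fun x hx => by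
        rw [map_sub, map_smul, hu1 x hx, (hmA x).1 hx, smul_zero, sub_zero]
      have hzeroF : ∀ x ∈ F, ev x (u - q a u • m) = 0 := fun x hx => by
        rw [hval x (hFA x hx), hu2 x hx a ha, sub_self, mul_zero]
      have hposC : ∀ x ∈ B, x ∉ A → x ∉ F → 0 < ev x (u - q a u • m) := fun x hx hxA hxF => by
        rw [hval x hxA]
        exact mul_pos (hpos x hxA) (sub_pos.2 (hu3 a ha x
          (Finset.mem_sdiff.2 ⟨Finset.mem_sdiff.2 ⟨hx, hxA⟩, hxF⟩)))
      refine hB.of_subset (l := u - q a u • m) (fun x hx => ?_) fun x => ?_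
      · by_cases hxA : x ∈ A
        · exact (hzero x hxA).ge
        · by_cases hxF : x ∈ F
          · exact (hzeroF x hxF).ge
          · exact (hposC x hx hxA hxF).le
      · rw [Finset.mem_union]
        constructor
        · rintro (hx | hx)
          · exact ⟨hAB hx, hzero x hx⟩
          · exact ⟨(Finset.mem_sdiff.1 (hFC hx)).1, hzeroF x hx⟩
        · rintro ⟨hx, h0⟩
          by_contra! hcon
          exact (hposC x hx hcon.1 hcon.2).ne' h0
    · rintro ⟨l, hl, hlF⟩
      have hz : ∀ x ∈ F, q x l = 0 := fun x hx => by
        change (ev x m)⁻¹ * ev x l = 0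
        rw [(hlF x).1 (Finset.mem_union_right _ hx), mul_zero]
      refine ⟨l, ⟨fun x hx => (hlF x).1 (Finset.mem_union_left _ hx), fun x hx y hy => by
        rw [hz x hx, hz y hy]⟩, Set.mem_univ _, fun x hx y hy => ?_⟩
      rw [Finset.mem_sdiff, Finset.mem_sdiff] at hy
      rw [hz x hx]
      refine mul_pos (inv_pos.2 (hpos y hy.1.2)) ((hl y).lt_of_ne fun h => ?_)
      rcases Finset.mem_union.1 ((hlF y).2 h.symm) with h | h
      · exact hy.1.2 h
      · exact hy.2 h
  rw [eulerTerm, hrank, pow_succ, mul_neg_one]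
  simp only [hiff]

open Classical in
lemma sum_neg_one_pow_finrank_commonKer [Fintype X] [DecidableEq X] (hA : IsConfigFace ev A)
    (hB : IsConfigFace ev B) (hAB : A ⊂ B) :
    ∑ F : Finset X with IsConfigFace ev F ∧ A ⊆ F ∧ F ⊆ B,
      (-1 : ℤ) ^ Module.finrank ℝ (commonKer ev F) = 0 := by
  obtain ⟨m, hm, hmA⟩ := id hA
  have hsum := sum_eulerTerm (fun y => (ev y m)⁻¹ • ev y) (commonKer ev A)
    (Finset.sdiff_nonempty.2 hAB.2) convex_univ isOpen_univ
  rw [Finset.sum_congr rfl fun F hF => eulerTerm_equalizer hB hAB.1 hm hmA (Finset.mem_filter.1 hF).2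
    (Finset.mem_powerset.1 (Finset.mem_filter.1 hF).1), ← Finset.sum_filter, Finset.sum_neg_distrib,
    eulerTerm, if_pos ⟨0, zero_mem _, Set.mem_univ _⟩] at hsum
  rw [← Finset.add_sum_erase (a := A) _ _ (by simpa using ⟨hA, hAB.1⟩), ← hsum, neg_add_eq_zero]
  refine Finset.sum_nbij' (fun F => A ∪ F) (fun F => F \ A) ?_ ?_ ?_ ?_ ?_
  · intro F hF
    simp only [Finset.mem_filter, Finset.mem_powerset, Finset.mem_erase, Finset.mem_univ,
      true_and] at hF ⊢
    obtain ⟨⟨h1, a, ha⟩, h2⟩ := hF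
    refine ⟨fun h => ?_, h2, Finset.subset_union_left,
      Finset.union_subset hAB.1 (h1.trans Finset.sdiff_subset)⟩
    exact (Finset.mem_sdiff.1 (h1 ha)).2 (h ▸ Finset.mem_union_right _ ha)
  · intro F hF
    simp only [Finset.mem_filter, Finset.mem_powerset, Finset.mem_erase, Finset.mem_univ,
      true_and] at hF ⊢
    obtain ⟨h1, h2, h3, h4⟩ := hF
    refine ⟨⟨Finset.sdiff_subset_sdiff h4 subset_rfl, Finset.sdiff_nonempty.2 fun h =>
      h1 (h.antisymm h3)⟩, ?_⟩
    rwa [Finset.union_sdiff_of_subset h3]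
  · intro F hF
    simp only [Finset.mem_filter, Finset.mem_powerset] at hF
    exact Finset.union_sdiff_cancel_left (Finset.disjoint_left.2 fun x hx hxF =>
      (Finset.mem_sdiff.1 (hF.1.1 hxF)).2 hx)
  · intro F hF
    simp only [Finset.mem_filter, Finset.mem_erase, Finset.mem_univ, true_and] at hF
    exact Finset.union_sdiff_of_subset hF.2.2.1
  · intro F _
    rfl

open Classical in
/-- The faces of a configuration in which the empty set and all pairs are faces. -/
noncomputable def neighborlySystemOfConfig [Fintype X] [DecidableEq X] (ev : X → M →L[ℝ] ℝ)
    (hempty : IsConfigFace ev ∅) (hpair : ∀ x y, IsConfigFace ev {x, y}) :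
    NeighborlySystem X where
  faces := {F | IsConfigFace ev F}
  rk := configRank ev
  inter_mem F hF G hG := by
    rw [Finset.mem_filter_univ] at hF hG ⊢
    exact hF.inter hG
  rk_lt_rk F hF G _ h := configRank_lt ((Finset.mem_filter_univ _).1 hF) h
  exists_between A hA B hB hAB hr := by
    rw [Finset.mem_filter_univ] at hA hB
    obtain ⟨F, hF, h⟩ := exists_isConfigFace_between hA hB hAB hr
    exact ⟨F, (Finset.mem_filter_univ _).2 hF, h⟩
  euler A hA B hB hAB := by
    rw [Finset.mem_filter_univ] at hA hB
    have hsign : ∀ F : Finset X, (-1 : ℤ) ^ configRank ev F =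
        (-1) ^ Module.finrank ℝ M * (-1) ^ Module.finrank ℝ (commonKer ev F) := fun F => by
      rw [← configRank_add_finrank (ev := ev) F, pow_add, mul_assoc, ← mul_pow]
      simp
    rw [Finset.filter_filter, Finset.sum_congr rfl fun F _ => hsign F, ← Finset.mul_sum,
      sum_neg_one_pow_finrank_commonKer hA hB hAB, mul_zero]
  empty_mem := (Finset.mem_filter_univ _).2 hempty
  rk_empty := by
    have h : commonKer ev ∅ = ⊤ := by
      ext u
      simp [mem_commonKer]
    rw [configRank, h, finrank_top, Nat.sub_self]
  pair_mem x y := (Finset.mem_filter_univ _).2 (hpair x y)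

end PointConfiguration

section Polytopes

variable {E : Type*} [NormedAddCommGroup E] [NormedSpace ℝ E]

/-- Evaluation at `x` on the space of continuous affine functionals. -/
noncomputable def affineEval (x : E) : (E →L[ℝ] ℝ) × ℝ →L[ℝ] ℝ :=
  (ContinuousLinearMap.apply ℝ ℝ x).comp (ContinuousLinearMap.fst ℝ (E →L[ℝ] ℝ) ℝ) +
    ContinuousLinearMap.snd ℝ (E →L[ℝ] ℝ) ℝ

lemma affineEval_apply (x : E) (l : (E →L[ℝ] ℝ) × ℝ) : affineEval x l = l.1 x + l.2 := rfl

lemma mem_convexHull_of_apply_eq {S : Set E} (f : E →L[ℝ] ℝ) {c : ℝ} (hS : ∀ s ∈ S, f s ≤ c) {x : E}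
    (hx : x ∈ convexHull ℝ S) (hfx : f x = c) : x ∈ convexHull ℝ {s ∈ S | f s = c} := by
  have hle : convexHull ℝ {s ∈ S | f s = c} ⊆ {x | f x = c} :=
    convexHull_min (fun s hs => hs.2) (convex_hyperplane f.toLinearMap.isLinear c)
  have hconv : Convex ℝ ({x | f x < c} ∪ convexHull ℝ {s ∈ S | f s = c}) := by
    rw [convex_iff_forall_pos]
    intro x hx y hy a b ha hb hab
    have hle' : ∀ z ∈ {x | f x < c} ∪ convexHull ℝ {s ∈ S | f s = c}, f z ≤ c := by
      rintro z (hz | hz)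
      · exact le_of_lt hz
      · exact (hle hz).le
    have hval : f (a • x + b • y) = a * f x + b * f y := by
      rw [map_add, map_smul, map_smul, smul_eq_mul, smul_eq_mul]
    have hx' := hle' x hx
    have hy' := hle' y hy
    have hc : c = a * c + b * c := by rw [← add_mul, hab, one_mul]
    rcases hx with hx | hx
    · left
      have h1 : a * f x < a * c := mul_lt_mul_of_pos_left hx ha
      have h2 : b * f y ≤ b * c := mul_le_mul_of_nonneg_left hy' hb.le
      change f (a • x + b • y) < c
      linarith
    · rcases hy with hy | hy
      · left
        have h1 : b * f y < b * c := mul_lt_mul_of_pos_left hy hb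
        have h2 : a * f x ≤ a * c := mul_le_mul_of_nonneg_left hx' ha.le
        change f (a • x + b • y) < c
        linarith
      · exact Or.inr (convex_convexHull ℝ _ hx hy ha.le hb.le hab)
  have hsub : S ⊆ {x | f x < c} ∪ convexHull ℝ {s ∈ S | f s = c} := fun s hs => by
    rcases (hS s hs).lt_or_eq with h | h
    · exact Or.inl h
    · exact Or.inr (subset_convexHull ℝ _ ⟨hs, h⟩)
  rcases convexHull_min hsub hconv hx with h | h
  · exact absurd hfx (ne_of_lt h)
  · exact h

lemma apply_le_of_mem_convexHull {S : Set E} (f : E →L[ℝ] ℝ) {c : ℝ} (hS : ∀ s ∈ S, f s ≤ c) {x : E}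
    (hx : x ∈ convexHull ℝ S) : f x ≤ c :=
  convexHull_min (fun s hs => hS s hs) (convex_halfSpace_le f.toLinearMap.isLinear c) hx

lemma exists_finset_forall_isExposed {P : Set E}
    (hP : ∃ S : Finset E, P = convexHull ℝ (S : Set E)) :
    ∃ S : Finset E, P = convexHull ℝ (S : Set E) ∧ ∀ s ∈ S, IsExposed ℝ P {s} := by
  classical
  obtain ⟨S, hS, hmin⟩ := WellFounded.has_min (measure (Finset.card (α := E))).wf
    {S : Finset E | P = convexHull ℝ (S : Set E)} hP
  refine ⟨S, hS, fun s hs _ => ?_⟩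
  have hSP : P = convexHull ℝ (S : Set E) := hS
  have hnot : s ∉ convexHull ℝ (S.erase s : Set E) := by
    intro hcon
    refine hmin (S.erase s) ?_ (Finset.card_erase_lt_of_mem hs)
    refine hSP.trans (Set.Subset.antisymm (convexHull_min (fun x hx => ?_) (convex_convexHull ℝ _))
      (convexHull_mono (Finset.coe_subset.2 (Finset.erase_subset _ _))))
    by_cases hxs : x = s
    · exact hxs ▸ hcon
    · exact subset_convexHull ℝ _ (Finset.mem_coe.2 (Finset.mem_erase.2 ⟨hxs, hx⟩))
  obtain ⟨f, u, hf, hu⟩ := geometric_hahn_banach_closed_point (convex_convexHull ℝ _)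
    ((S.erase s).finite_toSet.isClosed_convexHull (𝕜 := ℝ)) hnot
  have hlt : ∀ x ∈ S, x ≠ s → f x < f s := fun x hx hxs =>
    (hf x (subset_convexHull ℝ _ (Finset.mem_coe.2 (Finset.mem_erase.2 ⟨hxs, hx⟩)))).trans hu
  have hle : ∀ x ∈ (S : Set E), f x ≤ f s := fun x hx => by
    by_cases hxs : x = s
    · rw [hxs]
    · exact (hlt x hx hxs).le
  have hsP : s ∈ P := hSP ▸ subset_convexHull ℝ _ hs
  refine ⟨f, Set.Subset.antisymm ?_ ?_⟩
  · rintro x rfl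
    exact ⟨hsP, fun y hy => apply_le_of_mem_convexHull f hle (hSP ▸ hy)⟩
  · rintro x ⟨hx, hmax⟩
    rw [hSP] at hx
    have h1 := mem_convexHull_of_apply_eq f hle hx
      (le_antisymm (apply_le_of_mem_convexHull f hle hx) (hmax s hsP))
    have h2 : {y ∈ (S : Set E) | f y = f s} ⊆ {s} := fun y hy => by
      by_contra hys
      exact (hlt y hy.1 hys).ne hy.2
    simpa using convexHull_mono h2 h1

lemma convexHull_setOf_isExposed {P : Set E}
    (hP : ∃ S : Finset E, P = convexHull ℝ (S : Set E)) :
    convexHull ℝ {v | IsExposed ℝ P {v}} = P := by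
  obtain ⟨S, hS, hexp⟩ := exists_finset_forall_isExposed hP
  refine Set.Subset.antisymm (convexHull_min (fun v hv => ?_) (hS ▸ convex_convexHull ℝ _)) ?_
  · exact (hv : IsExposed ℝ P {v}).subset rfl
  · conv_lhs => rw [hS]
    exact convexHull_mono hexp

lemma eq_or_eq_of_mem_convexHull_pair {P : Set E} {u v z : E} (hz : IsExposed ℝ P {z}) (hu : u ∈ P)
    (hv : v ∈ P) (h : z ∈ convexHull ℝ {u, v}) : z = u ∨ z = v := by
  obtain ⟨l, hl⟩ := hz (Set.singleton_nonempty z)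
  have hzP : z ∈ {x ∈ P | ∀ y ∈ P, l y ≤ l x} := hl ▸ Set.mem_singleton z
  have hle : ∀ s ∈ ({u, v} : Set E), l s ≤ l z := by
    rintro s (rfl | rfl)
    · exact hzP.2 _ hu
    · exact hzP.2 _ hv
  obtain ⟨s, hs, hsz⟩ := convexHull_nonempty_iff.1 ⟨z, mem_convexHull_of_apply_eq l hle h rfl⟩
  have hsP : s ∈ P := by
    rcases hs with rfl | rfl
    · exact hu
    · exact hv
  have : s ∈ ({z} : Set E) := by
    rw [hl]
    exact ⟨hsP, fun y hy => hsz ▸ hzP.2 y hy⟩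
  rw [Set.mem_singleton_iff] at this
  subst this
  exact hs

variable {X : Type*} {p : X → E} {P : Set E}

lemma IsExposed.isConfigFace {B : Set E} (hB : IsExposed ℝ P B) (hne : B.Nonempty)
    (hp : ∀ x, p x ∈ P) {F : Finset X} (hF : ∀ x, x ∈ F ↔ p x ∈ B) :
    IsConfigFace (fun x => affineEval (p x)) F := by
  obtain ⟨l, hl⟩ := hB hne
  obtain ⟨b, hb⟩ := hne
  have hb' : b ∈ {x ∈ P | ∀ y ∈ P, l y ≤ l x} := hl ▸ hb
  have hval : ∀ x, affineEval (p x) (-l, l b) = l b - l (p x) := fun x => by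
    rw [affineEval_apply]
    change -l (p x) + l b = _
    ring
  refine ⟨(-l, l b), fun x => ?_, fun x => ?_⟩
  · rw [hval]
    exact sub_nonneg.2 (hb'.2 _ (hp x))
  · rw [hval, hF, hl, sub_eq_zero]
    exact ⟨fun h => le_antisymm (h.2 b hb'.1) (hb'.2 _ h.1),
      fun h => ⟨hp x, fun y hy => h ▸ hb'.2 y hy⟩⟩

lemma IsConfigFace.isExposed_convexHull (hP : convexHull ℝ (range p) = P) {F : Finset X}
    (hF : IsConfigFace (fun x => affineEval (p x)) F) (hne : F.Nonempty) :
    IsExposed ℝ P (convexHull ℝ (p '' F)) ∧ ∀ x, p x ∈ convexHull ℝ (p '' F) ↔ x ∈ F := by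
  obtain ⟨⟨f, c⟩, hl, hlF⟩ := hF
  simp only [affineEval_apply] at hl hlF
  have hle : ∀ s ∈ range p, (-f) s ≤ c := by
    rintro _ ⟨x, rfl⟩
    have := hl x
    change -f (p x) ≤ c
    linarith
  have hset : {s ∈ range p | (-f) s = c} = p '' F := by
    ext s
    constructor
    · rintro ⟨⟨x, rfl⟩, hx⟩
      change -f (p x) = c at hx
      exact ⟨x, (hlF x).2 (by linarith), rfl⟩
    · rintro ⟨x, hx, rfl⟩
      have := (hlF x).1 hx
      refine ⟨⟨x, rfl⟩, ?_⟩
      change -f (p x) = c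
      linarith
  have hsub : convexHull ℝ (p '' F) ⊆ {x | (-f) x = c} := by
    rw [← hset]
    exact convexHull_min (fun s hs => hs.2) (convex_hyperplane (-f).toLinearMap.isLinear c)
  constructor
  · rintro -
    obtain ⟨a, ha⟩ := hne
    have haF : p a ∈ convexHull ℝ (p '' F) := subset_convexHull ℝ _ ⟨a, ha, rfl⟩
    have haP : p a ∈ P := hP ▸ subset_convexHull ℝ _ ⟨a, rfl⟩
    refine ⟨-f, Set.Subset.antisymm (fun x hx => ⟨?_, fun y hy => ?_⟩) ?_⟩
    · exact hP ▸ convexHull_mono (image_subset_range _ _) hx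
    · rw [show (-f) x = c from hsub hx]
      exact apply_le_of_mem_convexHull _ hle (hP ▸ hy)
    · rintro x ⟨hx, hmax⟩
      rw [← hP] at hx
      rw [← hset]
      refine mem_convexHull_of_apply_eq _ hle hx
        (le_antisymm (apply_le_of_mem_convexHull _ hle hx) ?_)
      rw [← show (-f) (p a) = c from hsub haF]
      exact hmax _ haP
  · intro x
    refine ⟨fun h => (hlF x).2 ?_, fun h => subset_convexHull ℝ _ ⟨x, h, rfl⟩⟩
    have : -f (p x) = c := hsub h
    linarith

lemma IsExposed.eq_convexHull_image (hP : convexHull ℝ (range p) = P) {B : Set E}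
    (hB : IsExposed ℝ P B) (hne : B.Nonempty) {F : Finset X} (hF : ∀ x, x ∈ F ↔ p x ∈ B) :
    B = convexHull ℝ (p '' F) := by
  have hBconv : Convex ℝ B := hB.convex (hP ▸ convex_convexHull ℝ _)
  refine Set.Subset.antisymm (fun x hx => ?_) (convexHull_min ?_ hBconv)
  · obtain ⟨l, hl⟩ := hB hne
    have hx' : x ∈ {x ∈ P | ∀ y ∈ P, l y ≤ l x} := hl ▸ hx
    have hpP : ∀ y, p y ∈ P := fun y => hP ▸ subset_convexHull ℝ _ ⟨y, rfl⟩
    have hle : ∀ s ∈ range p, l s ≤ l x := by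
      rintro _ ⟨y, rfl⟩
      exact hx'.2 _ (hpP y)
    refine convexHull_mono ?_ (mem_convexHull_of_apply_eq l hle (hP ▸ hx'.1) rfl)
    rintro _ ⟨⟨y, rfl⟩, hy⟩
    refine ⟨y, (hF y).2 ?_, rfl⟩
    rw [hl]
    exact ⟨hpP y, fun z hz => hy ▸ hx'.2 z hz⟩
  · rintro _ ⟨y, hy, rfl⟩
    exact (hF y).1 hy

variable [FiniteDimensional ℝ E]

lemma finrank_strongDual : Module.finrank ℝ (E →L[ℝ] ℝ) = Module.finrank ℝ E := by
  rw [← (LinearMap.toContinuousLinearMap (𝕜 := ℝ) (E := E) (F' := ℝ)).finrank_eq]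
  exact Subspace.dual_finrank_eq

lemma configRank_affineEval {F : Finset X} (hF : F.Nonempty) :
    configRank (fun x => affineEval (p x)) F = Module.finrank ℝ (vectorSpan ℝ (p '' F)) + 1 := by
  obtain ⟨a, ha⟩ := hF
  let φ : (E →L[ℝ] ℝ) × ℝ →ₗ[ℝ] Module.Dual ℝ E :=
    (ContinuousLinearMap.coeLM ℝ).comp (LinearMap.fst ℝ (E →L[ℝ] ℝ) ℝ)
  set K := commonKer (fun x => affineEval (p x)) F with hK
  have hmemK : ∀ l, l ∈ K ↔ ∀ x ∈ F, l.1 (p x) + l.2 = 0 := fun l => Iff.rfl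
  have hinj : Function.Injective (φ.domRestrict K) := by
    rw [← LinearMap.ker_eq_bot, LinearMap.ker_eq_bot']
    rintro ⟨l, hl⟩ h
    have h1 : l.1 = 0 := by
      ext x
      exact congrArg (fun g : Module.Dual ℝ E => g x) h
    have h2 : l.2 = 0 := by
      have := (hmemK l).1 hl a ha
      rwa [h1, zero_apply, zero_add] at this
    exact Subtype.ext (Prod.ext h1 h2)
  have hrange : LinearMap.range (φ.domRestrict K) = (vectorSpan ℝ (p '' F)).dualAnnihilator := by
    rw [vectorSpan_eq_span_vsub_set_right ℝ (mem_image_of_mem p (Finset.mem_coe.2 ha))]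
    ext g
    rw [Submodule.mem_dualAnnihilator]
    constructor
    · rintro ⟨⟨l, hl⟩, rfl⟩ w hw
      refine (Submodule.span_le (p := LinearMap.ker (φ l))).2 ?_ hw
      rintro _ ⟨_, ⟨x, hx, rfl⟩, rfl⟩
      have h1 := (hmemK l).1 hl a ha
      have h2 := (hmemK l).1 hl x hx
      change l.1 (p x - p a) = 0
      rw [map_sub]
      linarith
    · intro h
      refine ⟨⟨(LinearMap.toContinuousLinearMap g, -g (p a)), fun x hx => ?_⟩, rfl⟩
      have := h (p x -ᵥ p a) (Submodule.subset_span ⟨p x, ⟨x, hx, rfl⟩, rfl⟩)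
      rw [vsub_eq_sub, map_sub] at this
      change g (p x) + -g (p a) = 0
      linarith
  have h1 := LinearMap.finrank_range_of_inj hinj
  rw [hrange] at h1
  have h2 := Subspace.finrank_add_finrank_dualAnnihilator_eq (vectorSpan ℝ (p '' (F : Set X)))
  have h3 := configRank_add_finrank (ev := fun x => affineEval (p x)) F
  rw [Module.finrank_prod, finrank_strongDual, Module.finrank_self, ← hK] at h3
  omega

end Polytopes

section TwoNeighborly

variable {N : ℕ} {P : Set (Fin N → ℝ)}

lemma pdim_convexHull_image_add_one {X : Type*} {p : X → Fin N → ℝ} {F : Finset X}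
    (hF : F.Nonempty) :
    pdim (convexHull ℝ (p '' F)) + 1 = configRank (fun x => affineEval (p x)) F := by
  rw [configRank_affineEval hF, pdim, affineSpan_convexHull, direction_affineSpan]

lemma isConfigFace_pair (hnb : TwoNeighborly P) [DecidableEq (vertexSet P)] (x y : vertexSet P) :
    IsConfigFace (fun v : vertexSet P => affineEval v.1) {x, y} := by
  have hsub : ∀ v : vertexSet P, v.1 ∈ P := fun v => (v.2 : IsExposed ℝ P {v.1}).subset rfl
  by_cases hxy : x = y
  · subst hxy
    refine (x.2 : IsExposed ℝ P {x.1}).isConfigFace (singleton_nonempty _) hsub fun z => ?_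
    simp [Subtype.ext_iff]
  · refine (hnb x.1 y.1 x.2 y.2 (fun h => hxy (Subtype.ext h))).1.isConfigFace
      (convexHull_nonempty_iff.2 ⟨x.1, by simp⟩) hsub fun z => ?_
    rw [Finset.mem_insert, Finset.mem_singleton]
    constructor
    · rintro (rfl | rfl)
      · exact subset_convexHull ℝ _ (by simp)
      · exact subset_convexHull ℝ _ (by simp)
    · intro h
      rcases eq_or_eq_of_mem_convexHull_pair z.2 (hsub x) (hsub y) h with h | h
      · exact Or.inl (Subtype.ext h)
      · exact Or.inr (Subtype.ext h)

lemma isConfigFace_empty {E X : Type*} [NormedAddCommGroup E] [NormedSpace ℝ E] (p : X → E) :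
    IsConfigFace (fun x => affineEval (p x)) ∅ :=
  ⟨(0, 1), fun x => by simp [affineEval_apply], fun x => by simp [affineEval_apply]⟩

lemma facetSet_finite [Finite (vertexSet P)]
    (hP : convexHull ℝ (range fun v : vertexSet P => v.1) = P) : (facetSet P).Finite := by
  classical
  have := Fintype.ofFinite (vertexSet P)
  refine (Set.finite_range fun F : Finset (vertexSet P) =>
    convexHull ℝ ((fun v : vertexSet P => v.1) '' F)).subset ?_
  rintro B ⟨hB, hne, -⟩
  exact ⟨Finset.univ.filter fun v => v.1 ∈ B,
    (hB.eq_convexHull_image hP hne fun x => by simp).symm⟩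

end TwoNeighborly

/-- Every 2-neighborly 6-polytope with at least 13 vertices has at least
17 facets. -/
theorem two_neighborly_six_polytope_bound
    {N : ℕ} (P : Set (Fin N → ℝ))
    (hP : IsPolytope P) (hdim : pdim P = 6) (hnb : TwoNeighborly P)
    (hv : 13 ≤ (vertexSet P).ncard) :
    17 ≤ (facetSet P).ncard := by
  classical
  have hfin : Finite (vertexSet P) := Set.finite_of_ncard_ne_zero (by omega)
  have := Fintype.ofFinite (vertexSet P)
  let p : vertexSet P → Fin N → ℝ := fun v => v.1
  have hhull : convexHull ℝ (range p) = P := by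
    rw [Subtype.range_coe]
    exact convexHull_setOf_isExposed hP
  have hcard : 13 ≤ (Finset.univ : Finset (vertexSet P)).card := by
    rwa [Finset.card_univ, ← Nat.card_eq_fintype_card, Nat.card_coe_set_eq]
  let S := neighborlySystemOfConfig (fun x => affineEval (p x)) (isConfigFace_empty p)
    (isConfigFace_pair hnb)
  have hface : ∀ F, F ∈ S.faces ↔ IsConfigFace (fun x => affineEval (p x)) F := fun F =>
    Finset.mem_filter_univ _
  have hrank : ∀ F : Finset (vertexSet P), F.Nonempty →
      pdim (convexHull ℝ (p '' F)) + 1 = S.rk F := fun F hF => pdim_convexHull_image_add_one hF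
  have huniv : Finset.univ ∈ S.faces := (hface _).2 ⟨0, fun x => by simp, fun x => by simp⟩
  have hnum : 17 ≤ S.num ∅ Finset.univ 6 := by
    refine NeighborlySystem.seventeen_le_num huniv ?_ hcard
    rw [← hrank _ (Finset.card_pos.1 (by omega)), Finset.coe_univ, image_univ, hhull, hdim]
  have hpos : ∀ F ∈ S.between ∅ Finset.univ 6, F.Nonempty := fun F hF => by
    rw [Finset.nonempty_iff_ne_empty]
    rintro rfl
    have := (NeighborlySystem.mem_between.1 hF).2.2.2
    rw [S.rk_empty] at this
    omega
  have hexp : ∀ F ∈ S.between ∅ Finset.univ 6, _ := fun F hF =>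
    ((hface F).1 (NeighborlySystem.mem_between.1 hF).1).isExposed_convexHull hhull (hpos F hF)
  have hmaps : (fun F : Finset (vertexSet P) => convexHull ℝ (p '' F)) ''
      (S.between ∅ Finset.univ 6 : Set (Finset (vertexSet P))) ⊆ facetSet P := by
    rintro _ ⟨F, hF, rfl⟩
    have h1 := hrank F (hpos F hF)
    rw [(NeighborlySystem.mem_between.1 hF).2.2.2] at h1
    exact ⟨(hexp F hF).1, convexHull_nonempty_iff.2 ((hpos F hF).to_set.image p), by
      change pdim (convexHull ℝ (p '' F)) + 1 = _
      rw [h1, hdim]⟩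
  have hinj : InjOn (fun F : Finset (vertexSet P) => convexHull ℝ (p '' F))
      (S.between ∅ Finset.univ 6 : Set (Finset (vertexSet P))) := by
    intro F hF G hG hFG
    ext x
    rw [← (hexp F hF).2 x, ← (hexp G hG).2 x, show convexHull ℝ (p '' F) = _ from hFG]
  have hle := ncard_le_ncard hmaps (facetSet_finite hhull)
  rw [hinj.ncard_image, ncard_coe_finset] at hle
  have : (17 : ℤ) ≤ (S.between ∅ Finset.univ 6).card := hnum
  omega
end

section
/- If P is a 2-neighborly 4-polytope with at most 14 facets, then the pair (number of vertices of P, number of facets of P) is (5, 5), (6, 9), or (7, 14). -/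
open Set

section TwoNeighborlyConfigurations

variable {ι E : Type*} [AddCommGroup E] [Module ℝ E] {w : ι → E}

/-- Every pair of points of the configuration `w` (possibly equal) is cut out by a
supporting hyperplane at height `1`. -/
def PairsExposed (w : ι → E) : Prop :=
  ∀ i j, ∃ l : Module.Dual ℝ E, l (w i) = 1 ∧ l (w j) = 1 ∧ ∀ k, k ≠ i → k ≠ j → l (w k) < 1

/-- `T` indexes the points of `w` on a supporting hyperplane at height `1`, and has four elements. -/
def IsFacetIndex (w : ι → E) (T : Finset ι) : Prop :=
  T.card = 4 ∧ ∃ l : Module.Dual ℝ E, (∀ i, l (w i) ≤ 1) ∧ ∀ i, l (w i) = 1 ↔ i ∈ T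

lemma PairsExposed.eq_zero_of_card_pos_le_two (h : PairsExposed w) (T : Finset ι) (f : ι → ℝ)
    (hf : ∑ i ∈ T, f i = 0) (hfw : ∑ i ∈ T, f i • w i = 0)
    (hc : (T.filter (fun i => 0 < f i)).card ≤ 2) : ∀ i ∈ T, f i = 0 := by
  classical
  by_cases hpos : (T.filter (fun i => 0 < f i)) = ∅
  · have hle : ∀ i ∈ T, f i ≤ 0 := by
      intro i hi
      by_contra hlt
      have : i ∈ T.filter (fun i => 0 < f i) := by simp [hi, not_le.mp hlt]
      simp [hpos] at this
    exact (Finset.sum_eq_zero_iff_of_nonpos hle).1 hf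
  obtain ⟨i, j, hij⟩ : ∃ i j, T.filter (fun i => 0 < f i) = {i, j} := by
    have h0 : (T.filter (fun i => 0 < f i)).card ≠ 0 := by simpa using hpos
    obtain h1 | h2 : (T.filter (fun i => 0 < f i)).card = 1 ∨
        (T.filter (fun i => 0 < f i)).card = 2 := by omega
    · obtain ⟨i, hi⟩ := Finset.card_eq_one.1 h1
      exact ⟨i, i, by simpa using hi⟩
    · obtain ⟨i, j, -, hi⟩ := Finset.card_eq_two.1 h2
      exact ⟨i, j, hi⟩
  obtain ⟨l, li, lj, hl⟩ := h i j
  have hsum : ∑ k ∈ T, f k * (1 - l (w k)) = 0 := by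
    have := congrArg l hfw
    simp only [map_sum, map_smul, smul_eq_mul, map_zero] at this
    simp only [mul_sub, mul_one, Finset.sum_sub_distrib, hf, this, sub_zero]
  have hmem : ∀ k, k ≠ i → k ≠ j → k ∈ T → f k ≤ 0 := by
    intro k h1 h2 hk
    by_contra hlt
    have : k ∈ T.filter (fun i => 0 < f i) := by simp [hk, not_le.mp hlt]
    rw [hij] at this
    simp [h1, h2] at this
  have hnp : ∀ k ∈ T, f k * (1 - l (w k)) ≤ 0 := by
    intro k hk
    by_cases h1 : k = i
    · simp [h1, li]
    by_cases h2 : k = j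
    · simp [h2, lj]
    exact mul_nonpos_of_nonpos_of_nonneg (hmem k h1 h2 hk) (by linarith [hl k h1 h2])
  have hz := (Finset.sum_eq_zero_iff_of_nonpos hnp).1 hsum
  have hnn : ∀ k ∈ T, 0 ≤ f k := by
    intro k hk
    by_cases hm : k ∈ T.filter (fun i => 0 < f i)
    · exact (Finset.mem_filter.1 hm).2.le
    · rw [hij] at hm
      simp only [Finset.mem_insert, Finset.mem_singleton, not_or] at hm
      have := hl k hm.1 hm.2
      rcases mul_eq_zero.1 (hz k hk) with h0 | h0
      · exact h0.ge
      · linarith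
  exact (Finset.sum_eq_zero_iff_of_nonneg hnn).1 hf

lemma PairsExposed.linearIndepOn_of_card_le_five (h : PairsExposed w) (T : Finset ι)
    (hT : T.card ≤ 5) (l : Module.Dual ℝ E) (hl : ∀ i ∈ T, l (w i) = 1) :
    LinearIndepOn ℝ w (T : Set ι) := by
  classical
  rw [linearIndepOn_finset_iff]
  intro f hfw
  have hf : ∑ i ∈ T, f i = 0 := by
    have := congrArg l hfw
    simp only [map_sum, map_smul, smul_eq_mul, map_zero] at this
    rw [← this]
    exact Finset.sum_congr rfl fun i hi => by rw [hl i hi, mul_one]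
  have hcard : (T.filter (fun i => 0 < f i)).card + (T.filter (fun i => 0 < -f i)).card ≤ 5 := by
    rw [← Finset.card_union_of_disjoint]
    · refine (Finset.card_le_card ?_).trans hT
      exact Finset.union_subset (Finset.filter_subset _ _) (Finset.filter_subset _ _)
    · rw [Finset.disjoint_filter]
      intro i _ h1
      linarith
  rcases le_or_gt (T.filter (fun i => 0 < f i)).card 2 with h2 | h2
  · exact h.eq_zero_of_card_pos_le_two T f hf hfw h2
  · have := h.eq_zero_of_card_pos_le_two T (fun i => - f i) (by simp [hf])
      (by simp [hfw]) (by omega)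
    simpa using this

lemma PairsExposed.card_le_four (h : PairsExposed w) (hE : Module.finrank ℝ E = 4) (T : Finset ι)
    (l : Module.Dual ℝ E) (hl : ∀ i ∈ T, l (w i) = 1) : T.card ≤ 4 := by
  by_contra hT
  obtain ⟨U, hU, hU5⟩ := Finset.exists_subset_card_eq (s := T) (n := 5) (by omega)
  have hli := h.linearIndepOn_of_card_le_five U hU5.le l fun i hi => hl i (hU hi)
  have : FiniteDimensional ℝ E := Module.finite_of_finrank_pos (by omega)
  have := LinearIndependent.fintype_card_le_finrank hli
  simp [hU5, hE] at this

lemma exists_pos_of_sum_eq_zero [Fintype ι] (hsum : ∑ i, w i = 0) (hspan : Submodule.span ℝ (range w) = ⊤)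
    (m : Module.Dual ℝ E) (hm : m ≠ 0) : ∃ i, 0 < m (w i) := by
  by_contra! hle
  apply hm
  have h0 : ∑ i, m (w i) = 0 := by rw [← map_sum, hsum, map_zero]
  have hz := (Finset.sum_eq_zero_iff_of_nonpos (fun i _ => hle i)).1 h0
  refine LinearMap.ext_on_range hspan fun i => ?_
  simpa using hz i (Finset.mem_univ i)

/-- Rotate a supporting hyperplane until it meets a further point of the configuration. -/
lemma exists_tight_pivot [Fintype ι] (l m : Module.Dual ℝ E) (hl : ∀ i, l (w i) ≤ 1)
    (hm : ∀ i, l (w i) = 1 → m (w i) ≤ 0) (hpos : ∃ i, 0 < m (w i)) :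
    ∃ t : ℝ, 0 < t ∧ (∀ i, (l + t • m) (w i) ≤ 1) ∧
      ∃ i, 0 < m (w i) ∧ (l + t • m) (w i) = 1 := by
  classical
  have hne : (Finset.univ.filter (fun i => 0 < m (w i))).Nonempty := by
    obtain ⟨i, hi⟩ := hpos
    exact ⟨i, by simp [hi]⟩
  obtain ⟨j, hj, hmin⟩ := Finset.exists_min_image _ (fun i => (1 - l (w i)) / m (w i)) hne
  simp only [Finset.mem_filter, Finset.mem_univ, true_and] at hj hmin
  have hlj : l (w j) < 1 := lt_of_le_of_ne (hl j) fun he => by linarith [hm j he]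
  have ht : 0 < (1 - l (w j)) / m (w j) := div_pos (by linarith) hj
  refine ⟨(1 - l (w j)) / m (w j), ht, fun i => ?_, j, hj, ?_⟩
  · simp only [LinearMap.add_apply, LinearMap.smul_apply, smul_eq_mul]
    rcases lt_or_ge 0 (m (w i)) with h | h
    · have := (le_div_iff₀ h).1 (hmin i h)
      linarith
    · have := hl i
      nlinarith
  · simp only [LinearMap.add_apply, LinearMap.smul_apply, smul_eq_mul]
    field_simp
    ring

lemma PairsExposed.exists_isFacetIndex_superset [Fintype ι] (h : PairsExposed w)
    (hE : Module.finrank ℝ E = 4)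
    (hsum : ∑ i, w i = 0) (hspan : Submodule.span ℝ (range w) = ⊤) (G : Finset ι)
    (l : Module.Dual ℝ E) (hl : ∀ i, l (w i) ≤ 1) (hG : ∀ i ∈ G, l (w i) = 1) :
    ∃ T, IsFacetIndex w T ∧ G ⊆ T := by
  classical
  have hcard : (Finset.univ.filter (fun i => l (w i) = 1)).card ≤ 4 :=
    h.card_le_four hE _ l (by simp)
  induction hk : 4 - (Finset.univ.filter (fun i => l (w i) = 1)).card
    using Nat.strong_induction_on generalizing l with
  | _ k ih =>
    rcases Nat.eq_zero_or_pos k with rfl | hk0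
    · exact ⟨Finset.univ.filter (fun i => l (w i) = 1), ⟨by omega, l, hl, by simp⟩,
        fun i hi => by simp [hG i hi]⟩
    have : FiniteDimensional ℝ E := Module.finite_of_finrank_pos (by omega)
    set T := Finset.univ.filter (fun i => l (w i) = 1) with hT
    have hlt : Submodule.span ℝ ((T.image w : Finset E) : Set E) < ⊤ := by
      refine lt_top_iff_ne_top.2 fun he => ?_
      have h1 := finrank_span_finset_le_card (R := ℝ) (T.image w)
      have h2 : (T.image w).card ≤ T.card := Finset.card_image_le
      rw [Set.finrank, he, finrank_top] at h1
      omega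
    obtain ⟨m, hm0, hm⟩ := Submodule.exists_le_ker_of_lt_top _ hlt
    have hmT : ∀ i, l (w i) = 1 → m (w i) = 0 := fun i hi =>
      hm (Submodule.subset_span (by simp only [Finset.coe_image]; exact ⟨i, by simp [hT, hi], rfl⟩))
    obtain ⟨t, ht, hle, j, hj, hj1⟩ := exists_tight_pivot l m hl (fun i hi => (hmT i hi).le)
      (exists_pos_of_sum_eq_zero hsum hspan m hm0)
    have hsub : insert j T ⊆ Finset.univ.filter (fun i => (l + t • m) (w i) = 1) := by
      intro i hi
      rcases Finset.mem_insert.1 hi with rfl | hi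
      · simpa using hj1
      · have : l (w i) = 1 := by simpa [hT] using hi
        simp [this, hmT i this]
    have hjT : j ∉ T := by
      intro hj'
      have := hmT j (by simpa [hT] using hj')
      linarith
    have hc := Finset.card_le_card hsub
    rw [Finset.card_insert_of_notMem hjT] at hc
    have h4 : (Finset.univ.filter (fun i => (l + t • m) (w i) = 1)).card ≤ 4 :=
      h.card_le_four hE _ (l + t • m) (fun i hi => (Finset.mem_filter.1 hi).2)
    refine ih _ ?_ (l + t • m) hle (fun i hi => ?_) h4 rfl
    · omega
    have := hG i hi
    simp [this, hmT i this]

lemma IsFacetIndex.linearIndepOn (h : PairsExposed w) {T : Finset ι} (hT : IsFacetIndex w T) :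
    LinearIndepOn ℝ w (T : Set ι) := by
  obtain ⟨hc, l, -, hl⟩ := hT
  exact h.linearIndepOn_of_card_le_five T (by omega) l fun i hi => (hl i).2 hi

lemma IsFacetIndex.span_eq_top (h : PairsExposed w) (hE : Module.finrank ℝ E = 4)
    {T : Finset ι} (hT : IsFacetIndex w T) : Submodule.span ℝ (w '' T) = ⊤ := by
  have : FiniteDimensional ℝ E := Module.finite_of_finrank_pos (by omega)
  have hli : LinearIndependent ℝ (fun i : (T : Set ι) => w i) := hT.linearIndepOn h
  have := hli.span_eq_top_of_card_eq_finrank' (by simp [hE, hT.1])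
  rwa [Set.range_comp' w, Subtype.range_coe] at this

lemma IsFacetIndex.exists_adjacent [Fintype ι] [DecidableEq ι] (h : PairsExposed w) (hE : Module.finrank ℝ E = 4)
    (hsum : ∑ i, w i = 0) (hspan : Submodule.span ℝ (range w) = ⊤)
    {T : Finset ι} (hT : IsFacetIndex w T) {a : ι} (ha : a ∈ T) :
    ∃ T', IsFacetIndex w T' ∧ T.erase a ⊆ T' ∧ a ∉ T' := by
  have hli : LinearIndependent ℝ (fun i : (T : Set ι) => w i) := hT.linearIndepOn h
  have hsp : ⊤ ≤ Submodule.span ℝ (Set.range fun i : (T : Set ι) => w i) := by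
    rw [Set.range_comp' w, Subtype.range_coe, hT.span_eq_top h hE]
  let m : Module.Dual ℝ E :=
    (Module.Basis.mk hli hsp).constr ℝ fun i => if (i : ι) = a then (-1 : ℝ) else 0
  have hm : ∀ i ∈ T, m (w i) = if i = a then -1 else 0 := by
    intro i hi
    have := (Module.Basis.mk hli hsp).constr_basis ℝ
      (fun i => if (i : ι) = a then (-1 : ℝ) else 0) ⟨i, hi⟩
    simpa [m] using this
  have hma : m (w a) = -1 := by simp [hm a ha]
  obtain ⟨hc, l, hl, hlT⟩ := hT
  have hm0 : m ≠ 0 := fun h0 => by simp [h0] at hma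
  obtain ⟨t, ht, hle, j, hj, hj1⟩ := exists_tight_pivot l m hl
    (fun i hi => by rw [hm i ((hlT i).1 hi)]; split_ifs <;> norm_num)
    (exists_pos_of_sum_eq_zero hsum hspan m hm0)
  have hjT : j ∉ T := fun hj' => by
    rw [hm j hj'] at hj
    split_ifs at hj <;> norm_num at hj
  have hsub : insert j (T.erase a) ⊆ Finset.univ.filter (fun i => (l + t • m) (w i) = 1) := by
    intro i hi
    rcases Finset.mem_insert.1 hi with rfl | hi
    · simpa using hj1
    · obtain ⟨hia, hiT⟩ := Finset.mem_erase.1 hi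
      simp [(hlT i).2 hiT, hm i hiT, hia]
  have hcard := Finset.card_le_card hsub
  rw [Finset.card_insert_of_notMem (fun hj' => hjT (Finset.mem_of_mem_erase hj')),
    Finset.card_erase_of_mem ha] at hcard
  have h4 : (Finset.univ.filter (fun i => (l + t • m) (w i) = 1)).card ≤ 4 :=
    h.card_le_four hE _ (l + t • m) (fun i hi => (Finset.mem_filter.1 hi).2)
  refine ⟨Finset.univ.filter (fun i => (l + t • m) (w i) = 1),
    ⟨by omega, l + t • m, hle, by simp⟩,
    (Finset.subset_insert _ _).trans hsub, fun ha' => ?_⟩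
  have := (Finset.mem_filter.1 ha').2
  simp only [LinearMap.add_apply, LinearMap.smul_apply, smul_eq_mul, (hlT a).2 ha, hma] at this
  linarith

/-- Generic points have no vanishing coordinate with respect to any facet. -/
lemma PairsExposed.exists_generic [Finite ι] (h : PairsExposed w) (hE : Module.finrank ℝ E = 4) :
    ∃ (c : E) (f : Finset ι → ι → ℝ), ∀ T, IsFacetIndex w T →
      ∑ i ∈ T, f T i • w i = c ∧ ∀ i ∈ T, f T i ≠ 0 := by
  classical
  have : FiniteDimensional ℝ E := Module.finite_of_finrank_pos (by omega)
  have := Fintype.ofFinite ι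
  let s : Finset (Submodule ℝ E) :=
    (Finset.univ.filter fun U : Finset ι => U.card = 3).image fun U =>
      Submodule.span ℝ ((U.image w : Finset E) : Set E)
  have hs : ⊤ ∉ s := by
    simp only [s, Finset.mem_image, Finset.mem_filter, Finset.mem_univ, true_and, not_exists,
      not_and]
    intro U hU he
    have h1 := finrank_span_finset_le_card (R := ℝ) (U.image w)
    have h2 : (U.image w).card ≤ U.card := Finset.card_image_le
    rw [Set.finrank, he, finrank_top] at h1
    omega
  obtain ⟨c, hc⟩ := (Set.ne_univ_iff_exists_notMem _).1
    (Subspace.biUnion_ne_univ_of_top_notMem hs)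
  have hex : ∀ T, ∃ f : ι → ℝ, IsFacetIndex w T → ∑ i ∈ T, f i • w i = c := by
    intro T
    by_cases hT : IsFacetIndex w T
    · have hmem : c ∈ Submodule.span ℝ (w '' T) := by simp [hT.span_eq_top h hE]
      obtain ⟨f, hf⟩ := (Submodule.mem_span_image_finset_iff_exists_fun' ℝ).1 hmem
      exact ⟨f, fun _ => hf⟩
    · exact ⟨0, fun h => absurd h hT⟩
  choose f hf using hex
  refine ⟨c, f, fun T hT => ⟨hf T hT, fun a ha h0 => hc ?_⟩⟩
  simp only [Set.mem_iUnion, exists_prop]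
  refine ⟨Submodule.span ℝ (((T.erase a).image w : Finset E) : Set E), ?_, ?_⟩
  · simp only [s, Finset.mem_image, Finset.mem_filter, Finset.mem_univ, true_and]
    exact ⟨T.erase a, by rw [Finset.card_erase_of_mem ha, hT.1], rfl⟩
  · have := hf T hT
    rw [← Finset.add_sum_erase T _ ha, h0, zero_smul, zero_add] at this
    rw [SetLike.mem_coe, ← this]
    exact Submodule.sum_mem _ fun i hi => Submodule.smul_mem _ _
      (Submodule.subset_span (by simpa using ⟨i, by simpa [and_comm] using hi, rfl⟩))

lemma PairsExposed.existsUnique_isFacetIndex [Fintype ι] [DecidableEq ι] (h : PairsExposed w)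
    (hE : Module.finrank ℝ E = 4)
    (hsum : ∑ i, w i = 0) (hspan : Submodule.span ℝ (Set.range w) = ⊤)
    (c : E) (f : Finset ι → ι → ℝ)
    (hf : ∀ T, IsFacetIndex w T → ∑ i ∈ T, f T i • w i = c ∧ ∀ i ∈ T, f T i ≠ 0)
    (G : Finset ι) (hG : ∃ T, IsFacetIndex w T ∧ G ⊆ T) :
    ∃! T, IsFacetIndex w T ∧ T.filter (fun i => f T i < 0) ⊆ G ∧ G ⊆ T := by
  have hval : ∀ T, IsFacetIndex w T → ∀ l : Module.Dual ℝ E,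
      l c = ∑ i ∈ T, f T i * l (w i) := by
    intro T hT l
    rw [← (hf T hT).1]
    simp
  have hvalT : ∀ T, IsFacetIndex w T → ∀ l : Module.Dual ℝ E, (∀ i, l (w i) = 1 ↔ i ∈ T) →
      l c = ∑ i ∈ T, f T i := by
    intro T hT l hl
    rw [hval T hT l]
    exact Finset.sum_congr rfl fun i hi => by rw [(hl i).2 hi, mul_one]
  have hle : ∀ T T', IsFacetIndex w T → IsFacetIndex w T' →
      T.filter (fun i => f T i < 0) ⊆ G → G ⊆ T' → T ≠ T' →
      ∑ i ∈ T', f T' i < ∑ i ∈ T, f T i := by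
    intro T T' hT hT' hn hG' hne
    obtain ⟨hc', l', hl', hlT'⟩ := hT'
    rw [← hvalT T' ⟨hc', l', hl', hlT'⟩ l' hlT', hval T hT l']
    obtain ⟨a, ha, ha'⟩ : ∃ a ∈ T, a ∉ T' := by
      by_contra! hsub
      exact hne (Finset.eq_of_subset_of_card_le hsub (by rw [hT.1, hc']))
    have hpos : ∀ i ∈ T, i ∉ T' → 0 < f T i := by
      intro i hi hi'
      refine lt_of_le_of_ne (not_lt.1 fun hlt => hi' (hG' (hn ?_))) ((hf T hT).2 i hi).symm
      exact Finset.mem_filter.2 ⟨hi, hlt⟩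
    refine Finset.sum_lt_sum (fun i hi => ?_) ⟨a, ha, ?_⟩
    · by_cases hi' : i ∈ T'
      · rw [(hlT' i).2 hi', mul_one]
      · nlinarith [hpos i hi hi', hl' i]
    · have : l' (w a) < 1 := lt_of_le_of_ne (hl' a) fun h1 => ha' ((hlT' a).1 h1)
      nlinarith [hpos a ha ha']
  classical
  let s : Finset (Finset ι) := Finset.univ.filter fun T => IsFacetIndex w T ∧ G ⊆ T
  have hs : s.Nonempty := by
    obtain ⟨T, hT⟩ := hG
    exact ⟨T, by simpa [s] using hT⟩
  obtain ⟨T, hTs, hmax⟩ := Finset.exists_max_image s (fun T => ∑ i ∈ T, f T i) hs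
  obtain ⟨hT, hGT⟩ : IsFacetIndex w T ∧ G ⊆ T := by simpa [s] using hTs
  have hneg : T.filter (fun i => f T i < 0) ⊆ G := by
    intro a ha
    obtain ⟨haT, hlt⟩ := Finset.mem_filter.1 ha
    by_contra haG
    obtain ⟨T', hT', hsub, haT'⟩ := hT.exists_adjacent h hE hsum hspan haT
    have hGT' : G ⊆ T' := fun i hi =>
      hsub (Finset.mem_erase.2 ⟨fun he => haG (he ▸ hi), hGT hi⟩)
    have hm := hmax T' (by simpa [s] using ⟨hT', hGT'⟩)
    obtain ⟨hc', l', hl', hlT'⟩ := id hT'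
    have h1 : ∑ i ∈ T, f T i < ∑ i ∈ T, f T i * l' (w i) := by
      refine Finset.sum_lt_sum (fun i hi => ?_) ⟨a, haT, ?_⟩
      · by_cases hia : i = a
        · subst hia
          nlinarith [hl' i]
        · rw [(hlT' i).2 (hsub (Finset.mem_erase.2 ⟨hia, hi⟩)), mul_one]
      · have : l' (w a) < 1 := lt_of_le_of_ne (hl' a) fun h1 => haT' ((hlT' a).1 h1)
        nlinarith
    rw [← hval T hT, hvalT T' hT' l' hlT'] at h1
    exact absurd hm (not_le.2 h1)
  refine ⟨T, ⟨hT, hneg, hGT⟩, ?_⟩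
  rintro T' ⟨hT', hneg', hGT'⟩
  by_contra hne
  exact lt_asymm (hle T T' hT hT' hneg hGT' (Ne.symm hne)) (hle T' T hT' hT hneg' hGT hne)

lemma PairsExposed.choose_eq_sum [Fintype ι] [DecidableEq ι] (h : PairsExposed w)
    (hE : Module.finrank ℝ E = 4)
    (hsum : ∑ i, w i = 0) (hspan : Submodule.span ℝ (Set.range w) = ⊤)
    (c : E) (f : Finset ι → ι → ℝ)
    (hf : ∀ T, IsFacetIndex w T → ∑ i ∈ T, f T i • w i = c ∧ ∀ i ∈ T, f T i ≠ 0)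
    (k : ℕ) (hk : k ≤ 2) (s : Finset (Finset ι)) (hs : ∀ T, T ∈ s ↔ IsFacetIndex w T) :
    (Fintype.card ι).choose k = ∑ T ∈ s, if (T.filter (fun i => f T i < 0)).card ≤ k then
      (4 - (T.filter (fun i => f T i < 0)).card).choose
        (k - (T.filter (fun i => f T i < 0)).card) else 0 := by
  have hface : ∀ G : Finset ι, G.card ≤ 2 → ∃ T, IsFacetIndex w T ∧ G ⊆ T := by
    intro G hG
    obtain ⟨l, hl, hlG⟩ : ∃ l : Module.Dual ℝ E, (∀ i, l (w i) ≤ 1) ∧ ∀ i ∈ G, l (w i) = 1 := by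
      by_cases h0 : G.card = 0
      · rw [Finset.card_eq_zero] at h0
        exact ⟨0, by simp, by simp [h0]⟩
      obtain ⟨i, j, rfl⟩ : ∃ i j, G = {i, j} := by
        obtain h1 | h2 : G.card = 1 ∨ G.card = 2 := by omega
        · obtain ⟨i, hi⟩ := Finset.card_eq_one.1 h1
          exact ⟨i, i, by simpa using hi⟩
        · obtain ⟨i, j, -, hi⟩ := Finset.card_eq_two.1 h2
          exact ⟨i, j, hi⟩
      obtain ⟨l, li, lj, hl⟩ := h i j
      refine ⟨l, fun k => ?_, by simp [li, lj]⟩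
      by_cases h1 : k = i
      · rw [h1, li]
      by_cases h2 : k = j
      · rw [h2, lj]
      exact (hl k h1 h2).le
    exact h.exists_isFacetIndex_superset hE hsum hspan G l hl hlG
  have hone : ∀ G ∈ Finset.univ.powersetCard k,
      (s.filter fun T => T.filter (fun i => f T i < 0) ⊆ G ∧ G ⊆ T).card = 1 := by
    intro G hG
    have hGk := (Finset.mem_powersetCard.1 hG).2
    obtain ⟨T, hT, huniq⟩ := h.existsUnique_isFacetIndex hE hsum hspan c f hf G
      (hface G (by omega))
    refine Finset.card_eq_one.2 ⟨T, ?_⟩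
    ext T'
    simp only [Finset.mem_filter, Finset.mem_singleton, hs]
    exact ⟨huniq T', fun he => he ▸ hT⟩
  calc (Fintype.card ι).choose k
      = ∑ G ∈ Finset.univ.powersetCard k,
          (s.filter fun T => T.filter (fun i => f T i < 0) ⊆ G ∧ G ⊆ T).card := by
        rw [Finset.sum_congr rfl hone]; simp
    _ = ∑ T ∈ s, ((Finset.univ.powersetCard k).filter fun G =>
          T.filter (fun i => f T i < 0) ⊆ G ∧ G ⊆ T).card :=
        Finset.sum_card_bipartiteAbove_eq_sum_card_bipartiteBelow _
    _ = _ := by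
        refine Finset.sum_congr rfl fun T hT => ?_
        have hT4 := ((hs T).1 hT).1
        have heq : ((Finset.univ.powersetCard k).filter fun G =>
            T.filter (fun i => f T i < 0) ⊆ G ∧ G ⊆ T) =
            (T.powersetCard k).filter (T.filter (fun i => f T i < 0) ⊆ ·) := by
          ext G
          simp only [Finset.mem_filter, Finset.mem_powersetCard, Finset.subset_univ, true_and]
          tauto
        rw [heq]
        split_ifs with hle
        · rw [Finset.card_filter_powersetCard_subset _ _ _ (Finset.filter_subset _ _) hle, hT4]
        · rw [Finset.card_eq_zero, Finset.filter_eq_empty_iff]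
          intro G hG hsub
          have := Finset.card_le_card hsub
          rw [(Finset.mem_powersetCard.1 hG).2] at this
          exact hle this

/-- The number of facets of a configuration of `n` points in dimension `4` in which all pairs
are exposed is `n.choose 2 - n`. -/
lemma PairsExposed.card_facets [Fintype ι] (h : PairsExposed w)
    (hE : Module.finrank ℝ E = 4)
    (hsum : ∑ i, w i = 0) (hspan : Submodule.span ℝ (Set.range w) = ⊤)
    (s : Finset (Finset ι)) (hs : ∀ T, T ∈ s ↔ IsFacetIndex w T) :
    s.card + Fintype.card ι = (Fintype.card ι).choose 2 := by
  classical
  obtain ⟨c, f, hf⟩ := h.exists_generic hE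
  have hf' : ∀ T, IsFacetIndex w T →
      ∑ i ∈ T, (fun T i => - f T i) T i • w i = -c ∧ ∀ i ∈ T, (fun T i => - f T i) T i ≠ 0 := by
    intro T hT
    simpa using hf T hT
  have a0 := h.choose_eq_sum hE hsum hspan c f hf 0 (by norm_num) s hs
  have a1 := h.choose_eq_sum hE hsum hspan c f hf 1 (by norm_num) s hs
  have a2 := h.choose_eq_sum hE hsum hspan c f hf 2 (by norm_num) s hs
  have b0 := h.choose_eq_sum hE hsum hspan (-c) (fun T i => - f T i) hf' 0 (by norm_num) s hs
  have b1 := h.choose_eq_sum hE hsum hspan (-c) (fun T i => - f T i) hf' 1 (by norm_num) s hs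
  have hrev : ∀ T ∈ s, (T.filter (fun i => f T i < 0)).card +
      (T.filter (fun i => - f T i < 0)).card = 4 := by
    intro T hT
    have hT' := (hs T).1 hT
    rw [← hT'.1, ← Finset.card_filter_add_card_filter_not (s := T) (fun i => f T i < 0)]
    congr 2
    refine Finset.filter_congr fun i hi => ?_
    have := (hf T hT').2 i hi
    rw [not_lt, neg_lt_zero]
    exact ⟨le_of_lt, fun h => lt_of_le_of_ne h this.symm⟩
  have key : s.card + 2 * (Fintype.card ι).choose 1 + 3 * (Fintype.card ι).choose 0 =
      (Fintype.card ι).choose 2 + 3 * (Fintype.card ι).choose 0 + (Fintype.card ι).choose 1 := by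
    nth_rewrite 1 [a1]
    nth_rewrite 1 [b0]
    rw [a2, b1, a0, Finset.card_eq_sum_ones]
    simp only [Finset.mul_sum, ← Finset.sum_add_distrib]
    refine Finset.sum_congr rfl fun T hT => ?_
    have hpq := hrev T hT
    generalize (T.filter (fun i => f T i < 0)).card = p at hpq ⊢
    generalize (T.filter (fun i => - f T i < 0)).card = q at hpq ⊢
    obtain rfl : q = 4 - p := by omega
    have hp4 : p ≤ 4 := by omega
    interval_cases p <;> simp [Nat.choose]
  simp only [Nat.choose_one_right] at key
  omega

end TwoNeighborlyConfigurations
section Polytopes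

variable {N : ℕ}

lemma le_of_mem_convexHull {A : Set (Fin N → ℝ)} (g : (Fin N → ℝ) →ₗ[ℝ] ℝ) (M : ℝ)
    (hg : ∀ s ∈ A, g s ≤ M) : ∀ x ∈ convexHull ℝ A, g x ≤ M :=
  fun _ hx => convexHull_min hg (convex_halfSpace_le g.isLinear M) hx

/-- The face of a polytope maximizing a functional is spanned by the maximizing generators. -/
lemma argmax_convexHull (S : Finset (Fin N → ℝ)) (g : (Fin N → ℝ) →ₗ[ℝ] ℝ) (M : ℝ)
    (hg : ∀ s ∈ S, g s ≤ M) (hM : ∃ s ∈ S, g s = M) :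
    {x ∈ convexHull ℝ (S : Set (Fin N → ℝ)) | ∀ y ∈ convexHull ℝ (S : Set (Fin N → ℝ)), g y ≤ g x} =
      convexHull ℝ {s | s ∈ S ∧ g s = M} := by
  classical
  obtain ⟨s₀, hs₀, hs₀M⟩ := hM
  ext x
  constructor
  · rintro ⟨hx, hmax⟩
    have hxM : g x = M := le_antisymm (le_of_mem_convexHull g M hg x hx)
      (hs₀M ▸ hmax s₀ (subset_convexHull ℝ _ hs₀))
    obtain ⟨a, ha0, ha1, hax⟩ := Finset.mem_convexHull'.1 hx
    have hzero : ∑ s ∈ S, a s * (M - g s) = 0 := by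
      have := congrArg g hax
      simp only [map_sum, map_smul, smul_eq_mul] at this
      simp only [mul_sub, Finset.sum_sub_distrib, ← Finset.sum_mul, ha1, this, hxM]
      ring
    have hz := (Finset.sum_eq_zero_iff_of_nonneg
      (fun s hs => mul_nonneg (ha0 s hs) (sub_nonneg.2 (hg s hs)))).1 hzero
    have hoff : ∀ s ∈ S, s ∉ S.filter (fun s => g s = M) → a s = 0 := by
      intro s hs hs'
      refine (mul_eq_zero.1 (hz s hs)).resolve_right fun h0 => hs' ?_
      exact Finset.mem_filter.2 ⟨hs, by linarith⟩
    have hcoe : {s | s ∈ S ∧ g s = M} =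
        ((S.filter (fun s => g s = M) : Finset (Fin N → ℝ)) : Set (Fin N → ℝ)) := by
      ext; simp
    rw [hcoe, Finset.mem_convexHull']
    refine ⟨a, fun s hs => ha0 s (Finset.mem_of_mem_filter s hs), ?_, ?_⟩
    · rw [← ha1]
      exact Finset.sum_subset (Finset.filter_subset _ _) hoff
    · rw [← hax]
      exact Finset.sum_subset (Finset.filter_subset _ _) fun s hs hs' => by
        rw [hoff s hs hs', zero_smul]
  · intro hx
    have hxM : M ≤ g x := by
      have := le_of_mem_convexHull (A := {s | s ∈ S ∧ g s = M}) (-g) (-M)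
        (fun s hs => by simp [hs.2]) x hx
      simpa using this
    exact ⟨convexHull_mono (fun s hs => hs.1) hx,
      fun y hy => (le_of_mem_convexHull g M hg y hy).trans hxM⟩

/-- A polytope is the convex hull of its vertices, which are finitely many points in convex
position. -/
lemma IsPolytope.exists_vertices {P : Set (Fin N → ℝ)} (hP : IsPolytope P) :
    ∃ S : Finset (Fin N → ℝ), P = convexHull ℝ (S : Set (Fin N → ℝ)) ∧
      vertexSet P = (S : Set (Fin N → ℝ)) ∧
      ∀ s ∈ S, s ∉ convexHull ℝ ((S : Set (Fin N → ℝ)) \ {s}) := by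
  classical
  obtain ⟨S, hS, hmin⟩ := exists_minimalFor_of_wellFoundedLT
    (fun S : Finset (Fin N → ℝ) => P = convexHull ℝ (S : Set (Fin N → ℝ))) Finset.card hP
  have hconv : ∀ s ∈ S, s ∉ convexHull ℝ ((S : Set (Fin N → ℝ)) \ {s}) := by
    intro s hs hmem
    have hPS : P = convexHull ℝ ((S.erase s : Finset (Fin N → ℝ)) : Set (Fin N → ℝ)) := by
      rw [hS, Finset.coe_erase]
      refine subset_antisymm (convexHull_min (fun t ht => ?_) (convex_convexHull ℝ _))
        (convexHull_mono Set.sdiff_subset)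
      by_cases hts : t = s
      · exact hts ▸ hmem
      · exact subset_convexHull ℝ _ ⟨ht, hts⟩
    have h1 := hmin hPS (Finset.card_le_card (Finset.erase_subset s S))
    have h2 := Finset.card_erase_lt_of_mem hs
    omega
  refine ⟨S, hS, ?_, hconv⟩
  ext v
  constructor
  · intro hv
    obtain ⟨g, hg⟩ := hv (Set.singleton_nonempty v)
    have hvP : v ∈ P := by
      have : v ∈ ({v} : Set (Fin N → ℝ)) := rfl
      rw [hg] at this
      exact this.1
    have hne : S.Nonempty := by
      rw [hS] at hvP
      simpa using convexHull_nonempty_iff.1 ⟨v, hvP⟩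
    obtain ⟨s, hs, hmax⟩ := Finset.exists_max_image S g hne
    have hsv : s ∈ ({v} : Set (Fin N → ℝ)) := by
      rw [hg]
      subst hS
      exact ⟨subset_convexHull ℝ _ hs, le_of_mem_convexHull g.toLinearMap (g s) hmax⟩
    rw [Set.mem_singleton_iff] at hsv
    exact hsv ▸ hs
  · intro hv _
    have hcl : IsClosed (convexHull ℝ ((S : Set (Fin N → ℝ)) \ {v})) :=
      (Set.Finite.isCompact_convexHull ℝ S.finite_toSet.sdiff).isClosed
    obtain ⟨g, u, hgu, huv⟩ := geometric_hahn_banach_closed_point (convex_convexHull ℝ _) hcl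
      (hconv v hv)
    have hlt : ∀ s ∈ S, s ≠ v → g s < g v := fun s hs hne =>
      (hgu s (subset_convexHull ℝ _ ⟨hs, hne⟩)).trans huv
    refine ⟨g, ?_⟩
    have := argmax_convexHull S g.toLinearMap (g v)
      (fun s hs => by
        by_cases h : s = v
        · simp [h]
        · exact (hlt s hs h).le) ⟨v, hv, rfl⟩
    rw [hS]
    refine Eq.trans ?_ this.symm
    have hset : {s | s ∈ S ∧ g.toLinearMap s = g v} = {v} := by
      ext s
      simp only [Set.mem_ofPred_eq, Set.mem_singleton_iff]
      refine ⟨fun ⟨h1, h2⟩ => ?_, fun h => by subst h; exact ⟨hv, rfl⟩⟩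
      by_contra hne
      exact absurd h2 (hlt s h1 hne).ne
    rw [hset, convexHull_singleton]

lemma pdim_convexHull (A : Set (Fin N → ℝ)) :
    pdim (convexHull ℝ A) = Module.finrank ℝ (vectorSpan ℝ A) := by
  rw [pdim, affineSpan_convexHull, direction_affineSpan]

/-- A finite point set, translated to have centroid `0`, as a spanning configuration. -/
lemma exists_centered (S : Finset (Fin N → ℝ)) (hS : S.Nonempty) :
    ∃ (p : Fin N → ℝ) (w : S → vectorSpan ℝ (S : Set (Fin N → ℝ))),
      (∀ i, (w i : Fin N → ℝ) = i - p) ∧ ∑ i, w i = 0 ∧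
      Submodule.span ℝ (Set.range w) = ⊤ := by
  have hc : (S.card : ℝ) ≠ 0 := by exact_mod_cast hS.card_pos.ne'
  set p : Fin N → ℝ := ∑ s ∈ S, (S.card : ℝ)⁻¹ • s with hp
  have hpmem : p ∈ convexHull ℝ (S : Set (Fin N → ℝ)) :=
    (convex_convexHull ℝ _).sum_mem (fun _ _ => by positivity) (by simp [hc])
      fun s hs => subset_convexHull ℝ _ hs
  have hmem : ∀ i : S, (i : Fin N → ℝ) - p ∈ vectorSpan ℝ (S : Set (Fin N → ℝ)) := by
    intro i
    rw [← direction_affineSpan]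
    exact AffineSubspace.vsub_mem_direction (subset_affineSpan ℝ _ i.2)
      (convexHull_subset_affineSpan _ hpmem)
  refine ⟨p, fun i => ⟨i - p, hmem i⟩, fun _ => rfl, ?_, ?_⟩
  · apply Subtype.ext
    simp only [Submodule.coe_sum, Submodule.coe_zero, Finset.sum_sub_distrib, Finset.sum_const,
      Finset.card_univ, Fintype.card_coe]
    rw [Finset.sum_coe_sort S (fun s => s), hp, ← Finset.smul_sum, ← Nat.cast_smul_eq_nsmul ℝ,
      smul_smul, mul_inv_cancel₀ hc, one_smul, sub_self]
  · apply Submodule.map_injective_of_injective (Submodule.injective_subtype _)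
    rw [Submodule.map_span, Submodule.map_top, Submodule.range_subtype]
    refine le_antisymm (Submodule.span_le.2 ?_) (Submodule.span_le.2 ?_)
    · rintro _ ⟨_, ⟨i, rfl⟩, rfl⟩
      exact hmem i
    · rintro _ ⟨s, hs, t, ht, rfl⟩
      have h1 : ∀ r (hr : r ∈ S), r - p ∈ Submodule.span ℝ
          ((vectorSpan ℝ (S : Set (Fin N → ℝ))).subtype '' Set.range
            fun i : S => (⟨i - p, hmem i⟩ : vectorSpan ℝ (S : Set (Fin N → ℝ)))) :=
        fun r hr => Submodule.subset_span ⟨_, ⟨⟨r, hr⟩, rfl⟩, rfl⟩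
      have := Submodule.sub_mem _ (h1 s hs) (h1 t ht)
      simpa using this

/-- A non-constant functional can be rescaled so that its supporting hyperplane has height `1`. -/
lemma exists_normalized_dual {S : Finset (Fin N → ℝ)} {p : Fin N → ℝ}
    {w : S → vectorSpan ℝ (S : Set (Fin N → ℝ))} (hw : ∀ i, (w i : Fin N → ℝ) = i - p)
    (hsum : ∑ i, w i = 0) (g : (Fin N → ℝ) →ₗ[ℝ] ℝ) (M : ℝ) (hg : ∀ s ∈ S, g s ≤ M)
    (hlt : ∃ s ∈ S, g s < M) :
    ∃ l : Module.Dual ℝ (vectorSpan ℝ (S : Set (Fin N → ℝ))),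
      ∀ i, l (w i) ≤ 1 ∧ (l (w i) = 1 ↔ g i = M) := by
  have hgp : g p < M := by
    have h0 : ∑ i : S, (g i - g p) = 0 := by
      have := congrArg (fun x => g (Submodule.subtype _ x)) hsum
      simpa only [map_sum, Submodule.subtype_apply, hw, map_sub, map_zero] using this
    obtain ⟨s, hs, hsM⟩ := hlt
    by_contra! hge
    have : ∑ i : S, (g i - g p) < ∑ i : S, (0 : ℝ) :=
      Finset.sum_lt_sum (fun i _ => by linarith [hg i i.2]) ⟨⟨s, hs⟩, Finset.mem_univ _, by
        simp only; linarith⟩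
    rw [h0, Finset.sum_const_zero] at this
    exact lt_irrefl _ this
  have hpos : 0 < M - g p := sub_pos.2 hgp
  refine ⟨(M - g p)⁻¹ • (g ∘ₗ Submodule.subtype _), fun i => ?_⟩
  have hval : ((M - g p)⁻¹ • (g ∘ₗ Submodule.subtype _)) (w i) = (g i - g p) / (M - g p) := by
    simp [hw, div_eq_inv_mul]
  rw [hval, div_le_one hpos, div_eq_one_iff_eq hpos.ne']
  exact ⟨by linarith [hg i i.2], by constructor <;> intro h <;> linarith⟩

lemma TwoNeighborly.pairsExposed {P : Set (Fin N → ℝ)} (hnb : TwoNeighborly P)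
    {S : Finset (Fin N → ℝ)} (hPS : P = convexHull ℝ (S : Set (Fin N → ℝ)))
    (hV : vertexSet P = (S : Set (Fin N → ℝ)))
    (hconv : ∀ s ∈ S, s ∉ convexHull ℝ ((S : Set (Fin N → ℝ)) \ {s})) (hcard : 3 ≤ S.card)
    {p : Fin N → ℝ} {w : S → vectorSpan ℝ (S : Set (Fin N → ℝ))}
    (hw : ∀ i, (w i : Fin N → ℝ) = i - p) (hsum : ∑ i, w i = 0) : PairsExposed w := by
  classical
  intro i j
  have hvert : ∀ i : S, IsVertex P i := fun i => by
    have : (i : Fin N → ℝ) ∈ vertexSet P := by rw [hV]; exact i.2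
    exact this
  have hexp : IsExposed ℝ P (convexHull ℝ {(i : Fin N → ℝ), (j : Fin N → ℝ)}) := by
    by_cases hij : (i : Fin N → ℝ) = j
    · rw [hij, Set.pair_eq_singleton, convexHull_singleton]
      exact hvert j
    · exact (hnb i j (hvert i) (hvert j) hij).1
  obtain ⟨g, hg⟩ := hexp ⟨i, subset_convexHull ℝ _ (by simp)⟩
  have hi : (i : Fin N → ℝ) ∈ {x ∈ P | ∀ y ∈ P, g y ≤ g x} :=
    hg ▸ subset_convexHull ℝ _ (by simp)
  have hj : (j : Fin N → ℝ) ∈ {x ∈ P | ∀ y ∈ P, g y ≤ g x} :=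
    hg ▸ subset_convexHull ℝ _ (by simp)
  have hSP : ∀ s ∈ S, s ∈ P := fun s hs => hPS ▸ subset_convexHull ℝ _ hs
  have hlt : ∀ k : S, k ≠ i → k ≠ j → g k < g i := by
    intro k hki hkj
    refine lt_of_le_of_ne (hi.2 k (hSP k k.2)) fun he => hconv k k.2 ?_
    have hk : (k : Fin N → ℝ) ∈ convexHull ℝ {(i : Fin N → ℝ), (j : Fin N → ℝ)} := by
      rw [hg]
      exact ⟨hSP k k.2, fun y hy => he ▸ hi.2 y hy⟩
    refine convexHull_mono ?_ hk
    rintro x (rfl | rfl)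
    · exact ⟨i.2, fun h => hki (Subtype.ext h.symm)⟩
    · exact ⟨j.2, fun h => hkj (Subtype.ext h.symm)⟩
  obtain ⟨k, hk⟩ : ∃ k, k ∉ ({i, j} : Finset S) := by
    by_contra! hall
    have h1 : Fintype.card S ≤ ({i, j} : Finset S).card :=
      Finset.card_le_card fun k _ => hall k
    have h2 := Finset.card_le_two (a := i) (b := j)
    rw [Fintype.card_coe] at h1
    omega
  simp only [Finset.mem_insert, Finset.mem_singleton, not_or] at hk
  obtain ⟨l, hl⟩ := exists_normalized_dual hw hsum g.toLinearMap (g i)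
    (fun s hs => hi.2 s (hSP s hs)) ⟨k, k.2, hlt k hk.1 hk.2⟩
  refine ⟨l, (hl i).2.2 rfl,
    (hl j).2.2 (le_antisymm (hi.2 j hj.1) (hj.2 i hi.1)), fun m hmi hmj => ?_⟩
  exact lt_of_le_of_ne (hl m).1 fun h => (hlt m hmi hmj).ne ((hl m).2.1 h)

lemma IsFacetIndex.finrank_vectorSpan {S : Finset (Fin N → ℝ)} {p : Fin N → ℝ}
    {w : S → vectorSpan ℝ (S : Set (Fin N → ℝ))} (hw : ∀ i, (w i : Fin N → ℝ) = i - p)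
    (h : PairsExposed w) {T : Finset S} (hT : IsFacetIndex w T) :
    Module.finrank ℝ (vectorSpan ℝ (Subtype.val '' (T : Set S) : Set (Fin N → ℝ))) = 3 := by
  have hli : LinearIndependent ℝ (fun i : T => w i) := hT.linearIndepOn h
  have hai : AffineIndependent ℝ (fun i : T => ((i : S) : Fin N → ℝ)) := by
    rw [affineIndependent_iff]
    intro s a ha0 ha
    refine linearIndependent_iff'.1 hli s a ?_
    apply Subtype.ext
    simp [hw, smul_sub, Finset.sum_sub_distrib, ha, ← Finset.sum_smul, ha0]
  have hr := hai.finrank_vectorSpan (n := 3) (by simp [hT.1])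
  rwa [Set.range_comp' (Subtype.val : S → (Fin N → ℝ)), show (Set.range fun i : T => (i : S)) = T from
    Subtype.range_coe] at hr

/-- Facets of a 2-neighborly 4-polytope correspond to facet index sets of its centered vertex
configuration. -/
lemma facetSet_eq_image {P : Set (Fin N → ℝ)} (hdim : pdim P = 4)
    {S : Finset (Fin N → ℝ)} (hPS : P = convexHull ℝ (S : Set (Fin N → ℝ)))
    {p : Fin N → ℝ} {w : S → vectorSpan ℝ (S : Set (Fin N → ℝ))}
    (hw : ∀ i, (w i : Fin N → ℝ) = i - p) (hsum : ∑ i, w i = 0) (h : PairsExposed w) :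
    facetSet P = (fun T : Finset S => convexHull ℝ (Subtype.val '' (T : Set S))) ''
        {T | IsFacetIndex w T} ∧
      Set.InjOn (fun T : Finset S => convexHull ℝ (Subtype.val '' (T : Set S) : Set (Fin N → ℝ)))
        {T | IsFacetIndex w T} := by
  classical
  subst hPS
  have hE : Module.finrank ℝ (vectorSpan ℝ (S : Set (Fin N → ℝ))) = 4 := by
    rw [← pdim_convexHull, hdim]
  have hext : ∀ T, IsFacetIndex w T → ∃ (g : (Fin N → ℝ) →ₗ[ℝ] ℝ) (M : ℝ),
      ∀ i : S, g i ≤ M ∧ (g i = M ↔ i ∈ T) := by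
    rintro T ⟨-, l, hl, hlT⟩
    obtain ⟨g, hg⟩ := l.exists_extend
    have hgl : ∀ i : S, l (w i) = g i - g p := fun i => by
      rw [← hg, LinearMap.comp_apply, Submodule.subtype_apply, hw, map_sub]
    refine ⟨g, g p + 1, fun i => ⟨by linarith [hl i, hgl i], ?_⟩⟩
    rw [← hlT i, hgl]
    constructor <;> intro h <;> linarith
  have hset : ∀ (T : Finset S) (g : (Fin N → ℝ) →ₗ[ℝ] ℝ) (M : ℝ), (∀ i : S, g i = M ↔ i ∈ T) →
      {s | s ∈ S ∧ g s = M} = Subtype.val '' (T : Set S) := by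
    intro T g M hgT
    ext s
    constructor
    · rintro ⟨hs, hsM⟩
      exact ⟨⟨s, hs⟩, (hgT ⟨s, hs⟩).1 hsM, rfl⟩
    · rintro ⟨i, hi, rfl⟩
      exact ⟨i.2, (hgT i).2 hi⟩
  constructor
  · ext F
    constructor
    · rintro ⟨hexp, hne, hF⟩
      obtain ⟨g, hg⟩ := hexp hne
      have hSne : S.Nonempty := by
        obtain ⟨x, hx⟩ := hne
        rw [hg] at hx
        simpa using convexHull_nonempty_iff.1 ⟨x, hx.1⟩
      obtain ⟨s₀, hs₀, hmax⟩ := Finset.exists_max_image S g hSne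
      let T : Finset S := Finset.univ.filter fun i => g i = g s₀
      have hFT : F = convexHull ℝ (Subtype.val '' (T : Set S)) := by
        rw [← hset T g.toLinearMap (g s₀) (by simp [T]), hg]
        exact argmax_convexHull S g.toLinearMap (g s₀) hmax ⟨s₀, hs₀, rfl⟩
      have hlt : ∃ s ∈ S, g s < g s₀ := by
        by_contra! hge
        have : (Subtype.val '' (T : Set S)) = (S : Set (Fin N → ℝ)) := by
          rw [← hset T g.toLinearMap (g s₀) (by simp [T])]
          ext s
          exact ⟨fun hs => hs.1, fun hs => ⟨hs, le_antisymm (hmax s hs) (hge s hs)⟩⟩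
        rw [hFT, this] at hF
        omega
      obtain ⟨l, hl⟩ := exists_normalized_dual hw hsum g.toLinearMap (g s₀) hmax hlt
      have hlT : ∀ i, l (w i) = 1 ↔ i ∈ T := fun i => by
        rw [(hl i).2]
        simp [T]
      refine ⟨T, ⟨le_antisymm ?_ ?_, l, fun i => (hl i).1, hlT⟩, hFT.symm⟩
      · exact h.card_le_four hE T l fun i hi => (hlT i).2 hi
      · rw [hFT, pdim_convexHull, hdim] at hF
        have hTpos : 0 < T.card := Finset.card_pos.2 ⟨⟨s₀, hs₀⟩, by simp [T]⟩
        have hle := finrank_vectorSpan_image_finset_le ℝ (Subtype.val : S → (Fin N → ℝ)) T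
          (n := T.card - 1) (by omega)
        rw [Finset.coe_image] at hle
        omega
    · rintro ⟨T, hT, rfl⟩
      obtain ⟨g, M, hg⟩ := hext T hT
      have hTne : T.Nonempty := Finset.card_pos.1 (by rw [hT.1]; norm_num)
      obtain ⟨i, hi⟩ := hTne
      refine ⟨fun _ => ⟨LinearMap.toContinuousLinearMap g, ?_⟩,
        ⟨i, subset_convexHull ℝ _ ⟨i, hi, rfl⟩⟩, ?_⟩
      · have := argmax_convexHull S g M (fun s hs => (hg ⟨s, hs⟩).1) ⟨i, i.2, (hg i).2.2 hi⟩
        rw [hset T g M fun i => (hg i).2] at this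
        simpa using this.symm
      · rw [hdim, pdim_convexHull, hT.finrank_vectorSpan hw h]
  · have hsub : ∀ T T', IsFacetIndex w T → IsFacetIndex w T' →
        convexHull ℝ (Subtype.val '' (T : Set S) : Set (Fin N → ℝ)) =
          convexHull ℝ (Subtype.val '' (T' : Set S)) → T ⊆ T' := by
      intro T T' _ hT' he i hi
      obtain ⟨g, M, hg⟩ := hext T' hT'
      have hmem : (i : Fin N → ℝ) ∈ convexHull ℝ (Subtype.val '' (T' : Set S)) :=
        he ▸ subset_convexHull ℝ _ ⟨i, hi, rfl⟩
      have := le_of_mem_convexHull (-g) (-M) (fun s hs => by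
        obtain ⟨j, hj, rfl⟩ := hs
        simp [(hg j).2.2 hj]) _ hmem
      exact (hg i).2.1 (le_antisymm (hg i).1 (by simpa using this))
    intro T hT T' hT' he
    exact Finset.Subset.antisymm (hsub T T' hT hT' he) (hsub T' T hT' hT he.symm)

end Polytopes

/-- If `P` is a 2-neighborly 4-polytope with at most 14 facets, then the pair
(number of vertices, number of facets) of `P` is `(5, 5)`, `(6, 9)`, or `(7, 14)`. -/
theorem two_neighborly_four_polytope_classification
    {N : ℕ} (P : Set (Fin N → ℝ))
    (hP : IsPolytope P) (hdim : pdim P = 4) (hnb : TwoNeighborly P)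
    (hf : (facetSet P).ncard ≤ 14) :
    ((vertexSet P).ncard, (facetSet P).ncard) = (5, 5) ∨
    ((vertexSet P).ncard, (facetSet P).ncard) = (6, 9) ∨
    ((vertexSet P).ncard, (facetSet P).ncard) = (7, 14) := by
  classical
  obtain ⟨S, hPS, hV, hconv⟩ := hP.exists_vertices
  have hE : Module.finrank ℝ (vectorSpan ℝ (S : Set (Fin N → ℝ))) = 4 := by
    rw [← pdim_convexHull, ← hPS, hdim]
  have hSne : S.Nonempty := by
    by_contra hne
    rw [Finset.not_nonempty_iff_eq_empty] at hne
    have hbot : vectorSpan ℝ (S : Set (Fin N → ℝ)) = ⊥ := by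
      rw [hne, Finset.coe_empty, vectorSpan_empty]
    rw [hbot, finrank_bot] at hE
    omega
  have hcard : 5 ≤ S.card := by
    have hpos := hSne.card_pos
    have := finrank_vectorSpan_image_finset_le ℝ (id : (Fin N → ℝ) → (Fin N → ℝ)) S
      (n := S.card - 1) (by omega)
    rw [Finset.image_id, hE] at this
    omega
  obtain ⟨p, w, hw, hsum, hspan⟩ := exists_centered S hSne
  have hpe := hnb.pairsExposed hPS hV hconv (by omega) hw hsum
  obtain ⟨himage, hinj⟩ := facetSet_eq_image hdim hPS hw hsum hpe
  have hcount := hpe.card_facets hE hsum hspan (Finset.univ.filter fun T => IsFacetIndex w T)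
    (by simp)
  have hfacets : (facetSet P).ncard =
      (Finset.univ.filter fun T : Finset S => IsFacetIndex w T).card := by
    rw [himage, hinj.ncard_image, ← Set.ncard_coe_finset]
    simp
  have hvertices : (vertexSet P).ncard = S.card := by rw [hV, Set.ncard_coe_finset]
  rw [← hfacets, Fintype.card_coe] at hcount
  have h7 : S.card ≤ 7 := by
    by_contra! h8
    have h1 := Nat.triangle_succ (S.card - 1)
    rw [Nat.choose_two_right] at hcount
    have h2 : S.card * 7 ≤ S.card * (S.card - 1) := Nat.mul_le_mul_left _ (by omega)
    omega
  rw [hvertices]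
  interval_cases S.card <;> simp [Nat.choose] at hcount <;> simp <;> omega
end
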